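/- Let X be a stationary ergodic process with finite alphabet 𝒳, 𝒳̂ a finite reconstruction alphabet, d : 𝒳 × 𝒳̂ → [0,∞) a distortion function, and let γ1, γ2, γ0, α1, α2, α0 ≥ 0. Let k = k_n and k1 = k_{1,n} satisfy k1 ≤ k, k_n = o(log n), and k_{1,n}, k_n → ∞ as n → ∞. Then almost surely limsup_n min_{(y^n, z^n, w^n) ∈ (𝒳̂^n)^3} ℰ_n(y^n, z^n, w^n) ≥ μ(γ, α), the infimum of γ1 R11 + γ2 R22 + γ0 R0 + α1 D1 + α2 D2 + α0 D0 over all (R11, R22, R0, D1, D2, D0) ∈ ℛ^P. -/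

import Mathlib

open MeasureTheory Filter
open scoped ENNReal

noncomputable def shEntropy {Ω α : Type*} [MeasurableSpace Ω] (μ : Measure Ω)
    [Fintype α] (S : Ω → α) : ℝ :=
  -∑ s : α, ((μ (S ⁻¹' {s})).toReal * Real.logb 2 (μ (S ⁻¹' {s})).toReal)

noncomputable def shCondEntropy {Ω α β : Type*} [MeasurableSpace Ω] (μ : Measure Ω)
    [Fintype α] [Fintype β] (S : Ω → α) (T : Ω → β) : ℝ :=
  shEntropy μ (fun ω => (S ω, T ω)) - shEntropy μ T

/-- The shift on two-sided sequences. -/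
def shiftZ {α : Type*} : (ℤ → α) → (ℤ → α) := fun x n => x (n + 1)

/-- The block `(x_1, …, x_n)` of a two-sided sequence. -/
def blockZ {α : Type*} (n : ℕ) (x : ℤ → α) : Fin n → α := fun i => x ((i : ℕ) + 1)

/-- Entropy rate `H̄ = lim_n H(Y_{n+1} | Y_1,…,Y_n)` of a stationary finite-alphabet
process (written as a `limsup`, which equals the limit whenever the latter exists). -/
noncomputable def entropyRate {α : Type*} [Fintype α] [MeasurableSpace α]
    (ν : Measure (ℤ → α)) : ℝ :=
  limsup (fun n : ℕ => shCondEntropy ν (fun x => x ((n : ℤ) + 1)) (blockZ n)) atTop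

/-- Conditional entropy rate `H̄(W | Y, Z) = lim_n (1/n) H(W^n | Y^n, Z^n)` for a jointly
stationary triple of processes (written as a `limsup`). -/
noncomputable def condEntropyRate {W Y Z : Type*} [Fintype W] [Fintype Y] [Fintype Z]
    [MeasurableSpace W] [MeasurableSpace Y] [MeasurableSpace Z]
    (ν : Measure (ℤ → W × Y × Z)) : ℝ :=
  limsup (fun n : ℕ => (1 / (n : ℝ)) *
    shCondEntropy ν (fun x => fun i : Fin n => (x ((i : ℕ) + 1)).1)
      (fun x => (fun i : Fin n => (x ((i : ℕ) + 1)).2.1,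
                 fun i : Fin n => (x ((i : ℕ) + 1)).2.2))) atTop

/-- Normalized per-letter distortion `d_n`. -/
noncomputable def dn {X Xh : Type*} (d : X → Xh → ℝ) (n : ℕ)
    (a : Fin n → X) (b : Fin n → Xh) : ℝ :=
  (1 / (n : ℝ)) * ∑ i, d (a i) (b i)

/-- Number of indices available with `nR` bits: `⌈2^{nR}⌉`. -/
noncomputable def idxCard (n : ℕ) (R : ℝ) : ℕ := ⌈(2 : ℝ) ^ ((n : ℝ) * R)⌉₊

/-- `(R1, R2, D1, D2, D0)` is block-achievable for the source `μ`. -/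
def BlockAchievable {X Xh : Type*} [MeasurableSpace X]
    (μ : Measure (ℤ → X)) (d : X → Xh → ℝ) (R1 R2 D1 D2 D0 : ℝ) : Prop :=
  ∃ (f : (n : ℕ) → (Fin n → X) → Fin (idxCard n R1) × Fin (idxCard n R2))
    (g1 : (n : ℕ) → Fin (idxCard n R1) → Fin n → Xh)
    (g2 : (n : ℕ) → Fin (idxCard n R2) → Fin n → Xh)
    (g0 : (n : ℕ) → Fin (idxCard n R1) × Fin (idxCard n R2) → Fin n → Xh),
    limsup (fun n : ℕ => ∫ x, dn d n (blockZ n x) (g1 n (f n (blockZ n x)).1) ∂μ) atTop ≤ D1 ∧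
    limsup (fun n : ℕ => ∫ x, dn d n (blockZ n x) (g2 n (f n (blockZ n x)).2) ∂μ) atTop ≤ D2 ∧
    limsup (fun n : ℕ => ∫ x, dn d n (blockZ n x) (g0 n (f n (blockZ n x))) ∂μ) atTop ≤ D0

/-- `(R11, R22, R0, D1, D2, D0)` is stationary-achievable for the source `μ`. -/
def StationaryAchievable {X Xh : Type*} [Fintype X] [Fintype Xh]
    [MeasurableSpace X] [MeasurableSpace Xh]
    (μ : Measure (ℤ → X)) (d : X → Xh → ℝ) (R11 R22 R0 D1 D2 D0 : ℝ) : Prop :=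
  ∀ ε > (0 : ℝ), ∃ ν : Measure (ℤ → X × Xh × Xh × Xh),
    IsProbabilityMeasure ν ∧ Ergodic shiftZ ν ∧
    ν.map (fun x => fun m : ℤ => (x m).1) = μ ∧
    entropyRate (ν.map (fun x => fun m : ℤ => (x m).2.1)) ≤ R11 + ε ∧
    entropyRate (ν.map (fun x => fun m : ℤ => (x m).2.2.1)) ≤ R22 + ε ∧
    condEntropyRate (ν.map (fun x => fun m : ℤ => ((x m).2.2.2, (x m).2.1, (x m).2.2.1)))
      ≤ R0 + ε ∧
    ∫ x, d ((x 0).1) ((x 0).2.1) ∂ν ≤ D1 + ε ∧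
    ∫ x, d ((x 0).1) ((x 0).2.2.1) ∂ν ≤ D2 + ε ∧
    ∫ x, d ((x 0).1) ((x 0).2.2.2) ∂ν ≤ D0 + ε

noncomputable def uniformFin (n : ℕ) : Measure (Fin n) := ((n : ℝ≥0∞))⁻¹ • Measure.count

/-- Cyclic index shift on `Fin n`: `i + t (mod n)`. -/
def cycIdx {n : ℕ} (i : Fin n) (t : ℤ) : Fin n :=
  ⟨(((i : ℕ) + t) % (n : ℤ)).toNat, by
    have hn : 0 < n := i.pos
    have h1 : 0 ≤ (((i : ℕ) : ℤ) + t) % (n : ℤ) :=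
      Int.emod_nonneg _ (by exact_mod_cast hn.ne')
    have h2 : (((i : ℕ) : ℤ) + t) % (n : ℤ) < (n : ℤ) :=
      Int.emod_lt_of_pos _ (by exact_mod_cast hn)
    omega⟩

/-- `k`-th order empirical conditional entropy `H_k(y^n)` (cyclic convention):
the conditional Shannon entropy of `y_i` given `y_{i-k}^{i-1}` when `i` is uniform. -/
noncomputable def empH {Y : Type*} [Fintype Y] (k : ℕ) {n : ℕ} (y : Fin n → Y) : ℝ :=
  shCondEntropy (uniformFin n) (fun i => y i)
    (fun i => fun j : Fin k => y (cycIdx i ((j : ℤ) - (k : ℤ))))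

/-- Empirical conditional entropy `H_{k,k1}(w^n | y^n, z^n)` (cyclic convention):
the conditional Shannon entropy of `w_i` given
`(w_{i-k}^{i-1}, y_{i-k1}^{i+k1}, z_{i-k1}^{i+k1})` when `i` is uniform. -/
noncomputable def empH2 {W Y Z : Type*} [Fintype W] [Fintype Y] [Fintype Z]
    (k k1 : ℕ) {n : ℕ} (w : Fin n → W) (y : Fin n → Y) (z : Fin n → Z) : ℝ :=
  shCondEntropy (uniformFin n) (fun i => w i)
    (fun i => (fun j : Fin k => w (cycIdx i ((j : ℤ) - (k : ℤ))),
               fun j : Fin (2 * k1 + 1) => y (cycIdx i ((j : ℤ) - (k1 : ℤ))),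
               fun j : Fin (2 * k1 + 1) => z (cycIdx i ((j : ℤ) - (k1 : ℤ)))))

/-- The cost functional `ℰ_n` of the universal MD scheme. -/
noncomputable def mdCost {X Xh : Type*} [Fintype Xh] (d : X → Xh → ℝ)
    (γ1 γ2 γ0 α1 α2 α0 : ℝ) (k k1 : ℕ) {n : ℕ}
    (x : ℤ → X) (y z w : Fin n → Xh) : ℝ :=
  γ1 * empH k y + γ2 * empH k z + γ0 * empH2 k k1 w y z +
    α1 * dn d n (blockZ n x) y + α2 * dn d n (blockZ n x) z + α0 * dn d n (blockZ n x) w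

/-- `μ(γ, α)`: the infimum of the weighted rate-distortion combination over the
stationary-achievable region `ℛ^P`. -/
noncomputable def muGA {X Xh : Type*} [Fintype X] [Fintype Xh]
    [MeasurableSpace X] [MeasurableSpace Xh]
    (μ : Measure (ℤ → X)) (d : X → Xh → ℝ) (γ1 γ2 γ0 α1 α2 α0 : ℝ) : ℝ :=
  sInf {v : ℝ | ∃ R11 R22 R0 D1 D2 D0 : ℝ,
    StationaryAchievable μ d R11 R22 R0 D1 D2 D0 ∧
    v = γ1 * R11 + γ2 * R22 + γ0 * R0 + α1 * D1 + α2 * D2 + α0 * D0}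

/-- All fibres of `S` are measurable. -/
def FiberMeasurable {Ω α : Type*} [MeasurableSpace Ω] (S : Ω → α) : Prop :=
  ∀ s, MeasurableSet (S ⁻¹' {s})

namespace FiberMeasurable

variable {Ω α β : Type*} [MeasurableSpace Ω]

lemma preimage [Finite α] {S : Ω → α} (hS : FiberMeasurable S) (A : Set α) :
    MeasurableSet (S ⁻¹' A) := by
  rw [← Set.biUnion_preimage_singleton]
  exact MeasurableSet.biUnion A.to_countable fun s _ => hS s

lemma comp [Finite α] {S : Ω → α} (hS : FiberMeasurable S) (f : α → β) :
    FiberMeasurable (fun ω => f (S ω)) :=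
  fun s => hS.preimage (f ⁻¹' {s})

lemma comp_measurable {Ω' : Type*} [MeasurableSpace Ω'] {S : Ω → α} (hS : FiberMeasurable S)
    {F : Ω' → Ω} (hF : Measurable F) : FiberMeasurable (fun ω => S (F ω)) :=
  fun s => hF (hS s)

lemma prodMk {S : Ω → α} {T : Ω → β} (hS : FiberMeasurable S) (hT : FiberMeasurable T) :
    FiberMeasurable (fun ω => (S ω, T ω)) := by
  rintro ⟨s, t⟩
  convert (hS s).inter (hT t) using 1
  ext ω
  simp [Prod.ext_iff]

lemma pi {ι : Type*} [Countable ι] {S : ι → Ω → α} (hS : ∀ i, FiberMeasurable (S i)) :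
    FiberMeasurable (fun ω i => S i ω) := by
  intro s
  convert MeasurableSet.iInter fun i => hS i (s i) using 1
  ext ω
  simp [funext_iff]

lemma measurable [Finite α] [MeasurableSpace α] {S : Ω → α} (hS : FiberMeasurable S) :
    Measurable S :=
  fun A _ => hS.preimage A

lemma const (c : α) : FiberMeasurable (fun _ : Ω => c) :=
  fun _ => MeasurableSet.const _

lemma measurable_comp [Finite α] [MeasurableSpace β] {S : Ω → α} (hS : FiberMeasurable S)
    (f : α → β) : Measurable (fun ω => f (S ω)) :=
  fun A _ => hS.preimage (f ⁻¹' A)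

lemma integrable_comp [Finite α] {μ : Measure Ω} [IsFiniteMeasure μ] {S : Ω → α}
    (hS : FiberMeasurable S) (f : α → ℝ) : Integrable (fun ω => f (S ω)) μ := by
  obtain ⟨C, hC⟩ := (Set.finite_range fun a => ‖f a‖).bddAbove
  exact Integrable.of_bound (hS.measurable_comp f).aestronglyMeasurable C
    (Eventually.of_forall fun ω => hC ⟨S ω, rfl⟩)

lemma of_measurable [MeasurableSpace α] [MeasurableSingletonClass α] {S : Ω → α}
    (hS : Measurable S) : FiberMeasurable S :=
  fun s => hS (measurableSet_singleton s)

end FiberMeasurable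

section Entropy

variable {Ω α β γ : Type*} [MeasurableSpace Ω] {μ : Measure Ω}

lemma sum_real_mul_eq_integral [Fintype α] [IsFiniteMeasure μ] {S : Ω → α}
    (hS : FiberMeasurable S) (F : α → ℝ) :
    ∑ s, μ.real (S ⁻¹' {s}) * F s = ∫ ω, F (S ω) ∂μ := by
  classical
  have h : (fun ω => F (S ω)) = fun ω => ∑ s, (S ⁻¹' {s}).indicator (fun _ => F s) ω := by
    funext ω
    rw [Finset.sum_eq_single (S ω)]
    · simp
    · intro b _ hb
      simp [Set.indicator, Ne.symm hb]
    · simp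
  rw [h, integral_finsetSum]
  · refine Finset.sum_congr rfl fun s _ => ?_
    rw [integral_indicator_const _ (hS s), smul_eq_mul]
  · intro s _
    exact (integrable_const _).indicator (hS s)

lemma sum_real_fiber [Fintype α] [IsProbabilityMeasure μ] {S : Ω → α}
    (hS : FiberMeasurable S) : ∑ s, μ.real (S ⁻¹' {s}) = 1 := by
  have := sum_real_mul_eq_integral (μ := μ) hS (fun _ => (1 : ℝ))
  simpa using this

lemma sum_real_pair [Fintype α] [IsFiniteMeasure μ] {S : Ω → α} {T : Ω → β}
    (hS : FiberMeasurable S) (hT : FiberMeasurable T) (t : β) :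
    ∑ s, μ.real ((fun ω => (S ω, T ω)) ⁻¹' {(s, t)}) = μ.real (T ⁻¹' {t}) := by
  classical
  rw [← measureReal_biUnion_finset]
  · congr 1
    ext ω
    simp [Prod.ext_iff]
  · intro s _ s' _ h
    refine Set.disjoint_left.2 fun ω h1 h2 => h ?_
    simp only [Set.mem_preimage, Set.mem_singleton_iff, Prod.ext_iff] at h1 h2
    exact h1.1.symm.trans h2.1
  · intro s _
    exact hS.prodMk hT (s, t)

lemma shEntropy_eq [Fintype α] (S : Ω → α) :
    shEntropy μ S = -∑ s, μ.real (S ⁻¹' {s}) * Real.logb 2 (μ.real (S ⁻¹' {s})) := rfl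

lemma shEntropy_comp_equiv [Fintype α] [Fintype β] (S : Ω → α) (e : α ≃ β) :
    shEntropy μ (fun ω => e (S ω)) = shEntropy μ S := by
  rw [shEntropy_eq, shEntropy_eq, ← e.sum_comp]
  congr 1
  refine Finset.sum_congr rfl fun s _ => ?_
  have : (fun ω => e (S ω)) ⁻¹' {e s} = S ⁻¹' {s} := by ext; simp
  rw [this]

lemma shEntropy_unique [IsProbabilityMeasure μ] [Fintype α] [Unique α] (S : Ω → α) :
    shEntropy μ S = 0 := by
  have h : S ⁻¹' {default} = Set.univ := by ext; simp [Subsingleton.elim (S _) default]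
  rw [shEntropy_eq, Fintype.sum_unique, h]
  simp

lemma shCondEntropy_unit [IsProbabilityMeasure μ] [Fintype α] (S : Ω → α) :
    shCondEntropy μ S (fun _ => ()) = shEntropy μ S := by
  rw [shCondEntropy, shEntropy_unique (fun _ : Ω => ()), sub_zero]
  exact shEntropy_comp_equiv S (Equiv.prodPUnit α).symm

lemma shCondEntropy_eq_sum [Fintype α] [Fintype β] [IsFiniteMeasure μ] {S : Ω → α} {T : Ω → β}
    (hS : FiberMeasurable S) (hT : FiberMeasurable T) :
    shCondEntropy μ S T = ∑ p : α × β, μ.real ((fun ω => (S ω, T ω)) ⁻¹' {p}) *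
      (Real.logb 2 (μ.real (T ⁻¹' {p.2})) -
        Real.logb 2 (μ.real ((fun ω => (S ω, T ω)) ⁻¹' {p}))) := by
  rw [shCondEntropy, shEntropy_eq, shEntropy_eq]
  have : ∑ t, μ.real (T ⁻¹' {t}) * Real.logb 2 (μ.real (T ⁻¹' {t})) =
      ∑ p : α × β, μ.real ((fun ω => (S ω, T ω)) ⁻¹' {p}) *
        Real.logb 2 (μ.real (T ⁻¹' {p.2})) := by
    rw [Fintype.sum_prod_type_right]
    refine Finset.sum_congr rfl fun t _ => ?_
    simp only
    rw [← Finset.sum_mul, sum_real_pair hS hT]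
  rw [this]
  simp only [mul_sub, Finset.sum_sub_distrib]
  ring

lemma real_pair_le_right [IsFiniteMeasure μ] (S : Ω → α) (T : Ω → β) (p : α × β) :
    μ.real ((fun ω => (S ω, T ω)) ⁻¹' {p}) ≤ μ.real (T ⁻¹' {p.2}) :=
  measureReal_mono (fun ω h => by
    simp only [Set.mem_preimage, Set.mem_singleton_iff] at h ⊢
    rw [← h])

lemma shCondEntropy_nonneg [Fintype α] [Fintype β] [IsFiniteMeasure μ] {S : Ω → α} {T : Ω → β}
    (hS : FiberMeasurable S) (hT : FiberMeasurable T) : 0 ≤ shCondEntropy μ S T := by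
  rw [shCondEntropy_eq_sum hS hT]
  refine Finset.sum_nonneg fun p _ => ?_
  rcases (measureReal_nonneg (μ := μ)
    (s := (fun ω => (S ω, T ω)) ⁻¹' {p})).eq_or_lt with h | h
  · simp [← h]
  · refine mul_nonneg h.le (sub_nonneg.2 ?_)
    exact Real.logb_le_logb_of_le (by norm_num) h (real_pair_le_right S T p)

/-- Gibbs' inequality for conditional entropy. -/
lemma shCondEntropy_le_cross [Fintype α] [Fintype β] [IsProbabilityMeasure μ]
    {S : Ω → α} {T : Ω → β} (hS : FiberMeasurable S) (hT : FiberMeasurable T)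
    (q : α → β → ℝ) (hq0 : ∀ s t, 0 ≤ q s t)
    (hqpos : ∀ s t, 0 < μ.real ((fun ω => (S ω, T ω)) ⁻¹' {(s, t)}) → 0 < q s t)
    (hq1 : ∀ t, ∑ s, q s t ≤ 1) :
    shCondEntropy μ S T ≤ ∫ ω, -Real.logb 2 (q (S ω) (T ω)) ∂μ := by
  have hST := hS.prodMk hT
  have e := sum_real_mul_eq_integral (μ := μ) hST (fun p => -Real.logb 2 (q p.1 p.2))
  simp only at e
  rw [← e, shCondEntropy_eq_sum hS hT, ← sub_nonpos, ← Finset.sum_sub_distrib]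
  have hl2 : 0 < Real.log 2 := Real.log_pos (by norm_num)
  have key : ∀ p : α × β,
      μ.real ((fun ω => (S ω, T ω)) ⁻¹' {p}) * (Real.logb 2 (μ.real (T ⁻¹' {p.2})) -
        Real.logb 2 (μ.real ((fun ω => (S ω, T ω)) ⁻¹' {p}))) -
      μ.real ((fun ω => (S ω, T ω)) ⁻¹' {p}) * -Real.logb 2 (q p.1 p.2) ≤
      (μ.real (T ⁻¹' {p.2}) * q p.1 p.2 - μ.real ((fun ω => (S ω, T ω)) ⁻¹' {p})) /
        Real.log 2 := by
    rintro ⟨s, t⟩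
    have hle := real_pair_le_right (μ := μ) S T (s, t)
    have hqp := hqpos s t
    simp only at hle ⊢
    set a := μ.real ((fun ω => (S ω, T ω)) ⁻¹' {(s, t)})
    set b := μ.real (T ⁻¹' {t})
    have ha : 0 ≤ a := measureReal_nonneg
    rcases ha.eq_or_lt with h | h
    · rw [← h]
      simp only [zero_mul, sub_zero]
      exact div_nonneg (mul_nonneg measureReal_nonneg (hq0 s t)) hl2.le
    · have hq := hqp h
      have hb : 0 < b := h.trans_le hle
      have h1 : Real.log (b * q s t / a) ≤ b * q s t / a - 1 :=
        Real.log_le_sub_one_of_pos (by positivity)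
      rw [Real.log_div (by positivity) h.ne', Real.log_mul hb.ne' hq.ne'] at h1
      have h2 := mul_le_mul_of_nonneg_left h1 h.le
      have h3 : a * (b * q s t / a - 1) = b * q s t - a := by field_simp
      rw [h3] at h2
      simp only [Real.logb]
      rw [le_div_iff₀ hl2]
      calc _ = a * (Real.log b + Real.log (q s t) - Real.log a) := by
            field_simp
            ring
        _ ≤ _ := h2
  refine (Finset.sum_le_sum fun p _ => key p).trans ?_
  rw [← Finset.sum_div, Finset.sum_sub_distrib, sum_real_fiber hST]
  refine div_nonpos_of_nonpos_of_nonneg (sub_nonpos.2 ?_) hl2.le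
  rw [Fintype.sum_prod_type_right]
  simp only
  calc ∑ t, ∑ s, μ.real (T ⁻¹' {t}) * q s t
      = ∑ t, μ.real (T ⁻¹' {t}) * ∑ s, q s t := by simp only [Finset.mul_sum]
    _ ≤ ∑ t, μ.real (T ⁻¹' {t}) * 1 :=
        Finset.sum_le_sum fun t _ => mul_le_mul_of_nonneg_left (hq1 t) measureReal_nonneg
    _ = 1 := by simpa using sum_real_fiber (μ := μ) hT

lemma shCondEntropy_le_log_card [Fintype α] [Nonempty α] [Fintype β] [IsProbabilityMeasure μ]
    {S : Ω → α} {T : Ω → β} (hS : FiberMeasurable S) (hT : FiberMeasurable T) :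
    shCondEntropy μ S T ≤ Real.logb 2 (Fintype.card α) := by
  have hc : (0 : ℝ) < Fintype.card α := by exact_mod_cast Fintype.card_pos
  have := shCondEntropy_le_cross (μ := μ) hS hT (fun _ _ => ((Fintype.card α : ℝ))⁻¹)
    (fun _ _ => by positivity) (fun _ _ _ => by positivity)
    (fun t => by simp [hc.ne'])
  simpa [Real.logb_inv] using this

/-- Conditioning on less increases entropy. -/
lemma shCondEntropy_le_comp [Fintype α] [Fintype β] [Fintype γ] [IsProbabilityMeasure μ]
    {S : Ω → α} {T : Ω → β} (hS : FiberMeasurable S) (hT : FiberMeasurable T) (f : β → γ) :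
    shCondEntropy μ S T ≤ shCondEntropy μ S (fun ω => f (T ω)) := by
  have hfT := hT.comp f
  set P : α × γ → ℝ := fun p => μ.real ((fun ω => (S ω, f (T ω))) ⁻¹' {p}) with hP
  set R : γ → ℝ := fun c => μ.real ((fun ω => f (T ω)) ⁻¹' {c}) with hR
  have hsum : ∀ c, ∑ s, P (s, c) = R c := fun c => sum_real_pair hS hfT c
  have hPR : ∀ p, P p ≤ R p.2 := fun p => real_pair_le_right S _ p
  have hpos : ∀ s t, 0 < μ.real ((fun ω => (S ω, T ω)) ⁻¹' {(s, t)}) → 0 < P (s, f t) := by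
    intro s t h
    refine h.trans_le (measureReal_mono fun ω hω => ?_)
    simp only [Set.mem_preimage, Set.mem_singleton_iff, Prod.ext_iff] at hω ⊢
    exact ⟨hω.1, by rw [hω.2]⟩
  refine (shCondEntropy_le_cross hS hT (fun s t => P (s, f t) / R (f t))
    (fun s t => div_nonneg measureReal_nonneg measureReal_nonneg)
    (fun s t h => div_pos (hpos s t h) ((hpos s t h).trans_le (hPR _))) ?_).trans ?_
  · intro t
    rw [← Finset.sum_div, hsum]
    exact div_self_le_one _
  · rw [shCondEntropy_eq_sum hS hfT,
      ← sum_real_mul_eq_integral (hS.prodMk hfT) (fun p => -Real.logb 2 (P p / R p.2))]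
    refine Finset.sum_le_sum fun p _ => ?_
    change P p * _ ≤ P p * (Real.logb 2 (R p.2) - Real.logb 2 (P p))
    have hp : 0 ≤ P p := measureReal_nonneg
    rcases hp.eq_or_lt with h | h
    · rw [← h]; simp
    · rw [Real.logb_div h.ne' (h.trans_le (hPR p)).ne']
      simp

end Entropy

/-- A `limsup` over `ℝ` is at most any nonnegative asymptotic upper bound. -/
lemma limsup_le_of_nonneg_of_forall {u : ℕ → ℝ} {b : ℝ} (hb : 0 ≤ b)
    (h : ∀ ε > 0, ∀ᶠ n in atTop, u n ≤ b + ε) : limsup u atTop ≤ b := by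
  refine le_of_forall_pos_le_add fun ε hε => ?_
  rw [limsup_eq]
  by_cases hB : BddBelow {a | ∀ᶠ n in atTop, u n ≤ a}
  · exact csInf_le hB (h ε hε)
  · rw [Real.sInf_of_not_bddBelow hB]
    positivity

section Empirical

variable {A C : Type*}

lemma isProbabilityMeasure_uniformFin {n : ℕ} (hn : 0 < n) :
    IsProbabilityMeasure (uniformFin n) := by
  constructor
  rw [uniformFin, Measure.smul_apply, Measure.count_univ, smul_eq_mul]
  simp only [ENat.card_eq_coe_fintype_card, Fintype.card_fin]
  exact ENNReal.inv_mul_cancel (by simpa using hn.ne') (by simp)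

lemma integral_uniformFin {n : ℕ} (f : Fin n → ℝ) :
    ∫ i, f i ∂(uniformFin n) = (1 / (n : ℝ)) * ∑ i, f i := by
  rw [uniformFin, integral_smul_measure, integral_count]
  simp

lemma uniformFin_real {n : ℕ} (s : Finset (Fin n)) :
    (uniformFin n).real (s : Set (Fin n)) = (s.card : ℝ) / n := by
  rw [uniformFin, measureReal_ennreal_smul_apply, measureReal_def, Measure.count_apply_finset]
  simp [div_eq_inv_mul]

lemma fiberMeasurable_fin {n : ℕ} (S : Fin n → A) : FiberMeasurable S :=
  fun _ => MeasurableSpace.measurableSet_top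

/-- Product bound for a causal family of conditional sub-probabilities. -/
lemma sum_prod_causal_le_one [Fintype A] [Nonempty A] : ∀ (n : ℕ)
    (τ : Fin n → (Fin n → A) → A → ℝ) (_ : ∀ i w a, 0 ≤ τ i w a)
    (_ : ∀ i w w', (∀ j < i, w j = w' j) → τ i w = τ i w')
    (_ : ∀ i w, ∑ a, τ i w a ≤ 1),
    ∑ w : Fin n → A, ∏ i, τ i w (w i) ≤ 1
  | 0, _, _, _, _ => by simp
  | n + 1, τ, h0, hc, h1 => by
    obtain ⟨a₀⟩ := ‹Nonempty A›
    rw [← (Fin.snocEquiv fun _ => A).sum_comp, Fintype.sum_prod_type_right]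
    have hcast : ∀ (w : Fin n → A) (a : A) (i : Fin n),
        τ i.castSucc (Fin.snoc (α := fun _ => A) w a) =
          τ i.castSucc (Fin.snoc (α := fun _ => A) w a₀) := by
      intro w a i
      refine hc _ _ _ fun j hj => ?_
      have hj' : (j : ℕ) < n := lt_trans hj i.2
      simp [Fin.snoc, hj']
    have hlast : ∀ (w : Fin n → A) (a : A),
        τ (Fin.last n) (Fin.snoc (α := fun _ => A) w a) =
          τ (Fin.last n) (Fin.snoc (α := fun _ => A) w a₀) := by
      intro w a
      refine hc _ _ _ fun j hj => ?_
      have hj' : (j : ℕ) < n := hj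
      simp [Fin.snoc, hj']
    have hterm : ∀ (w : Fin n → A) (a : A),
        ∏ i, τ i (Fin.snoc (α := fun _ => A) w a) (Fin.snoc (α := fun _ => A) w a i) =
        (∏ i : Fin n, τ i.castSucc (Fin.snoc (α := fun _ => A) w a₀) (w i)) *
          τ (Fin.last n) (Fin.snoc (α := fun _ => A) w a₀) a := by
      intro w a
      rw [Fin.prod_univ_castSucc, hlast]
      simp only [hcast w a, Fin.snoc_castSucc, Fin.snoc_last]
    calc ∑ w : Fin n → A, ∑ a : A, ∏ i, τ i ((Fin.snocEquiv fun _ => A) (a, w))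
            ((Fin.snocEquiv fun _ => A) (a, w) i)
        = ∑ w : Fin n → A, (∏ i : Fin n, τ i.castSucc (Fin.snoc (α := fun _ => A) w a₀) (w i)) *
            ∑ a, τ (Fin.last n) (Fin.snoc (α := fun _ => A) w a₀) a := by
          refine Finset.sum_congr rfl fun w _ => ?_
          rw [Finset.mul_sum]
          exact Finset.sum_congr rfl fun a _ => hterm w a
      _ ≤ ∑ w : Fin n → A,
            ∏ i : Fin n, τ i.castSucc (Fin.snoc (α := fun _ => A) w a₀) (w i) := by
          refine Finset.sum_le_sum fun w _ => ?_
          exact mul_le_of_le_one_right (Finset.prod_nonneg fun i _ => h0 _ _ _) (h1 _ _)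
      _ ≤ 1 := by
          refine sum_prod_causal_le_one n
            (fun i w => τ i.castSucc (Fin.snoc (α := fun _ => A) w a₀))
            (fun _ _ _ => h0 _ _ _) ?_ (fun _ _ => h1 _ _)
          intro i w w' h
          refine hc _ _ _ fun j hj => ?_
          have hj' : (j : ℕ) < n := lt_trans hj i.2
          simp only [Fin.snoc, hj', dif_pos, cast_eq]
          exact h ⟨j, hj'⟩ hj

/-- Summing a product of conditional sub-probabilities with cyclic contexts of length `k`. -/
lemma sum_prod_cyclic_le [Fintype A] [Nonempty A] {n k : ℕ} (hn : 0 < n)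
    (G : Fin n → (Fin k → A) → C) (θ : A → C → ℝ) (h0 : ∀ a c, 0 ≤ θ a c)
    (h1 : ∀ c, ∑ a, θ a c ≤ 1) :
    ∑ w : Fin n → A, ∏ i, θ (w i) (G i fun j => w (cycIdx i ((j : ℤ) - (k : ℤ)))) ≤
      (Fintype.card A : ℝ) ^ k := by
  classical
  let ctx : (Fin k → A) → Fin n → (Fin n → A) → Fin k → A := fun b i w j =>
    if h : (i : ℕ) + j < k then b ⟨i + j, h⟩ else w ⟨i + j - k, by omega⟩
  have hctx : ∀ (w : Fin n → A) (i : Fin n),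
      (fun j : Fin k => w (cycIdx i ((j : ℤ) - (k : ℤ)))) =
        ctx (fun j => w (cycIdx ⟨0, hn⟩ ((j : ℤ) - (k : ℤ)))) i w := by
    intro w i
    funext j
    simp only [ctx]
    split_ifs with h
    · congr 1
      apply Fin.ext
      simp only [cycIdx]
      congr 2
      push_cast
      ring
    · congr 1
      apply Fin.ext
      simp only [cycIdx]
      rw [Int.emod_eq_of_lt (by omega) (by omega)]
      omega
  calc _ ≤ ∑ w : Fin n → A, ∑ b : Fin k → A, ∏ i, θ (w i) (G i (ctx b i w)) := by
        refine Finset.sum_le_sum fun w _ => ?_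
        rw [Finset.prod_congr rfl fun i _ => congrArg (fun u => θ (w i) (G i u)) (hctx w i)]
        exact Finset.single_le_sum
          (f := fun b => ∏ i, θ (w i) (G i (ctx b i w)))
          (fun b _ => Finset.prod_nonneg fun i _ => h0 _ _)
          (Finset.mem_univ fun j : Fin k => w (cycIdx ⟨0, hn⟩ ((j : ℤ) - (k : ℤ))))
    _ = ∑ b : Fin k → A, ∑ w : Fin n → A, ∏ i, θ (w i) (G i (ctx b i w)) := Finset.sum_comm
    _ ≤ ∑ _b : Fin k → A, (1 : ℝ) := by
        refine Finset.sum_le_sum fun b _ => ?_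
        refine sum_prod_causal_le_one n (fun i w a => θ a (G i (ctx b i w)))
          (fun _ _ _ => h0 _ _) ?_ (fun _ _ => h1 _)
        intro i w w' h
        have : ctx b i w = ctx b i w' := by
          funext j
          simp only [ctx]
          split_ifs with hk
          · rfl
          · exact h _ (by rw [Fin.lt_def]; simp only; omega)
        simp only [this]
    _ = (Fintype.card A : ℝ) ^ k := by simp

lemma uniformFin_condEntropy [Fintype A] [Fintype C] {n : ℕ} (hn : 0 < n) (S : Fin n → A)
    (T : Fin n → C) :
    n * shCondEntropy (uniformFin n) S T =
      ∑ i, (Real.logb 2 ((uniformFin n).real (T ⁻¹' {T i})) -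
        Real.logb 2 ((uniformFin n).real ((fun i => (S i, T i)) ⁻¹' {(S i, T i)}))) := by
  have := isProbabilityMeasure_uniformFin hn
  rw [shCondEntropy_eq_sum (fiberMeasurable_fin S) (fiberMeasurable_fin T),
    sum_real_mul_eq_integral (fiberMeasurable_fin _)
      (fun p : A × C => Real.logb 2 ((uniformFin n).real (T ⁻¹' {p.2})) -
        Real.logb 2 ((uniformFin n).real ((fun i => (S i, T i)) ⁻¹' {p}))),
    integral_uniformFin]
  have : (n : ℝ) ≠ 0 := by exact_mod_cast hn.ne'
  field_simp

/-- Kraft-type bound for empirical conditional entropies with cyclic contexts. -/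
lemma sum_two_rpow_neg_empirical_le [Fintype A] [Nonempty A] [Fintype C] {n k : ℕ} (hn : 0 < n)
    (G : Fin n → (Fin k → A) → C) :
    ∑ w : Fin n → A, (2 : ℝ) ^ (-(n * shCondEntropy (uniformFin n) w
      (fun i => G i fun j => w (cycIdx i ((j : ℤ) - (k : ℤ)))))) ≤
      ((n : ℝ) + 1) ^ (Fintype.card A * Fintype.card C) * (Fintype.card A : ℝ) ^ k := by
  classical
  have := isProbabilityMeasure_uniformFin hn
  have hn' : (n : ℝ) ≠ 0 := by exact_mod_cast hn.ne'
  obtain ⟨T, hT⟩ : ∃ T : (Fin n → A) → Fin n → C,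
      ∀ w i, T w i = G i fun j => w (cycIdx i ((j : ℤ) - (k : ℤ))) := ⟨_, fun _ _ => rfl⟩
  obtain ⟨cnt, hcnt⟩ : ∃ cnt : (Fin n → A) → A × C → Fin (n + 1),
      ∀ w p, (cnt w p : ℕ) = (Finset.univ.filter fun i => (w i, T w i) = p).card :=
    ⟨fun w p => ⟨(Finset.univ.filter fun i => (w i, T w i) = p).card, by
      have := Finset.card_filter_le (Finset.univ : Finset (Fin n)) fun i => (w i, T w i) = p
      simp only [Finset.card_univ, Fintype.card_fin] at this
      omega⟩, fun _ _ => rfl⟩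
  obtain ⟨θ, hθ⟩ : ∃ θ : (A × C → Fin (n + 1)) → A → C → ℝ, ∀ N a c, θ N a c =
    ((N (a, c) : ℕ) : ℝ) / ∑ a', ((N (a', c) : ℕ) : ℝ) := ⟨_, fun _ _ _ => rfl⟩
  have hθ0 : ∀ N a c, 0 ≤ θ N a c := fun N a c => by
    rw [hθ]
    exact div_nonneg (Nat.cast_nonneg _) (Finset.sum_nonneg fun _ _ => Nat.cast_nonneg _)
  have hθ1 : ∀ N c, ∑ a, θ N a c ≤ 1 := fun N c => by
    simp only [hθ]
    rw [← Finset.sum_div]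
    exact div_self_le_one _
  have hreal : ∀ w (p : A × C), (uniformFin n).real ((fun i => (w i, T w i)) ⁻¹' {p}) =
      ((cnt w p : ℕ) : ℝ) / n := by
    intro w p
    rw [hcnt, ← uniformFin_real]
    congr 1
    ext i
    simp
  have hrealT : ∀ w c, (uniformFin n).real (T w ⁻¹' {c}) =
      (∑ a, ((cnt w (a, c) : ℕ) : ℝ)) / n := by
    intro w c
    rw [← sum_real_pair (fiberMeasurable_fin w) (fiberMeasurable_fin (T w)), Finset.sum_div]
    exact Finset.sum_congr rfl fun a _ => hreal w (a, c)
  have hprod : ∀ w, (2 : ℝ) ^ (-(n * shCondEntropy (uniformFin n) w (T w))) =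
      ∏ i, θ (cnt w) (w i) (T w i) := by
    intro w
    have hpos : ∀ i, 0 < ((cnt w (w i, T w i) : ℕ) : ℝ) := by
      intro i
      have : 0 < (cnt w (w i, T w i) : ℕ) := by
        rw [hcnt]
        exact Finset.card_pos.2 ⟨i, by simp⟩
      exact_mod_cast this
    have hposT : ∀ i, 0 < ∑ a, ((cnt w (a, T w i) : ℕ) : ℝ) := fun i =>
      (hpos i).trans_le (Finset.single_le_sum
        (f := fun a => ((cnt w (a, T w i) : ℕ) : ℝ)) (fun _ _ => Nat.cast_nonneg _)
        (Finset.mem_univ (w i)))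
    rw [uniformFin_condEntropy hn, ← Finset.sum_neg_distrib,
      Real.rpow_sum_of_pos (by norm_num)]
    refine Finset.prod_congr rfl fun i _ => ?_
    rw [hrealT, hreal]
    have h1 := hpos i
    have h2 := hposT i
    have hnpos : (0 : ℝ) < n := by exact_mod_cast hn
    rw [neg_sub, ← Real.logb_div (by positivity) (by positivity),
      Real.rpow_logb (by norm_num) (by norm_num) (by positivity)]
    rw [hθ]
    field_simp
  simp only [← hT]
  calc ∑ w : Fin n → A, (2 : ℝ) ^ (-(n * shCondEntropy (uniformFin n) w (T w)))
      = ∑ w : Fin n → A, ∏ i, θ (cnt w) (w i) (T w i) := Finset.sum_congr rfl fun w _ => hprod w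
    _ ≤ ∑ w : Fin n → A, ∑ N : A × C → Fin (n + 1), ∏ i, θ N (w i) (T w i) := by
        refine Finset.sum_le_sum fun w _ => ?_
        exact Finset.single_le_sum (f := fun N => ∏ i, θ N (w i) (T w i))
          (fun N _ => Finset.prod_nonneg fun i _ => hθ0 _ _ _) (Finset.mem_univ _)
    _ = ∑ N : A × C → Fin (n + 1), ∑ w : Fin n → A, ∏ i, θ N (w i) (T w i) := Finset.sum_comm
    _ ≤ ∑ _N : A × C → Fin (n + 1), (Fintype.card A : ℝ) ^ k :=
        Finset.sum_le_sum fun N _ => by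
          simp only [hT]
          exact sum_prod_cyclic_le hn G (θ N) (hθ0 N) (hθ1 N)
    _ = _ := by simp

/-- Universal conditional probability assignment: the ideal code length exceeds the empirical
conditional entropy by a redundancy that is negligible for short contexts. -/
lemma exists_universal_assignment [Fintype A] [Nonempty A] [Fintype C] {n k : ℕ} (hn : 0 < n)
    (G : Fin n → (Fin k → A) → C) :
    ∃ q : (Fin n → A) → ℝ, (∀ w, 0 < q w) ∧ ∑ w, q w ≤ 1 ∧
      ∀ w, -Real.logb 2 (q w) = n * shCondEntropy (uniformFin n) w
          (fun i => G i fun j => w (cycIdx i ((j : ℤ) - (k : ℤ)))) +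
        (Fintype.card A * Fintype.card C * Real.logb 2 (n + 1) +
          k * Real.logb 2 (Fintype.card A)) := by
  have hA : (0 : ℝ) < Fintype.card A := by exact_mod_cast Fintype.card_pos
  have hZ : 0 < ((n : ℝ) + 1) ^ (Fintype.card A * Fintype.card C) *
    (Fintype.card A : ℝ) ^ k := by positivity
  refine ⟨fun w => (2 : ℝ) ^ (-(n * shCondEntropy (uniformFin n) w
      (fun i => G i fun j => w (cycIdx i ((j : ℤ) - (k : ℤ)))))) /
      (((n : ℝ) + 1) ^ (Fintype.card A * Fintype.card C) * (Fintype.card A : ℝ) ^ k),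
    fun w => by positivity, ?_, fun w => ?_⟩
  · rw [← Finset.sum_div]
    exact div_le_one_of_le₀ (sum_two_rpow_neg_empirical_le hn G) hZ.le
  · rw [Real.logb_div (by positivity) hZ.ne', Real.logb_rpow (by norm_num) (by norm_num),
      Real.logb_mul (by positivity) (by positivity), Real.logb_pow, Real.logb_pow]
    push_cast
    ring

end Empirical

section BlockCoding

lemma sum_prod_blocks_le {I A : Type*} [Fintype I] [DecidableEq I] [Fintype A] [Nonempty A]
    {B n : ℕ} (e : Fin B × Fin n → I) (he : Function.Injective e)
    (q : Fin B → (Fin n → A) → ℝ) (h0 : ∀ b w, 0 ≤ q b w) (h1 : ∀ b, ∑ w, q b w ≤ 1) :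
    ∑ s : I → A, ∏ b, q b (fun i => s (e (b, i))) ≤
      (Fintype.card A : ℝ) ^ (Fintype.card I - B * n) := by
  classical
  let E : (Fin B × Fin n) ⊕ ↥(Set.range e)ᶜ ≃ I :=
    ((Equiv.ofInjective e he).sumCongr (Equiv.refl _)).trans (Equiv.Set.sumCompl (Set.range e))
  have hE : ∀ k, E.symm (e k) = Sum.inl k := by
    intro k
    rw [Equiv.symm_apply_eq]
    simp [E]
  have hcard : Fintype.card ↥(Set.range e)ᶜ = Fintype.card I - B * n := by
    have := Fintype.card_congr E
    rw [Fintype.card_sum, Fintype.card_prod, Fintype.card_fin, Fintype.card_fin] at this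
    omega
  let F : ((Fin B × Fin n) ⊕ ↥(Set.range e)ᶜ → A) ≃ (I → A) := E.arrowCongr (Equiv.refl A)
  rw [← F.sum_comp,
    ← (Equiv.sumArrowEquivProdArrow (Fin B × Fin n) ↥(Set.range e)ᶜ A).symm.sum_comp,
    Fintype.sum_prod_type]
  have hval : ∀ u v b i, F ((Equiv.sumArrowEquivProdArrow (Fin B × Fin n)
      ↥(Set.range e)ᶜ A).symm (u, v)) (e (b, i)) = u (b, i) := by
    intro u v b i
    simp [F, hE]
  simp only [hval, Finset.sum_const, nsmul_eq_mul]
  rw [← Finset.mul_sum, ← (Equiv.curry (Fin B) (Fin n) A).symm.sum_comp]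
  have hprod : ∑ u : Fin B → Fin n → A, ∏ b, q b (u b) = ∏ b, ∑ w, q b w := by
    rw [Finset.prod_univ_sum, Fintype.piFinset_univ]
  have hle : ∑ u : Fin B → Fin n → A, ∏ b, q b (u b) ≤ 1 := by
    rw [hprod]
    exact Finset.prod_le_one (fun b _ => Finset.sum_nonneg fun w _ => h0 b w) fun b _ => h1 b
  have hc : ((Finset.univ : Finset (↥(Set.range e)ᶜ → A)).card : ℝ) =
      (Fintype.card A : ℝ) ^ (Fintype.card I - B * n) := by
    rw [Finset.card_univ, Fintype.card_fun, hcard]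
    push_cast
    rfl
  rw [hc]
  exact mul_le_of_le_one_right (by positivity) hle

/-- Ideal code length per block, charged at the times when a block starts. -/
noncomputable def blockCost {Ω A V : Type*} {n : ℕ} (T : Ω → Ω) (p : Ω → ZMod n)
    (a : Ω → A) (v : Ω → V) (q : (Fin n → A) → (Fin n → V) → ℝ) (ω : Ω) : ℝ :=
  open Classical in
  if p ω = 0 then -Real.logb 2 (q (fun i => a (T^[i] ω)) (fun i => v (T^[i] ω))) else 0

lemma le_one_of_sum_le_one {α : Type*} [Fintype α] {q : α → ℝ} (h0 : ∀ a, 0 ≤ q a)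
    (h1 : ∑ a, q a ≤ 1) (a : α) : q a ≤ 1 :=
  (Finset.single_le_sum (fun b _ => h0 b) (Finset.mem_univ a)).trans h1

lemma blockCost_nonneg {Ω A V : Type*} [Fintype A] {n : ℕ} (T : Ω → Ω) (p : Ω → ZMod n)
    (a : Ω → A) (v : Ω → V) {q : (Fin n → A) → (Fin n → V) → ℝ} (hq0 : ∀ s t, 0 < q s t)
    (hq1 : ∀ t, ∑ s, q s t ≤ 1) (ω : Ω) : 0 ≤ blockCost T p a v q ω := by
  classical
  unfold blockCost
  split_ifs
  · exact neg_nonneg.2 (Real.logb_nonpos (by norm_num) (hq0 _ _).le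
      (le_one_of_sum_le_one (fun s => (hq0 s _).le) (hq1 _) _))
  · exact le_rfl

lemma exists_phase_offset {Ω : Type*} {T : Ω → Ω} {n : ℕ} [NeZero n] {p : Ω → ZMod n}
    (hpT : ∀ ω, p (T ω) = p ω + 1) (ω : Ω) :
    ∃ o : Fin n, ∀ b : ℕ, p (T^[o + b * n + 1] ω) = 0 := by
  have hit : ∀ (t : ℕ) ω, p (T^[t] ω) = p ω + t := by
    intro t
    induction t with
    | zero => simp
    | succ t ih =>
      intro ω
      rw [Function.iterate_succ_apply, ih, hpT]
      push_cast
      ring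
  refine ⟨⟨(-(p ω + 1)).val, ZMod.val_lt _⟩, fun b => ?_⟩
  rw [hit]
  push_cast
  rw [ZMod.natCast_zmod_val]
  simp

variable {Ω A V : Type*} [MeasurableSpace Ω] {P : Measure Ω} {T : Ω → Ω}

lemma integrable_blockCost [IsFiniteMeasure P] [Finite A] [Finite V] {n : ℕ} [NeZero n]
    (hT : Measurable T) {p : Ω → ZMod n} (hp : FiberMeasurable p) {a : Ω → A} {v : Ω → V}
    (ha : FiberMeasurable a) (hv : FiberMeasurable v) (q : (Fin n → A) → (Fin n → V) → ℝ) :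
    Integrable (blockCost T p a v q) P := by
  classical
  have hA : FiberMeasurable (fun ω => fun i : Fin n => a (T^[i] ω)) :=
    FiberMeasurable.pi fun i => ha.comp_measurable (hT.iterate i)
  have hV : FiberMeasurable (fun ω => fun i : Fin n => v (T^[i] ω)) :=
    FiberMeasurable.pi fun i => hv.comp_measurable (hT.iterate i)
  exact (hp.prodMk (hA.prodMk hV)).integrable_comp
    (fun x => if x.1 = 0 then -Real.logb 2 (q x.2.1 x.2.2) else 0)

lemma shCondEntropy_le_blockCost [IsProbabilityMeasure P] [Fintype A] [Nonempty A] [Fintype V]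
    {n : ℕ} [NeZero n] (hT : MeasurePreserving T P P) {p : Ω → ZMod n} (hp : FiberMeasurable p)
    (hpT : ∀ ω, p (T ω) = p ω + 1) {a : Ω → A} {v : Ω → V}
    (ha : FiberMeasurable a) (hv : FiberMeasurable v) {q : (Fin n → A) → (Fin n → V) → ℝ}
    (hq0 : ∀ s t, 0 < q s t) (hq1 : ∀ t, ∑ s, q s t ≤ 1) (N : ℕ) :
    shCondEntropy P (fun ω => fun i : Fin N => a (T^[(i : ℕ) + 1] ω))
      (fun ω => fun i : Fin N => v (T^[(i : ℕ) + 1] ω)) ≤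
    Real.logb 2 n + 2 * n * Real.logb 2 (Fintype.card A) + N * ∫ ω, blockCost T p a v q ω ∂P := by
  classical
  have hn : 0 < n := Nat.pos_of_ne_zero (NeZero.ne n)
  have hnR : (0 : ℝ) < n := by exact_mod_cast hn
  have hA : (0 : ℝ) < Fintype.card A := by exact_mod_cast Fintype.card_pos
  have hA1 : (1 : ℝ) ≤ Fintype.card A := by exact_mod_cast Fintype.card_pos
  set B : ℕ := N / n - 1 with hB
  have hdm := Nat.div_add_mod N n
  have hml := Nat.mod_lt N hn
  have hBn : B = 0 ∨ B * n + n ≤ N := by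
    rcases Nat.eq_zero_or_pos (N / n) with h | h
    · left; omega
    · right
      have : B + 1 = N / n := by omega
      calc B * n + n = n * (B + 1) := by ring
        _ = n * (N / n) := by rw [this]
        _ ≤ N := by omega
  have hrest : N - B * n ≤ 2 * n := by
    rcases Nat.eq_zero_or_pos (N / n) with h | h
    · rw [h] at hdm
      omega
    · have : B + 1 = N / n := by omega
      rw [← this] at hdm
      have : n * (B + 1) = B * n + n := by ring
      omega
  have hidx : ∀ (o : Fin n) (b : Fin B) (i : Fin n), (o : ℕ) + b * n + i < N := by
    intro o b i
    have hb := b.2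
    have h2 : B * n + n ≤ N := by
      rcases hBn with h | h
      · omega
      · exact h
    have h3 : (b : ℕ) * n + n ≤ B * n := by
      calc (b : ℕ) * n + n = (b + 1) * n := by ring
        _ ≤ B * n := Nat.mul_le_mul_right _ hb
    omega
  let e : Fin n → Fin B × Fin n → Fin N := fun o x => ⟨o + x.1 * n + x.2, hidx o x.1 x.2⟩
  have he : ∀ o, Function.Injective (e o) := by
    rintro o ⟨b, i⟩ ⟨b', i'⟩ h
    have h' : (o : ℕ) + b * n + i = o + b' * n + i' := congrArg Fin.val h
    have h1 : (i : ℕ) + n * b = i' + n * b' := by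
      rw [mul_comm n, mul_comm n]
      omega
    have h2 : (i : ℕ) = i' := by
      have := congrArg (· % n) h1
      simpa [Nat.add_mul_mod_self_left, Nat.mod_eq_of_lt] using this
    have h3 : (b : ℕ) = b' := by
      rw [h2] at h1
      exact Nat.eq_of_mul_eq_mul_left hn (by omega)
    exact Prod.ext (Fin.ext h3) (Fin.ext h2)
  let R : Fin n → (Fin N → A) → (Fin N → V) → ℝ := fun o s t =>
    ∏ b : Fin B, q (fun i => s (e o (b, i))) (fun i => t (e o (b, i)))
  have hR0 : ∀ o s t, 0 < R o s t := fun o s t => Finset.prod_pos fun b _ => hq0 _ _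
  have hR1 : ∀ o t, ∑ s, R o s t ≤ (Fintype.card A : ℝ) ^ (N - B * n) := by
    intro o t
    have := sum_prod_blocks_le (e o) (he o) (fun b w => q w (fun i => t (e o (b, i))))
      (fun b w => (hq0 _ _).le) (fun b => hq1 _)
    simpa using this
  let Q : (Fin N → A) → (Fin N → V) → ℝ := fun s t =>
    ∑ o, R o s t / (n * (Fintype.card A : ℝ) ^ (N - B * n))
  have hQ0 : ∀ s t, 0 < Q s t := fun s t =>
    Finset.sum_pos (fun o _ => div_pos (hR0 o s t) (by positivity)) ⟨⟨0, hn⟩, Finset.mem_univ _⟩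
  have hQ1 : ∀ t, ∑ s, Q s t ≤ 1 := by
    intro t
    simp only [Q]
    rw [Finset.sum_comm]
    calc ∑ o : Fin n, ∑ s, R o s t / (n * (Fintype.card A : ℝ) ^ (N - B * n))
        ≤ ∑ _o : Fin n, (1 / n : ℝ) := by
          refine Finset.sum_le_sum fun o _ => ?_
          rw [← Finset.sum_div, div_le_div_iff₀ (by positivity) hnR]
          nlinarith [hR1 o t]
      _ = 1 := by
          simp [hnR.ne']
  have hS : FiberMeasurable (fun ω => fun i : Fin N => a (T^[(i : ℕ) + 1] ω)) :=
    FiberMeasurable.pi fun i => ha.comp_measurable (hT.measurable.iterate _)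
  have hU : FiberMeasurable (fun ω => fun i : Fin N => v (T^[(i : ℕ) + 1] ω)) :=
    FiberMeasurable.pi fun i => hv.comp_measurable (hT.measurable.iterate _)
  have hcost := integrable_blockCost (P := P) hT.measurable hp ha hv q
  have hcostt : ∀ t : ℕ, Integrable (fun ω => blockCost T p a v q (T^[t + 1] ω)) P := fun t =>
    (hT.iterate (t + 1)).integrable_comp_of_integrable hcost
  refine (shCondEntropy_le_cross hS hU Q (fun s t => (hQ0 s t).le) (fun s t _ => hQ0 s t)
    hQ1).trans ?_
  have hpt : ∀ ω, -Real.logb 2 (Q (fun i : Fin N => a (T^[(i : ℕ) + 1] ω))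
      (fun i : Fin N => v (T^[(i : ℕ) + 1] ω))) ≤
      (Real.logb 2 n + 2 * n * Real.logb 2 (Fintype.card A)) +
        ∑ t ∈ Finset.range N, blockCost T p a v q (T^[t + 1] ω) := by
    intro ω
    obtain ⟨o, ho⟩ := exists_phase_offset hpT ω
    set s : Fin N → A := fun i => a (T^[(i : ℕ) + 1] ω) with hs
    set u : Fin N → V := fun i => v (T^[(i : ℕ) + 1] ω) with hu
    have h1 : R o s u / (n * (Fintype.card A : ℝ) ^ (N - B * n)) ≤ Q s u :=
      Finset.single_le_sum
        (f := fun o => R o s u / (n * (Fintype.card A : ℝ) ^ (N - B * n)))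
        (fun o _ => (div_pos (hR0 o s u) (by positivity)).le) (Finset.mem_univ o)
    have h2 := Real.logb_le_logb_of_le (b := 2) (by norm_num)
      (div_pos (hR0 o s u) (by positivity)) h1
    rw [Real.logb_div (hR0 o s u).ne' (by positivity),
      Real.logb_mul (by positivity) (by positivity), Real.logb_pow] at h2
    have h3 : ((N - B * n : ℕ) : ℝ) * Real.logb 2 (Fintype.card A) ≤
        2 * n * Real.logb 2 (Fintype.card A) := by
      refine mul_le_mul_of_nonneg_right ?_ (Real.logb_nonneg (by norm_num) hA1)
      exact_mod_cast hrest
    have h4 : Real.logb 2 (R o s u) =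
        ∑ b : Fin B, Real.logb 2 (q (fun i => s (e o (b, i))) (fun i => u (e o (b, i)))) := by
      exact Real.logb_prod _ _ fun b _ => (hq0 _ _).ne'
    have h5 : ∑ b : Fin B, -Real.logb 2 (q (fun i => s (e o (b, i))) (fun i => u (e o (b, i)))) ≤
        ∑ t ∈ Finset.range N, blockCost T p a v q (T^[t + 1] ω) := by
      have h6 : ∀ b : Fin B,
          -Real.logb 2 (q (fun i => s (e o (b, i))) (fun i => u (e o (b, i)))) =
          blockCost T p a v q (T^[(o + b * n) + 1] ω) := by
        intro b
        rw [blockCost, if_pos (ho b)]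
        have h7 : ∀ i : ℕ, T^[i] (T^[(o + b * n) + 1] ω) = T^[o + b * n + i + 1] ω := by
          intro i
          rw [← Function.iterate_add_apply]
          congr 1
          omega
        simp only [h7]
        rfl
      simp only [h6]
      have hinj : Function.Injective (fun b : Fin B => (o : ℕ) + b * n) := by
        intro b b' h
        simp only [add_right_inj] at h
        exact Fin.ext (Nat.eq_of_mul_eq_mul_right hn h)
      rw [← Finset.sum_image (s := (Finset.univ : Finset (Fin B)))
        (g := fun b : Fin B => (o : ℕ) + b * n)
        (f := fun t => blockCost T p a v q (T^[t + 1] ω)) (fun b _ b' _ h => hinj h)]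
      refine Finset.sum_le_sum_of_subset_of_nonneg ?_
        (fun t _ _ => blockCost_nonneg T p a v hq0 hq1 _)
      intro t ht
      obtain ⟨b, _, rfl⟩ := Finset.mem_image.1 ht
      have := hidx o b ⟨0, hn⟩
      simpa using this
    rw [Finset.sum_neg_distrib, ← h4] at h5
    linarith
  have hsumint : Integrable (fun ω => ∑ t ∈ Finset.range N,
      blockCost T p a v q (T^[t + 1] ω)) P := integrable_finsetSum _ fun t _ => hcostt t
  refine (integral_mono ((hS.prodMk hU).integrable_comp fun x => -Real.logb 2 (Q x.1 x.2))
    ((integrable_const _).add hsumint) hpt).trans ?_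
  have e1 := integral_add (μ := P) (integrable_const
    (Real.logb 2 n + 2 * n * Real.logb 2 (Fintype.card A))) hsumint
  simp only [Pi.add_apply] at e1 ⊢
  rw [e1, integral_finsetSum _ fun t _ => hcostt t]
  have e2 : ∀ t, ∫ ω, blockCost T p a v q (T^[t + 1] ω) ∂P = ∫ ω, blockCost T p a v q ω ∂P := by
    intro t
    have hm := hT.iterate (t + 1)
    have := integral_map (μ := P) hm.measurable.aemeasurable
      (f := blockCost T p a v q) (by rw [hm.map_eq]; exact hcost.aestronglyMeasurable)
    rw [hm.map_eq] at this
    exact this.symm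
  rw [Finset.sum_congr rfl fun t _ => e2 t]
  simp

end BlockCoding

section EntropyRate

lemma iterate_shift_eq {Ω α : Type*} {T : Ω → Ω} {Ψ : Ω → ℤ → α}
    (hΨ : ∀ ω, Ψ (T ω) = shiftZ (Ψ ω)) (t : ℕ) (ω : Ω) :
    Ψ (T^[t] ω) 0 = Ψ ω t := by
  have : ∀ (t : ℕ) (ω : Ω) (s : ℤ), Ψ (T^[t] ω) s = Ψ ω (s + t) := by
    intro t
    induction t with
    | zero => simp
    | succ t ih =>
      intro ω s
      rw [Function.iterate_succ_apply, ih, hΨ, shiftZ]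
      push_cast
      congr 1
      ring
  simpa using this t ω 0

variable {Ω Ω' α β γ : Type*} [MeasurableSpace Ω] [MeasurableSpace Ω'] {P : Measure Ω}

lemma shEntropy_map [Fintype α] {F : Ω → Ω'} (hF : Measurable F) {S : Ω' → α}
    (hS : FiberMeasurable S) : shEntropy (P.map F) S = shEntropy P (fun ω => S (F ω)) := by
  rw [shEntropy, shEntropy]
  congr 1
  refine Finset.sum_congr rfl fun s _ => ?_
  rw [Measure.map_apply hF (hS s)]
  rfl

lemma shCondEntropy_map [Fintype α] [Fintype β] {F : Ω → Ω'} (hF : Measurable F) {S : Ω' → α}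
    {T : Ω' → β} (hS : FiberMeasurable S) (hT : FiberMeasurable T) :
    shCondEntropy (P.map F) S T = shCondEntropy P (fun ω => S (F ω)) (fun ω => T (F ω)) := by
  rw [shCondEntropy, shCondEntropy, shEntropy_map hF (hS.prodMk hT), shEntropy_map hF hT]

lemma shCondEntropy_comp_equiv_right [Fintype α] [Fintype β] [Fintype γ] (S : Ω → α) (T : Ω → β)
    (e : β ≃ γ) : shCondEntropy P S (fun ω => e (T ω)) = shCondEntropy P S T := by
  rw [shCondEntropy, shCondEntropy, shEntropy_comp_equiv T e,
    ← shEntropy_comp_equiv (fun ω => (S ω, T ω)) ((Equiv.refl α).prodCongr e)]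
  rfl

/-- Chain rule along a sequence of random variables. -/
lemma sum_shCondEntropy_eq [Fintype α] [IsProbabilityMeasure P] (Y : ℕ → Ω → α) (N : ℕ) :
    ∑ m ∈ Finset.range N, shCondEntropy P (Y m) (fun ω => fun i : Fin m => Y i ω) =
      shEntropy P (fun ω => fun i : Fin N => Y i ω) := by
  induction N with
  | zero => rw [Finset.sum_range_zero, shEntropy_unique]
  | succ N ih =>
    rw [Finset.sum_range_succ, ih, shCondEntropy,
      ← shEntropy_comp_equiv (fun ω => (Y N ω, fun i : Fin N => Y i ω))
        (Fin.snocEquiv fun _ : Fin (N + 1) => α), add_sub_cancel]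
    congr 1
    funext ω i
    refine Fin.lastCases ?_ (fun j => ?_) i
    · simp
    · simp

lemma limsup_increment_le [IsProbabilityMeasure P] [Fintype α] {T : Ω → Ω}
    (hT : MeasurePreserving T P P) {a : Ω → α} (ha : FiberMeasurable a) {b C : ℝ} (hb : 0 ≤ b)
    (h : ∀ N : ℕ, shEntropy P (fun ω => fun i : Fin N => a (T^[(i : ℕ) + 1] ω)) ≤ C + N * b) :
    limsup (fun N : ℕ => shCondEntropy P (fun ω => a (T^[N + 1] ω))
      (fun ω => fun i : Fin N => a (T^[(i : ℕ) + 1] ω))) atTop ≤ b := by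
  set u : ℕ → ℝ := fun N => shCondEntropy P (fun ω => a (T^[N + 1] ω))
      (fun ω => fun i : Fin N => a (T^[(i : ℕ) + 1] ω)) with hu
  have hA : ∀ t, FiberMeasurable (fun ω => a (T^[t] ω)) := fun t =>
    ha.comp_measurable (hT.measurable.iterate t)
  have hanti : Antitone u := by
    refine antitone_nat_of_succ_le fun N => ?_
    have h1 := shCondEntropy_le_comp (μ := P) (hA (N + 2))
      (FiberMeasurable.pi fun i : Fin (N + 1) => hA (i + 1)) (fun t => fun i : Fin N => t i.succ)
    refine h1.trans_eq ?_
    have h2 := shCondEntropy_map (P := P) hT.measurable (hA (N + 1))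
      (FiberMeasurable.pi fun i : Fin N => hA (i + 1))
    rw [hT.map_eq] at h2
    simp only [hu]
    rw [h2]
    rfl
  refine limsup_le_of_nonneg_of_forall hb fun ε hε => ?_
  have hlim : Tendsto (fun N : ℕ => C / (N : ℝ)) atTop (nhds 0) :=
    tendsto_const_div_atTop_nhds_zero_nat C
  filter_upwards [hlim.eventually (ge_mem_nhds hε), eventually_gt_atTop 0] with N h1 h2
  have hN : (0 : ℝ) < N := by exact_mod_cast h2
  have h3 : N * u N ≤ ∑ m ∈ Finset.range N, u m := by
    have := Finset.card_nsmul_le_sum (Finset.range N) u (u N)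
      fun m hm => hanti (Finset.mem_range.1 hm).le
    simpa using this
  have h4 := sum_shCondEntropy_eq (P := P) (fun m ω => a (T^[m + 1] ω)) N
  have h5 := h N
  rw [← h4] at h5
  have h6 : N * u N ≤ C + N * b := h3.trans h5
  rw [div_le_iff₀ hN] at h1
  nlinarith

variable {T : Ω → Ω} {n : ℕ} [NeZero n] {p : Ω → ZMod n}

lemma entropyRate_map_le [IsProbabilityMeasure P] [Fintype α] [Nonempty α] [MeasurableSpace α]
    [MeasurableSingletonClass α] (hT : MeasurePreserving T P P) (hp : FiberMeasurable p)
    (hpT : ∀ ω, p (T ω) = p ω + 1) {Ψ : Ω → ℤ → α} (hm : Measurable Ψ)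
    (hΨ : ∀ ω, Ψ (T ω) = shiftZ (Ψ ω)) {q : (Fin n → α) → (Fin n → Unit) → ℝ}
    (hq0 : ∀ s t, 0 < q s t) (hq1 : ∀ t, ∑ s, q s t ≤ 1) :
    entropyRate (P.map Ψ) ≤ ∫ ω, blockCost T p (fun ω => Ψ ω 0) (fun _ => ()) q ω ∂P := by
  have hc : ∀ t : ℤ, FiberMeasurable (fun y : ℤ → α => y t) := fun t =>
    FiberMeasurable.of_measurable (measurable_pi_apply t)
  have ha : FiberMeasurable (fun ω => Ψ ω 0) := (hc 0).comp_measurable hm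
  have hit := iterate_shift_eq hΨ
  have h := limsup_increment_le hT ha
    (integral_nonneg fun ω => blockCost_nonneg T p (fun ω => Ψ ω 0) (fun _ => ()) hq0 hq1 ω)
    (C := Real.logb 2 n + 2 * n * Real.logb 2 (Fintype.card α)) (fun N => by
      refine le_trans (le_of_eq ?_)
        (shCondEntropy_le_blockCost hT hp hpT ha (FiberMeasurable.const ()) hq0 hq1 N)
      rw [← shCondEntropy_unit]
      exact (shCondEntropy_comp_equiv_right _ (fun _ => ())
        (Equiv.ofUnique Unit (Fin N → Unit))).symm)
  refine le_of_eq_of_le ?_ h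
  rw [entropyRate]
  congr 1
  funext N
  rw [shCondEntropy_map hm (hc _) (T := blockZ N) (FiberMeasurable.pi fun i => hc _)]
  simp only [hit]
  push_cast
  rfl

lemma condEntropyRate_map_le {W Y Z : Type*} [IsProbabilityMeasure P] [Fintype W] [Nonempty W]
    [Fintype Y] [Fintype Z] [MeasurableSpace W] [MeasurableSpace Y] [MeasurableSpace Z]
    [MeasurableSingletonClass W] [MeasurableSingletonClass Y] [MeasurableSingletonClass Z]
    (hT : MeasurePreserving T P P) (hp : FiberMeasurable p)
    (hpT : ∀ ω, p (T ω) = p ω + 1) {Ψ : Ω → ℤ → W × Y × Z} (hm : Measurable Ψ)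
    (hΨ : ∀ ω, Ψ (T ω) = shiftZ (Ψ ω)) {q : (Fin n → W) → (Fin n → Y × Z) → ℝ}
    (hq0 : ∀ s t, 0 < q s t) (hq1 : ∀ t, ∑ s, q s t ≤ 1) :
    condEntropyRate (P.map Ψ) ≤
      ∫ ω, blockCost T p (fun ω => (Ψ ω 0).1) (fun ω => (Ψ ω 0).2) q ω ∂P := by
  have hc : ∀ t : ℤ, FiberMeasurable (fun y : ℤ → W × Y × Z => y t) := fun t =>
    FiberMeasurable.of_measurable (measurable_pi_apply t)
  have ha : FiberMeasurable (fun ω => Ψ ω 0) := (hc 0).comp_measurable hm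
  have hit := iterate_shift_eq hΨ
  have hb : 0 ≤ ∫ ω, blockCost T p (fun ω => (Ψ ω 0).1) (fun ω => (Ψ ω 0).2) q ω ∂P :=
    integral_nonneg fun ω => blockCost_nonneg T p _ _ hq0 hq1 ω
  rw [condEntropyRate]
  refine limsup_le_of_nonneg_of_forall hb fun ε hε => ?_
  set C := Real.logb 2 n + 2 * n * Real.logb 2 (Fintype.card W) with hC
  have hlim : Tendsto (fun N : ℕ => C / (N : ℝ)) atTop (nhds 0) :=
    tendsto_const_div_atTop_nhds_zero_nat C
  filter_upwards [hlim.eventually (ge_mem_nhds hε), eventually_gt_atTop 0] with N h1 h2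
  have hN : (0 : ℝ) < N := by exact_mod_cast h2
  have h := shCondEntropy_le_blockCost hT hp hpT (ha.comp Prod.fst) (ha.comp Prod.snd) hq0 hq1 N
  have hY : ∀ t : ℤ, FiberMeasurable (fun y : ℤ → W × Y × Z => (y t).2.1) := fun t =>
    (hc t).comp fun x => x.2.1
  have hZ : ∀ t : ℤ, FiberMeasurable (fun y : ℤ → W × Y × Z => (y t).2.2) := fun t =>
    (hc t).comp fun x => x.2.2
  rw [shCondEntropy_map hm (FiberMeasurable.pi fun i : Fin N => (hc _).comp Prod.fst)
    ((FiberMeasurable.pi fun i : Fin N => hY _).prodMk (FiberMeasurable.pi fun i : Fin N => hZ _))]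
  simp only [hit] at h
  have he := shCondEntropy_comp_equiv_right (P := P)
    (fun ω => fun i : Fin N => (Ψ ω ((i : ℕ) + 1 : ℕ)).1)
    (fun ω => fun i : Fin N => (Ψ ω ((i : ℕ) + 1 : ℕ)).2)
    (Equiv.arrowProdEquivProdArrow (Fin N) (fun _ => Y) (fun _ => Z))
  rw [← he] at h
  push_cast at h
  rw [one_div, inv_mul_le_iff₀ hN]
  rw [div_le_iff₀ hN] at h1
  refine le_trans (h.trans ?_) (le_of_eq rfl)
  nlinarith

end EntropyRate

section ErgodicComponent

lemma exists_ergodic_cond {Ω : Type*} [MeasurableSpace Ω] {m : Measure Ω} [IsProbabilityMeasure m]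
    {T : Ω → Ω} (hT : MeasurePreserving T m m) {δ : ℝ} (hδ : 0 < δ)
    (h : ∀ E, MeasurableSet E → T ⁻¹' E = E → 0 < m.real E → δ ≤ m.real E)
    {g : Ω → ℝ} (hg : Integrable g m) :
    ∃ E, MeasurableSet E ∧ 0 < m.real E ∧ Ergodic T (ProbabilityTheory.cond m E) ∧
      ∫ ω, g ω ∂(ProbabilityTheory.cond m E) ≤ ∫ ω, g ω ∂m := by
  set G := ∫ ω, g ω ∂m with hG
  let F : Set (Set Ω) := {E | MeasurableSet E ∧ T ⁻¹' E = E ∧ 0 < m.real E ∧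
    ∫ ω in E, g ω ∂m ≤ G * m.real E}
  have huniv : Set.univ ∈ F := by
    refine ⟨MeasurableSet.univ, rfl, by simp, by simp [hG]⟩
  have hbdd : BddBelow (m.real '' F) := ⟨0, by rintro _ ⟨E, _, rfl⟩; exact measureReal_nonneg⟩
  obtain ⟨_, ⟨E, hE, rfl⟩, hlt⟩ := exists_lt_of_csInf_lt ((Set.nonempty_of_mem huniv).image m.real)
    (lt_add_of_pos_right (sInf (m.real '' F)) hδ)
  obtain ⟨hEm, hET, hE0, hEg⟩ := hE
  have hmin : ∀ A ∈ F, m.real E - δ < m.real A := fun A hA => by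
    have := csInf_le hbdd ⟨A, hA, rfl⟩
    linarith
  have hm0 : m E ≠ 0 := fun h0 => by simp [Measure.real, h0] at hE0
  refine ⟨E, hEm, hE0, ⟨?_, ⟨fun A hA hAT => ?_⟩⟩, ?_⟩
  · have h1 := hT.restrict_preimage hEm
    rw [hET] at h1
    exact h1.smul_measure _
  · have hi : T ⁻¹' (E ∩ A) = E ∩ A := by rw [Set.preimage_inter, hET, hAT]
    have hd : T ⁻¹' (E \ A) = E \ A := by rw [Set.preimage_sdiff, hET, hAT]
    have hsum := measureReal_inter_add_sdiff (μ := m) (s := E) hA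
    have hgsum := integral_inter_add_sdiff hA (hg.integrableOn (s := E))
    have key : m.real (E ∩ A) = 0 ∨ m.real (E \ A) = 0 := by
      by_contra! hne
      have p1 : 0 < m.real (E ∩ A) := lt_of_le_of_ne measureReal_nonneg hne.1.symm
      have p2 : 0 < m.real (E \ A) := lt_of_le_of_ne measureReal_nonneg hne.2.symm
      have q1 := h _ (hEm.inter hA) hi p1
      have q2 := h _ (hEm.diff hA) hd p2
      rcases le_or_gt (∫ ω in E ∩ A, g ω ∂m) (G * m.real (E ∩ A)) with h1 | h1
      · have := hmin _ ⟨hEm.inter hA, hi, p1, h1⟩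
        linarith
      · have := hmin _ ⟨hEm.diff hA, hd, p2, by
          rw [← hsum] at hEg
          linarith⟩
        linarith
    rw [eventuallyConst_set']
    rcases key with h0 | h0
    · left
      rw [ae_eq_empty, ProbabilityTheory.cond_apply hEm]
      rw [measureReal_eq_zero_iff] at h0
      simp [h0]
    · right
      rw [ae_eq_univ, ProbabilityTheory.cond_apply hEm]
      rw [measureReal_eq_zero_iff] at h0
      rw [← Set.sdiff_eq, h0, mul_zero]
  · rw [ProbabilityTheory.cond, integral_smul_measure, ENNReal.toReal_inv, smul_eq_mul,
      ← measureReal_def, inv_mul_le_iff₀ hE0]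
    linarith [mul_comm G (m.real E)]

variable {α : Type*} [MeasurableSpace α]

/-- The uniform probability measure on the cyclic group `ZMod n`. -/
noncomputable def uniformZMod (n : ℕ) : Measure (ZMod n) := (n : ℝ≥0∞)⁻¹ • Measure.count

instance isProbabilityMeasure_uniformZMod (n : ℕ) [NeZero n] :
    IsProbabilityMeasure (uniformZMod n) := by
  constructor
  rw [uniformZMod, Measure.smul_apply, Measure.count_univ, ENat.card_eq_coe_fintype_card,
    ZMod.card, smul_eq_mul]
  simp only [ENat.toENNReal_coe]
  exact ENNReal.inv_mul_cancel (by exact_mod_cast NeZero.ne n) (ENNReal.natCast_ne_top n)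

lemma integral_uniformZMod {n : ℕ} [NeZero n] (f : ZMod n → ℝ) :
    ∫ j, f j ∂(uniformZMod n) = (n : ℝ)⁻¹ * ∑ j, f j := by
  rw [uniformZMod, integral_smul_measure, integral_count]
  simp

/-- Advance a dynamical system together with a phase modulo `n`. -/
def phaseMap (n : ℕ) (σ : α → α) : α × ZMod n → α × ZMod n := Prod.map σ (· + 1)

lemma measurePreserving_phaseMap {n : ℕ} [NeZero n] {μ : Measure α} [IsProbabilityMeasure μ]
    {σ : α → α} (hσ : MeasurePreserving σ μ μ) :
    MeasurePreserving (phaseMap n σ) (μ.prod (uniformZMod n)) (μ.prod (uniformZMod n)) := by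
  refine hσ.prod (MeasurePreserving.smul_measure ⟨measurable_of_finite _, ?_⟩ _)
  ext s hs
  rw [Measure.map_apply (measurable_of_finite _) hs, Measure.count_apply hs,
    Measure.count_apply (MeasurableSet.of_discrete)]
  congr 1
  exact Set.encard_preimage_of_bijective (Equiv.addRight (1 : ZMod n)).bijective s

lemma le_measureReal_of_phaseMap_invariant {n : ℕ} [NeZero n] {μ : Measure α}
    [IsProbabilityMeasure μ] {σ : α → α} (hσ : Ergodic σ μ) {E : Set (α × ZMod n)}
    (hE : MeasurableSet E) (hi : phaseMap n σ ⁻¹' E = E)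
    (h0 : 0 < (μ.prod (uniformZMod n)).real E) :
    (n : ℝ)⁻¹ ≤ (μ.prod (uniformZMod n)).real E := by
  let S : ZMod n → Set α := fun j => (fun x => (x, j)) ⁻¹' E
  have hS : ∀ j, MeasurableSet (S j) := fun j => measurable_prodMk_right hE
  let U : Set α := ⋃ j, S j
  have hU : MeasurableSet U := MeasurableSet.iUnion hS
  have hUi : σ ⁻¹' U = U := by
    ext x
    simp only [U, S, Set.mem_preimage, Set.mem_iUnion]
    constructor
    · rintro ⟨j, hj⟩
      refine ⟨j - 1, ?_⟩
      rw [← hi]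
      simpa [phaseMap] using hj
    · rintro ⟨j, hj⟩
      rw [← hi] at hj
      exact ⟨j + 1, hj⟩
  have hval : (μ.prod (uniformZMod n)).real E = (n : ℝ)⁻¹ * ∑ j, μ.real (S j) := by
    rw [← integral_uniformZMod, Measure.real, Measure.prod_apply_symm hE]
    rw [integral_eq_lintegral_of_nonneg_ae (Eventually.of_forall fun _ => measureReal_nonneg)
      (measurable_of_finite _).aestronglyMeasurable]
    congr 1
    refine lintegral_congr fun j => ?_
    rw [Measure.real, ENNReal.ofReal_toReal (measure_ne_top _ _)]
  have hn : (0 : ℝ) < (n : ℝ)⁻¹ := by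
    have : (0 : ℝ) < n := by exact_mod_cast Nat.pos_of_ne_zero (NeZero.ne n)
    positivity
  rw [hval] at h0 ⊢
  rcases hσ.toPreErgodic.prob_eq_zero_or_one hU hUi with h | h
  · have : ∀ j, μ.real (S j) = 0 := fun j => by
      rw [measureReal_eq_zero_iff]
      exact measure_mono_null (Set.subset_iUnion S j) h
    simp [this] at h0
  · have h1 : (1 : ℝ) ≤ ∑ j, μ.real (S j) := by
      have h2 : μ.real U = 1 := by simp [Measure.real, h]
      rw [← h2]
      exact measureReal_iUnion_fintype_le S
    exact le_mul_of_one_le_right hn.le h1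

/-- An ergodic component of the extension by a phase, with small average of `g`. -/
lemma exists_ergodic_phase_measure {n : ℕ} [NeZero n] {μ : Measure α}
    [IsProbabilityMeasure μ] {σ : α → α} (hσ : Ergodic σ μ) {g : α × ZMod n → ℝ}
    (hg : Integrable g (μ.prod (uniformZMod n))) :
    ∃ P : Measure (α × ZMod n), IsProbabilityMeasure P ∧ Ergodic (phaseMap n σ) P ∧
      P.map Prod.fst = μ ∧ ∫ ω, g ω ∂P ≤ (n : ℝ)⁻¹ * ∑ j, ∫ x, g (x, j) ∂μ := by
  have hn : (0 : ℝ) < n := by exact_mod_cast Nat.pos_of_ne_zero (NeZero.ne n)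
  obtain ⟨E, hE, hE0, hEe, hEg⟩ := exists_ergodic_cond
    (measurePreserving_phaseMap (n := n) hσ.toMeasurePreserving) (inv_pos.2 hn)
    (fun E h1 h2 h3 => le_measureReal_of_phaseMap_invariant hσ h1 h2 h3) hg
  have hm0 : (μ.prod (uniformZMod n)) E ≠ 0 := fun h0 => by simp [Measure.real, h0] at hE0
  have hP := ProbabilityTheory.cond_isProbabilityMeasure hm0
  refine ⟨_, hP, hEe, ?_, ?_⟩
  · have := Measure.isProbabilityMeasure_map
      (μ := ProbabilityTheory.cond (μ.prod (uniformZMod n)) E)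
      (f := Prod.fst) measurable_fst.aemeasurable
    refine hσ.eq_of_absolutelyContinuous ?_ ?_
    · refine ⟨hσ.measurable, ?_⟩
      rw [Measure.map_map hσ.measurable measurable_fst]
      conv_rhs => rw [← hEe.map_eq, Measure.map_map measurable_fst hEe.measurable]
      rfl
    · have h1 := (ProbabilityTheory.cond_absolutelyContinuous
        (μ := μ.prod (uniformZMod n)) (s := E)).map (measurable_fst (α := α) (β := ZMod n))
      rwa [measurePreserving_fst.map_eq] at h1
  · refine hEg.trans_eq ?_
    rw [integral_prod_symm _ hg, integral_uniformZMod]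

end ErgodicComponent

/-- Two points are indistinguishable if no measurable set separates them. -/
def Indist {α : Type*} [MeasurableSpace α] (a b : α) : Prop :=
  ∀ s, MeasurableSet s → a ∈ s → b ∈ s

namespace Indist

variable {α β : Type*} [MeasurableSpace α] [MeasurableSpace β] {a b c : α}

lemma refl (a : α) : Indist a a := fun _ _ h => h

lemma symm (h : Indist a b) : Indist b a := fun s hs hb => by
  by_contra ha
  exact h sᶜ hs.compl ha hb

lemma trans (h : Indist a b) (h' : Indist b c) : Indist a c :=
  fun s hs ha => h' s hs (h s hs ha)

lemma map (h : Indist a b) {f : α → β} (hf : Measurable f) : Indist (f a) (f b) :=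
  fun _ hs ha => h _ (hf hs) ha

lemma prodMk {a' b' : β} (h : Indist a b) (h' : Indist a' b') : Indist (a, a') (b, b') :=
  (h.map measurable_prodMk_right).trans (h'.map measurable_prodMk_left)

lemma pi {ι : Type*} {x y : ι → α} (h : ∀ i, Indist (x i) (y i)) : Indist x y := by
  let m : MeasurableSpace (ι → α) :=
    { MeasurableSet' := fun s => x ∈ s ↔ y ∈ s
      measurableSet_empty := by simp
      measurableSet_compl := fun s hs => by simp [hs]
      measurableSet_iUnion := fun f hf => by simp [hf] }
  have hle : MeasurableSpace.pi ≤ m := by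
    refine iSup_le fun i => ?_
    rintro s ⟨t, ht, rfl⟩
    exact ⟨h i t ht, (h i).symm t ht⟩
  exact fun s hs => (hle s hs).1

lemma measurableSet [Finite α] (a : α) : MeasurableSet {b | Indist a b} := by
  convert MeasurableSet.measurableAtom_of_countable a
  ext b
  constructor
  · exact fun h => h _ (MeasurableSet.measurableAtom_of_countable a) (mem_measurableAtom_self a)
  · exact fun h s hs ha => mem_of_mem_measurableAtom h hs ha

end Indist

section AtomRep

variable {α : Type*} [MeasurableSpace α]

/-- Indistinguishability as an equivalence relation. -/
def indistSetoid (α : Type*) [MeasurableSpace α] : Setoid α where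
  r := Indist
  iseqv := ⟨Indist.refl, Indist.symm, Indist.trans⟩

/-- A chosen representative of the class of indistinguishable points. -/
noncomputable def atomRep (a : α) : α := (Quotient.mk (indistSetoid α) a).out

lemma indist_atomRep (a : α) : Indist (atomRep a) a :=
  Quotient.exact (s := indistSetoid α) (Quotient.out_eq _)

lemma atomRep_eq_iff {a b : α} : atomRep a = atomRep b ↔ Indist a b := by
  constructor
  · intro h
    exact (indist_atomRep a).symm.trans (h ▸ indist_atomRep b)
  · intro h
    exact congrArg Quotient.out (Quotient.sound (s := indistSetoid α) h)

lemma atomRep_atomRep (a : α) : atomRep (atomRep a) = atomRep a :=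
  atomRep_eq_iff.2 (indist_atomRep a)

lemma fiberMeasurable_atomRep [Finite α] : FiberMeasurable (atomRep : α → α) := by
  intro s
  by_cases h : ∃ a, atomRep a = s
  · obtain ⟨a, rfl⟩ := h
    convert Indist.measurableSet a
    ext b
    simp only [Set.mem_preimage, Set.mem_singleton_iff, Set.mem_ofPred_eq]
    rw [eq_comm, atomRep_eq_iff]
  · convert MeasurableSet.empty
    ext b
    simp only [Set.mem_preimage, Set.mem_singleton_iff, Set.mem_empty_iff_false, iff_false]
    exact fun hb => h ⟨b, hb⟩

lemma measurableSingletonClass_of_indist [Finite α] (h : ∀ a b : α, Indist a b → a = b) :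
    MeasurableSingletonClass α := by
  refine ⟨fun a => ?_⟩
  convert Indist.measurableSet a
  ext b
  exact ⟨fun hb => hb ▸ Indist.refl b, fun hb => (h a b hb).symm⟩

lemma measure_eq_of_saturated {ν : Measure α} {A B : Set α} (h : A ⊆ B)
    (hB : ∀ b ∈ B, ∃ a ∈ A, Indist a b) : ν A = ν B := by
  refine le_antisymm (measure_mono h) ?_
  rw [← measure_toMeasurable A]
  refine measure_mono fun b hb => ?_
  obtain ⟨a, ha, hab⟩ := hB b hb
  exact hab _ (measurableSet_toMeasurable ν A) (subset_toMeasurable ν A ha)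

variable {X Y : Type*} [MeasurableSpace X] [MeasurableSpace Y]

/-- The smallest distortion between points indistinguishable from the given ones. -/
noncomputable def atomCost (d : X → Y → ℝ) (x : X) (y : Y) : ℝ :=
  ⨅ p : {p : X × Y // Indist x p.1 ∧ Indist y p.2}, d p.1.1 p.1.2

variable {d : X → Y → ℝ}

lemma atomCost_le [Finite X] [Finite Y] (x : X) (y : Y) : atomCost d x y ≤ d x y :=
  ciInf_le (Set.finite_range _).bddBelow
    (⟨(x, y), Indist.refl x, Indist.refl y⟩ : {p : X × Y // Indist x p.1 ∧ Indist y p.2})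

lemma atomCost_nonneg (hd : ∀ x y, 0 ≤ d x y) (x : X) (y : Y) : 0 ≤ atomCost d x y :=
  Real.iInf_nonneg fun _ => hd _ _

lemma atomCost_atomRep (x : X) (y : Y) : atomCost d (atomRep x) y = atomCost d x y := by
  have h : Indist (atomRep x) = Indist x := funext fun z => propext
    ⟨(indist_atomRep x).symm.trans, (indist_atomRep x).trans⟩
  rw [atomCost, h, atomCost]

lemma integral_le_integral_atomCost (hd : ∀ x y, 0 ≤ d x y) {ν : Measure α} {f : α → X} {e : α → Y}
    (h : ∀ a x y, Indist (f a) x → Indist (e a) y → ∃ b, Indist a b ∧ f b = x ∧ e b = y) :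
    ∫ a, d (f a) (e a) ∂ν ≤ ∫ a, atomCost d (f a) (e a) ∂ν := by
  by_cases hm : AEStronglyMeasurable (fun a => d (f a) (e a)) ν
  · refine le_of_eq (integral_congr_ae ?_)
    obtain ⟨g, hg, hfg⟩ := hm
    have hN := measure_toMeasurable (μ := ν) {a | ¬ d (f a) (e a) = g a}
    have h0 : ν {a | ¬ d (f a) (e a) = g a} = 0 := hfg
    rw [h0] at hN
    have hae : ∀ᵐ a ∂ν, a ∉ toMeasurable ν {a | ¬ d (f a) (e a) = g a} := by
      rw [ae_iff]
      simpa using hN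
    filter_upwards [hae] with a ha
    have hgood : ∀ b, Indist a b → d (f b) (e b) = g a := by
      intro b hb
      have h1 : b ∉ toMeasurable ν {a | ¬ d (f a) (e a) = g a} :=
        fun hb' => ha (hb.symm _ (measurableSet_toMeasurable _ _) hb')
      have h2 : d (f b) (e b) = g b := by
        by_contra hne
        exact h1 (subset_toMeasurable _ _ hne)
      have h3 : g b = g a := hb (g ⁻¹' {g a}) (hg.measurable (measurableSet_singleton _)) rfl
      rw [h2, h3]
    have hne : Nonempty {p : X × Y // Indist (f a) p.1 ∧ Indist (e a) p.2} :=
      ⟨⟨(f a, e a), Indist.refl _, Indist.refl _⟩⟩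
    have hc : ∀ p : {p : X × Y // Indist (f a) p.1 ∧ Indist (e a) p.2},
        d p.1.1 p.1.2 = d (f a) (e a) := by
      rintro ⟨⟨x, y⟩, hx, hy⟩
      obtain ⟨b, hab, rfl, rfl⟩ := h a x y hx hy
      rw [hgood b hab, hgood a (Indist.refl a)]
    rw [atomCost]
    simp only [hc, ciInf_const]
  · rw [integral_undef fun hi => hm hi.aestronglyMeasurable]
    exact integral_nonneg fun a => atomCost_nonneg hd _ _

end AtomRep

section NonatomicAlphabet

variable {Ω A B : Type*} [MeasurableSpace Ω] {P : Measure Ω}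

lemma sum_comp_eq_sum_card_mul [Fintype A] [DecidableEq A] (r : A → A) (F : A → ℝ) :
    ∑ s, F (r s) = ∑ t, ((Finset.univ.filter fun s => r s = t).card : ℝ) * F t := by
  rw [← Finset.sum_fiberwise (s := Finset.univ) (g := r)]
  refine Finset.sum_congr rfl fun t _ => ?_
  rw [Finset.sum_congr rfl fun s hs => by rw [(Finset.mem_filter.1 hs).2], Finset.sum_const,
    nsmul_eq_mul]

/-- If the fibres of `S` cannot be resolved by measurable sets, its conditional entropy is large. -/
lemma le_shCondEntropy_of_fibers [IsProbabilityMeasure P] [Fintype A] [Fintype B] [DecidableEq A]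
    {S : Ω → A} {T : Ω → B} {rA : A → A} {rB : B → B}
    (hA : FiberMeasurable fun ω => rA (S ω)) (hB : FiberMeasurable fun ω => rB (T ω))
    (hST : ∀ s t, P.real ((fun ω => (S ω, T ω)) ⁻¹' {(s, t)}) =
      P.real ((fun ω => (rA (S ω), rB (T ω))) ⁻¹' {(rA s, rB t)}))
    (hT : ∀ t, P.real (T ⁻¹' {t}) = P.real ((fun ω => rB (T ω)) ⁻¹' {rB t}))
    {M ρ : ℝ} (hM1 : 1 ≤ M) (hM : ∀ x, P.real ((fun ω => (rA (S ω), rB (T ω))) ⁻¹' {x}) ≠ 0 →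
      M ≤ (Finset.univ.filter fun s => rA s = x.1).card)
    (hρ : ∀ x, P.real ((fun ω => (rA (S ω), rB (T ω))) ⁻¹' {x}) ≤ ρ) :
    (M - 1) * (-Real.logb 2 ρ) ≤ shCondEntropy P S T := by
  classical
  set Q : A × B → ℝ := fun x => P.real ((fun ω => (rA (S ω), rB (T ω))) ⁻¹' {x}) with hQ
  set R : B → ℝ := fun t => P.real ((fun ω => rB (T ω)) ⁻¹' {t}) with hR
  have hQ0 : ∀ x, 0 ≤ Q x := fun x => measureReal_nonneg
  have hQR : ∀ x, Q x ≤ R x.2 := fun x => real_pair_le_right _ _ x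
  have hQ1 : ∀ x, Q x ≤ 1 := fun x => measureReal_le_one
  have hsum : ∀ t, ∑ s, Q (s, t) = R t := fun t => sum_real_pair hA hB t
  have htot : ∑ x, Q x = 1 := sum_real_fiber (hA.prodMk hB)
  set h : ℝ → ℝ := fun x => -(x * Real.logb 2 x) with hh
  have hh0 : ∀ x, 0 ≤ h (Q x) := fun x => by
    have := Real.logb_nonpos (b := 2) (by norm_num) (hQ0 x) (hQ1 x)
    simp only [hh]
    nlinarith [hQ0 x]
  have hne : ∀ x, Q x ≠ 0 → ∃ ω, (rA (S ω), rB (T ω)) = x := by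
    intro x hx
    by_contra! hc
    apply hx
    have : (fun ω => (rA (S ω), rB (T ω))) ⁻¹' {x} = ∅ := by
      ext ω
      simp [hc ω]
    simp only [hQ]
    rw [this, measureReal_empty]
  set K : B → ℝ := fun t => (M - 1) * ∑ s, h (Q (s, t)) with hK
  have hK0 : ∀ t, 0 ≤ K t := fun t =>
    mul_nonneg (by linarith) (Finset.sum_nonneg fun s _ => hh0 _)
  have hent : shCondEntropy P S T = ∑ t, (∑ s, h (Q (rA s, rB t)) - h (R (rB t))) := by
    rw [shCondEntropy, shEntropy_eq, shEntropy_eq, Fintype.sum_prod_type_right,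
      Finset.sum_sub_distrib, ← Finset.sum_neg_distrib, ← Finset.sum_neg_distrib]
    congr 1
    · refine Finset.sum_congr rfl fun t _ => ?_
      rw [← Finset.sum_neg_distrib]
      refine Finset.sum_congr rfl fun s _ => ?_
      rw [hST]
    · refine Finset.sum_congr rfl fun t _ => ?_
      rw [hT]
  have hG : ∀ t, K t ≤ ∑ s, h (Q (rA s, t)) - h (R t) := by
    intro t
    have h1 : M * ∑ s, h (Q (s, t)) ≤ ∑ s, h (Q (rA s, t)) := by
      rw [sum_comp_eq_sum_card_mul rA fun s => h (Q (s, t)), Finset.mul_sum]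
      refine Finset.sum_le_sum fun s _ => ?_
      by_cases hx : Q (s, t) = 0
      · simp [hx, hh]
      · exact mul_le_mul_of_nonneg_right (hM _ hx) (hh0 _)
    have h2 : h (R t) ≤ ∑ s, h (Q (s, t)) := by
      have : h (R t) = ∑ s, -(Q (s, t) * Real.logb 2 (R t)) := by
        rw [Finset.sum_neg_distrib, ← Finset.sum_mul, hsum]
      rw [this]
      refine Finset.sum_le_sum fun s _ => ?_
      rcases (hQ0 (s, t)).eq_or_lt with h0 | h0
      · simp [← h0, hh]
      · have := Real.logb_le_logb_of_le (b := 2) (by norm_num) h0 (hQR (s, t))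
        simp only [hh]
        nlinarith
    simp only [hK]
    linarith
  rw [hent]
  calc (M - 1) * (-Real.logb 2 ρ) ≤ (M - 1) * ∑ x, h (Q x) := by
        refine mul_le_mul_of_nonneg_left ?_ (by linarith)
        calc -Real.logb 2 ρ = ∑ x, -(Q x * Real.logb 2 ρ) := by
              rw [Finset.sum_neg_distrib, ← Finset.sum_mul, htot, one_mul]
          _ ≤ _ := by
              refine Finset.sum_le_sum fun x _ => ?_
              rcases (hQ0 x).eq_or_lt with h0 | h0
              · simp [← h0, hh]
              · have := Real.logb_le_logb_of_le (b := 2) (by norm_num) h0 (hρ x)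
                simp only [hh]
                nlinarith
    _ = ∑ t, K t := by
        rw [Fintype.sum_prod_type_right, Finset.mul_sum]
    _ ≤ ∑ t, K (rB t) := by
        rw [sum_comp_eq_sum_card_mul rB K]
        refine Finset.sum_le_sum fun t _ => ?_
        by_cases ht : ∃ t', rB t' = t
        · obtain ⟨t', ht'⟩ := ht
          have : 0 < (Finset.univ.filter fun s => rB s = t).card :=
            Finset.card_pos.2 ⟨t', by simp [ht']⟩
          exact le_mul_of_one_le_left (hK0 t) (by exact_mod_cast this)
        · have : K t = 0 := by
            simp only [hK]
            rw [Finset.sum_eq_zero, mul_zero]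
            intro s _
            by_cases hx : Q (s, t) = 0
            · simp [hx, hh]
            · obtain ⟨ω, hω⟩ := hne _ hx
              exact absurd ⟨_, (Prod.ext_iff.1 hω).2⟩ ht
          simp [this]
    _ ≤ _ := Finset.sum_le_sum fun t _ => hG (rB t)

lemma shEntropy_eq_zero_of_trivial [Fintype A] {S : Ω → A}
    (h : ∀ s, P.real (S ⁻¹' {s}) = 0 ∨ P.real (S ⁻¹' {s}) = 1) : shEntropy P S = 0 := by
  rw [shEntropy_eq, Finset.sum_eq_zero, neg_zero]
  intro s _
  rcases h s with h | h <;> simp [h]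

end NonatomicAlphabet

section NonatomicBlocks

variable {Ω A B : Type*} [MeasurableSpace Ω] [MeasurableSpace A] [MeasurableSpace B]
  {P : Measure Ω} {N : ℕ} {U : Ω → Fin N → A} {V : Ω → Fin N → B}

/-- Every pair of blocks indistinguishable from the observed one is observed at an
indistinguishable point. -/
def LiftsIndist (U : Ω → Fin N → A) (V : Ω → Fin N → B) : Prop :=
  ∀ ω s t, (∀ i, Indist (U ω i) (s i)) → (∀ i, Indist (V ω i) (t i)) →
    ∃ ω', Indist ω ω' ∧ U ω' = s ∧ V ω' = t

lemma fiberMeasurable_atomRep_block [Finite A] {U : Ω → Fin N → A}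
    (hU : ∀ i, Measurable fun ω => U ω i) :
    FiberMeasurable fun ω => fun i => atomRep (U ω i) :=
  FiberMeasurable.pi fun i => fiberMeasurable_atomRep.comp_measurable (hU i)

lemma LiftsIndist.real_pair (h : LiftsIndist U V) (s : Fin N → A) (t : Fin N → B) :
    P.real ((fun ω => (U ω, V ω)) ⁻¹' {(s, t)}) =
      P.real ((fun ω => ((fun i => atomRep (U ω i)), (fun i => atomRep (V ω i)))) ⁻¹'
        {((fun i => atomRep (s i)), (fun i => atomRep (t i)))}) := by
  rw [measureReal_def, measureReal_def]
  congr 1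
  refine measure_eq_of_saturated ?_ ?_
  · rintro ω hω
    obtain ⟨rfl, rfl⟩ := Prod.ext_iff.1 hω
    rfl
  · intro ω hω
    obtain ⟨h1, h2⟩ := Prod.ext_iff.1 hω
    obtain ⟨ω', h3, rfl, rfl⟩ := h ω s t (fun i => atomRep_eq_iff.1 (congrFun h1 i))
      (fun i => atomRep_eq_iff.1 (congrFun h2 i))
    exact ⟨ω', rfl, h3.symm⟩

lemma LiftsIndist.real_right (h : LiftsIndist U V) (t : Fin N → B) :
    P.real (V ⁻¹' {t}) =
      P.real ((fun ω => fun i => atomRep (V ω i)) ⁻¹' {fun i => atomRep (t i)}) := by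
  rw [measureReal_def, measureReal_def]
  congr 1
  refine measure_eq_of_saturated ?_ ?_
  · rintro ω rfl
    rfl
  · intro ω h2
    obtain ⟨ω', h3, -, rfl⟩ := h ω (U ω) t (fun i => Indist.refl _)
      (fun i => atomRep_eq_iff.1 (congrFun h2 i))
    exact ⟨ω', rfl, h3.symm⟩

lemma two_pow_card_le_card_fiber [Fintype A] [DecidableEq A] {a a' : A} (hne : a ≠ a')
    (ha : Indist a a') (s : Fin N → A) :
    2 ^ (Finset.univ.filter fun i => atomRep (s i) = atomRep a).card ≤
      (Finset.univ.filter fun s' : Fin N → A =>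
        (fun i => atomRep (s' i)) = fun i => atomRep (s i)).card := by
  classical
  set J := Finset.univ.filter fun i => atomRep (s i) = atomRep a with hJ
  rw [← Finset.card_powerset]
  refine Finset.card_le_card_of_injOn
    (fun K i => if i ∈ J then (if i ∈ K then a else a') else s i) ?_ ?_
  · intro K _
    simp only [Finset.coe_filter, Finset.mem_univ, true_and, Set.mem_ofPred_eq]
    funext i
    by_cases hi : i ∈ J
    · have h1 : atomRep (s i) = atomRep a := (Finset.mem_filter.1 hi).2
      simp only [hi, if_true]
      split_ifs
      · exact h1.symm
      · exact (atomRep_eq_iff.2 ha.symm).trans h1.symm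
    · simp [hi]
  · intro K hK K' hK' h
    have hKJ := Finset.mem_powerset.1 hK
    have hKJ' := Finset.mem_powerset.1 hK'
    ext i
    have hi := congrFun h i
    simp only at hi
    constructor
    · intro hk
      by_contra hk'
      simp only [hKJ hk, hk, hk', if_true, if_false] at hi
      exact hne hi
    · intro hk
      by_contra hk'
      simp only [hKJ' hk, hk, hk', if_true, if_false] at hi
      exact hne hi.symm

lemma le_shCondEntropy_of_nonatomic [Fintype A] [Fintype B] [IsProbabilityMeasure P]
    (hU : ∀ i, Measurable fun ω => U ω i) (hV : ∀ i, Measurable fun ω => V ω i)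
    (h : LiftsIndist U V) {a a' : A} (hne : a ≠ a') (ha : Indist a a') {L : ℕ} [DecidableEq A]
    (hL : ∀ᵐ ω ∂P, L ≤ (Finset.univ.filter fun i => atomRep (U ω i) = atomRep a).card)
    {ρ : ℝ} (i₀ : Fin N)
    (hρ : ∀ x, P.real ((fun ω => (atomRep (U ω i₀), atomRep (V ω i₀))) ⁻¹' {x}) ≤ ρ) :
    (2 ^ L - 1) * (-Real.logb 2 ρ) ≤ shCondEntropy P U V := by
  classical
  have hU' := fiberMeasurable_atomRep_block (N := N) hU
  have hV' := fiberMeasurable_atomRep_block (N := N) hV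
  refine le_shCondEntropy_of_fibers (rA := fun s i => atomRep (s i))
    (rB := fun t i => atomRep (t i)) hU' hV' h.real_pair h.real_right
    (one_le_pow₀ (by norm_num)) ?_ ?_
  · rintro ⟨s, t⟩ hx
    have hx' : P ((fun ω => ((fun i => atomRep (U ω i)), (fun i => atomRep (V ω i)))) ⁻¹'
        {(s, t)}) ≠ 0 := fun h0 => hx (by rw [measureReal_def, h0]; rfl)
    obtain ⟨ω, hω, hLω⟩ : ∃ ω, ω ∈ _ ∧ L ≤ _ := by
      by_contra! hcon
      exact hx' (measure_mono_null (fun ω hω => (hcon ω hω).not_ge) (ae_iff.1 hL))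
    obtain ⟨rfl, -⟩ := Prod.ext_iff.1 hω
    have h1 := two_pow_card_le_card_fiber hne ha (U ω)
    have h2 : 2 ^ L ≤ _ := (Nat.pow_le_pow_right (by norm_num) hLω).trans h1
    exact_mod_cast h2
  · rintro ⟨s, t⟩
    refine (measureReal_mono ?_).trans (hρ (s i₀, t i₀))
    intro ω hω
    obtain ⟨rfl, rfl⟩ := Prod.ext_iff.1 hω
    rfl

lemma measureReal_fiber_of_ae_eq {γ : Type*} [IsProbabilityMeasure P] {F : Ω → γ} {c : γ}
    (hF : ∀ᵐ ω ∂P, F ω = c) (x : γ) :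
    P.real (F ⁻¹' {x}) = 0 ∨ P.real (F ⁻¹' {x}) = 1 := by
  by_cases hx : c = x
  · right
    have h1 : F ⁻¹' {x} =ᵐ[P] Set.univ := by
      filter_upwards [hF] with ω hω
      exact propext ⟨fun _ => trivial, fun _ => hω.trans hx⟩
    rw [measureReal_congr h1, probReal_univ]
  · left
    rw [measureReal_eq_zero_iff]
    refine measure_mono_null ?_ (ae_iff.1 hF)
    intro ω hω h'
    exact hx (h'.symm.trans hω)

lemma shCondEntropy_eq_zero_of_atomRep_const [Fintype A] [Fintype B] [IsProbabilityMeasure P]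
    (h : LiftsIndist U V) {a : A} {b : B}
    (hab : ∀ i, ∀ᵐ ω ∂P, (atomRep (U ω i), atomRep (V ω i)) = (a, b)) :
    shCondEntropy P U V = 0 := by
  have hae : ∀ᵐ ω ∂P, ∀ i, (atomRep (U ω i), atomRep (V ω i)) = (a, b) := ae_all_iff.2 hab
  rw [shCondEntropy, shEntropy_eq_zero_of_trivial, shEntropy_eq_zero_of_trivial, sub_zero]
  · intro t
    rw [h.real_right]
    refine measureReal_fiber_of_ae_eq (c := fun _ => b) ?_ _
    filter_upwards [hae] with ω hω
    funext i
    exact (Prod.ext_iff.1 (hω i)).2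
  · rintro ⟨s, t⟩
    rw [h.real_pair]
    refine measureReal_fiber_of_ae_eq (c := (fun _ => a, fun _ => b)) ?_ _
    filter_upwards [hae] with ω hω
    exact Prod.ext (funext fun i => (Prod.ext_iff.1 (hω i)).1)
      (funext fun i => (Prod.ext_iff.1 (hω i)).2)

end NonatomicBlocks

section DegenerateRates

variable {γ A B : Type*} [MeasurableSpace γ] [MeasurableSpace A] [MeasurableSpace B]

lemma liftsIndist_coordinates {f : γ → A} {g : γ → B}
    (hfg : ∀ c s t, Indist (f c) s → Indist (g c) t → ∃ c', Indist c c' ∧ f c' = s ∧ g c' = t)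
    (N : ℕ) :
    LiftsIndist (fun (x : ℤ → γ) (i : Fin N) => f (x ((i : ℕ) + 1)))
      (fun x (i : Fin N) => g (x ((i : ℕ) + 1))) := by
  intro x s t hs ht
  choose c hc using fun i => hfg _ _ _ (hs i) (ht i)
  refine ⟨fun z => if h : 1 ≤ z ∧ z ≤ N then c ⟨(z - 1).toNat, by omega⟩ else x z, ?_, ?_, ?_⟩
  · refine Indist.pi fun z => ?_
    by_cases h : 1 ≤ z ∧ z ≤ N
    · have h1 := (hc ⟨(z - 1).toNat, by omega⟩).1
      have h2 : (((z - 1).toNat : ℕ) : ℤ) + 1 = z := by omega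
      simp only [h2] at h1
      simpa [h] using h1
    · simpa [h] using Indist.refl (x z)
  · funext i
    have h1 : (1 : ℤ) ≤ (i : ℕ) + 1 ∧ ((i : ℕ) : ℤ) + 1 ≤ N := by omega
    simp only [h1, and_self, dif_pos, add_sub_cancel_right, Int.toNat_natCast]
    exact (hc i).2.1
  · funext i
    have h1 : (1 : ℤ) ≤ (i : ℕ) + 1 ∧ ((i : ℕ) : ℤ) + 1 ≤ N := by omega
    simp only [h1, and_self, dif_pos, add_sub_cancel_right, Int.toNat_natCast]
    exact (hc i).2.2

lemma ae_coordinate_of_ae {ν : Measure (ℤ → γ)} (hν : MeasurePreserving shiftZ ν ν)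
    {p : γ → Prop} (h : ∀ᵐ x ∂ν, p (x 1)) (i : ℕ) : ∀ᵐ x ∂ν, p (x (i + 1)) := by
  induction i with
  | zero => simpa using h
  | succ i ih =>
    filter_upwards [hν.quasiMeasurePreserving.ae ih] with x hx
    simpa [shiftZ] using hx

lemma le_card_of_phase {n : ℕ} (a : A) (u : ℤ → A) {o : Fin n}
    (ho : ∀ b : ℕ, Indist a (u ((o : ℕ) + b * n + 1))) (L : ℕ) [DecidableEq A] :
    L ≤ (Finset.univ.filter
      fun i : Fin (n * L) => atomRep (u ((i : ℕ) + 1)) = atomRep a).card := by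
  have hb : ∀ b : Fin L, (o : ℕ) + b * n < n * L := fun b => by
    have h1 : ((b : ℕ) + 1) * n ≤ L * n := Nat.mul_le_mul_right _ b.2
    have := o.2
    nlinarith
  have hc : (Finset.univ : Finset (Fin L)).card = L := by simp
  conv_lhs => rw [← hc]
  refine Finset.card_le_card_of_injOn (fun b => ⟨(o : ℕ) + b * n, hb b⟩) ?_ ?_
  · intro b _
    simp only [Finset.coe_filter, Finset.mem_univ, true_and, Set.mem_ofPred_eq]
    refine (atomRep_eq_iff.2 ?_).symm
    simpa using ho b
  · intro b _ b' _ h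
    have h1 : (o : ℕ) + b * n = o + b' * n := by simpa using h
    exact Fin.ext (Nat.eq_of_mul_eq_mul_right o.pos (by omega))

lemma eventually_mul_lt_two_pow (C : ℝ) {c : ℝ} (hc : 0 < c) :
    ∀ᶠ L : ℕ in atTop, C * L < (2 ^ L - 1) * c := by
  have h1 := (tendsto_pow_const_div_const_pow_of_one_lt 1 (one_lt_two (α := ℝ))).const_mul |C|
  have h2 : ∀ᶠ L : ℕ in atTop, |C| * ((L : ℝ) ^ 1 / 2 ^ L) < c / 2 :=
    h1.eventually (gt_mem_nhds (by simpa using half_pos hc))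
  filter_upwards [h2, eventually_ge_atTop 1] with L hL hL1
  have h3 : (2 : ℝ) ≤ 2 ^ L := by
    simpa using pow_le_pow_right₀ (one_le_two (α := ℝ)) hL1
  rw [pow_one, ← mul_div_assoc, div_lt_iff₀ (by positivity)] at hL
  have h4 : C * L ≤ |C| * L := by gcongr; exact le_abs_self C
  nlinarith

/-- Block entropies of a process visiting a nonatomic letter periodically either vanish or grow
superlinearly. -/
lemma block_entropy_dichotomy [Fintype A] [Fintype B] {ν : Measure (ℤ → γ)}
    [IsProbabilityMeasure ν] (hν : MeasurePreserving shiftZ ν ν) {f : γ → A} {g : γ → B}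
    (hf : Measurable f) (hg : Measurable g)
    (hfg : ∀ c s t, Indist (f c) s → Indist (g c) t → ∃ c', Indist c c' ∧ f c' = s ∧ g c' = t)
    {a a' : A} (hne : a ≠ a') (ha : Indist a a') {n : ℕ} (hn : 0 < n)
    (hph : ∀ᵐ x ∂ν, ∃ o : Fin n, ∀ b : ℕ, Indist a (f (x ((o : ℕ) + b * n + 1)))) :
    (∀ N, shCondEntropy ν (fun (x : ℤ → γ) (i : Fin N) => f (x ((i : ℕ) + 1)))
      (fun x (i : Fin N) => g (x ((i : ℕ) + 1))) = 0) ∨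
    ¬ ∃ C : ℝ, ∀ᶠ N : ℕ in atTop,
      shCondEntropy ν (fun (x : ℤ → γ) (i : Fin N) => f (x ((i : ℕ) + 1)))
        (fun x (i : Fin N) => g (x ((i : ℕ) + 1))) ≤ C * N := by
  classical
  set F : (ℤ → γ) → A × B := fun x => (atomRep (f (x 1)), atomRep (g (x 1))) with hF
  have hmf : ∀ z : ℤ, Measurable fun x : ℤ → γ => f (x z) := fun z =>
    hf.comp (measurable_pi_apply z)
  have hmg : ∀ z : ℤ, Measurable fun x : ℤ → γ => g (x z) := fun z =>
    hg.comp (measurable_pi_apply z)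
  have hFm : FiberMeasurable F :=
    (fiberMeasurable_atomRep.comp_measurable (hmf 1)).prodMk
      (fiberMeasurable_atomRep.comp_measurable (hmg 1))
  by_cases hcase : ∃ v, ν.real (F ⁻¹' {v}) = 1
  · left
    obtain ⟨⟨v, v'⟩, hv⟩ := hcase
    have hae : ∀ᵐ x ∂ν, F x = (v, v') := by
      have h1 : ν (F ⁻¹' {(v, v')}) = 1 := by
        rw [measureReal_def] at hv
        exact (ENNReal.toReal_eq_one_iff _).1 hv
      exact (prob_compl_eq_zero_iff (hFm _)).2 h1
    intro N
    exact shCondEntropy_eq_zero_of_atomRep_const (liftsIndist_coordinates hfg N)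
      fun i => ae_coordinate_of_ae hν (p := fun c => (atomRep (f c), atomRep (g c)) = (v, v'))
        hae i
  · right
    push Not at hcase
    rintro ⟨C, hC⟩
    obtain ⟨ρ, hρ0, hρ1, hρ⟩ : ∃ ρ : ℝ, 0 < ρ ∧ ρ < 1 ∧ ∀ v, ν.real (F ⁻¹' {v}) ≤ ρ := by
      have : Nonempty (A × B) := (inferInstance : NeZero ν).ne |> fun h => by
        obtain ⟨x⟩ : Nonempty (ℤ → γ) := nonempty_of_isProbabilityMeasure ν
        exact ⟨F x⟩
      obtain ⟨v, hv⟩ := Finite.exists_max fun v => ν.real (F ⁻¹' {v})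
      refine ⟨max (1 / 2) (ν.real (F ⁻¹' {v})), by positivity, max_lt (by norm_num) ?_,
        fun w => (hv w).trans (le_max_right _ _)⟩
      exact lt_of_le_of_ne measureReal_le_one (hcase v)
    have hc : 0 < -Real.logb 2 ρ := neg_pos.2 (Real.logb_neg one_lt_two hρ0 hρ1)
    have hnL : Tendsto (fun L : ℕ => n * L) atTop atTop :=
      tendsto_id.const_mul_atTop' hn
    obtain ⟨L, hL1, hL2, hL3⟩ := ((hnL.eventually hC).and
      ((eventually_mul_lt_two_pow (C * n) hc).and (eventually_ge_atTop 1))).exists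
    have hN : 0 < n * L := Nat.mul_pos hn hL3
    have h1 := le_shCondEntropy_of_nonatomic (P := ν) (fun i : Fin (n * L) => hmf _)
      (fun i : Fin (n * L) => hmg _) (liftsIndist_coordinates hfg (n * L)) hne ha (L := L)
      (hph.mono fun x ⟨o, ho⟩ => le_card_of_phase a (fun z => f (x z)) ho L) (ρ := ρ) ⟨0, hN⟩
      (fun v => by simpa [hF] using hρ v)
    push_cast at hL1
    have : C * n * L = C * (n * L) := by ring
    linarith

/-- The entropy rate of a stationary process visiting a nonatomic letter periodically has the
value zero. -/
lemma entropyRate_eq_zero_of_nonatomic [Fintype A] {ν : Measure (ℤ → A)}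
    [IsProbabilityMeasure ν] (hν : MeasurePreserving shiftZ ν ν)
    {a a' : A} (hne : a ≠ a') (ha : Indist a a') {n : ℕ} (hn : 0 < n)
    (hph : ∀ᵐ x ∂ν, ∃ o : Fin n, ∀ b : ℕ, Indist a (x ((o : ℕ) + b * n + 1))) :
    entropyRate ν = 0 := by
  have hsum : ∀ N, ∑ m ∈ Finset.range N,
      shCondEntropy ν (fun x : ℤ → A => x ((m : ℤ) + 1)) (blockZ m) =
        shCondEntropy ν (fun (x : ℤ → A) (i : Fin N) => x ((i : ℕ) + 1))
          (fun x (i : Fin N) => ()) := fun N => by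
    have h1 := sum_shCondEntropy_eq (P := ν) (fun m (x : ℤ → A) => x ((m : ℤ) + 1)) N
    have h2 := shCondEntropy_comp_equiv_right (P := ν)
      (fun (x : ℤ → A) (i : Fin N) => x ((i : ℕ) + 1)) (fun _ => (fun _ => () : Fin N → Unit))
      (Equiv.ofUnique (Fin N → Unit) Unit)
    rw [← h2]
    refine h1.trans ?_
    exact (shCondEntropy_unit _).symm
  have hdich := block_entropy_dichotomy hν (f := id) (g := fun _ => ()) measurable_id
    measurable_const (fun c s t h _ => ⟨s, h, rfl, rfl⟩) hne ha hn hph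
  simp only [id] at hdich
  simp only [← hsum] at hdich
  rcases hdich with h0 | h0
  · have : ∀ m : ℕ, shCondEntropy ν (fun x : ℤ → A => x ((m : ℤ) + 1)) (blockZ m) = 0 := by
      intro m
      have h1 := h0 (m + 1)
      rw [Finset.sum_range_succ, h0 m, zero_add] at h1
      exact h1
    rw [entropyRate]
    simp only [this]
    exact limsup_const 0
  · rw [entropyRate, limsup_eq]
    refine (congrArg sInf ?_).trans Real.sInf_empty
    rw [Set.eq_empty_iff_forall_notMem]
    intro c hc
    apply h0
    obtain ⟨M, hM⟩ := eventually_atTop.1 (show ∀ᶠ m : ℕ in atTop, _ ≤ c from hc)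
    set u := fun m : ℕ => shCondEntropy ν (fun x : ℤ → A => x ((m : ℤ) + 1)) (blockZ m) with hu
    have h1 : ∀ j, ∑ m ∈ Finset.range (M + j), u m ≤ |∑ m ∈ Finset.range M, u m| + |c| * j := by
      intro j
      induction j with
      | zero => simpa using le_abs_self _
      | succ j ih =>
        rw [← add_assoc, Finset.sum_range_succ]
        have := hM (M + j) (by omega)
        have := le_abs_self c
        push_cast
        simp only [hu] at ih ⊢
        linarith
    refine ⟨|∑ m ∈ Finset.range M, u m| + |c|, ?_⟩
    filter_upwards [eventually_ge_atTop (M + 1)] with N hN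
    obtain ⟨j, rfl⟩ := Nat.exists_eq_add_of_le (Nat.le_of_succ_le hN)
    refine (h1 j).trans ?_
    rw [add_mul]
    have h2 : (1 : ℝ) ≤ (M + j : ℕ) := by exact_mod_cast (by omega : 1 ≤ M + j)
    gcongr
    · exact le_mul_of_one_le_right (abs_nonneg _) h2
    · omega

/-- The conditional entropy rate of a stationary process visiting a nonatomic letter
periodically has the value zero. -/
lemma condEntropyRate_eq_zero_of_nonatomic {W Y Z : Type*} [Fintype W] [Fintype Y] [Fintype Z]
    [MeasurableSpace W] [MeasurableSpace Y] [MeasurableSpace Z] {ν : Measure (ℤ → W × Y × Z)}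
    [IsProbabilityMeasure ν] (hν : MeasurePreserving shiftZ ν ν)
    {a a' : W} (hne : a ≠ a') (ha : Indist a a') {n : ℕ} (hn : 0 < n)
    (hph : ∀ᵐ x ∂ν, ∃ o : Fin n, ∀ b : ℕ, Indist a (x ((o : ℕ) + b * n + 1)).1) :
    condEntropyRate ν = 0 := by
  have heq : ∀ N : ℕ, shCondEntropy ν (fun (x : ℤ → W × Y × Z) (i : Fin N) => (x ((i : ℕ) + 1)).1)
      (fun x => (fun i : Fin N => (x ((i : ℕ) + 1)).2.1, fun i : Fin N => (x ((i : ℕ) + 1)).2.2)) =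
      shCondEntropy ν (fun (x : ℤ → W × Y × Z) (i : Fin N) => (x ((i : ℕ) + 1)).1)
        (fun x (i : Fin N) => (x ((i : ℕ) + 1)).2) := fun N =>
    shCondEntropy_comp_equiv_right (P := ν)
      (fun (x : ℤ → W × Y × Z) (i : Fin N) => (x ((i : ℕ) + 1)).1)
      (fun x (i : Fin N) => (x ((i : ℕ) + 1)).2)
      (Equiv.arrowProdEquivProdArrow (Fin N) (fun _ => Y) fun _ => Z)
  have hdich := block_entropy_dichotomy hν (f := Prod.fst) (g := Prod.snd) measurable_fst
    measurable_snd (fun c s t h h' => ⟨(s, t), h.prodMk h', rfl, rfl⟩) hne ha hn hph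
  rw [condEntropyRate]
  simp only [heq]
  rcases hdich with h0 | h0
  · simp only [h0, mul_zero]
    exact limsup_const 0
  · rw [limsup_eq]
    refine (congrArg sInf ?_).trans Real.sInf_empty
    rw [Set.eq_empty_iff_forall_notMem]
    intro c hc
    apply h0
    refine ⟨c, ?_⟩
    filter_upwards [show ∀ᶠ N : ℕ in atTop, _ ≤ c from hc, eventually_ge_atTop 1] with N h1 hN
    have hN' : (0 : ℝ) < N := by exact_mod_cast hN
    rwa [one_div, inv_mul_le_iff₀ hN', mul_comm] at h1

end DegenerateRates

lemma atomCost_atomRep_both {X Y : Type*} [MeasurableSpace X] [MeasurableSpace Y] {d : X → Y → ℝ}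
    (x : X) (y : Y) : atomCost d (atomRep x) (atomRep y) = atomCost d x y := by
  have h : Indist (atomRep y) = Indist y := funext fun z => propext
    ⟨(indist_atomRep y).symm.trans, (indist_atomRep y).trans⟩
  rw [atomCost_atomRep, atomCost, h, atomCost]

section CodeProcess

variable {X C : Type*} {n : ℕ}

lemma phaseMap_iterate_zero (x : ℤ → X) (t : ℕ) :
    (phaseMap n shiftZ)^[t] (x, 0) = (shiftZ^[t] x, (t : ZMod n)) := by
  induction t with
  | zero => simp
  | succ t ih =>
    rw [Function.iterate_succ_apply', ih, Function.iterate_succ_apply']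
    simp [phaseMap]

lemma integral_iterate_shiftZ [MeasurableSpace X] {μ : Measure (ℤ → X)}
    (hμ : MeasurePreserving shiftZ μ μ) {f : (ℤ → X) → ℝ} (hf : AEStronglyMeasurable f μ)
    (t : ℕ) : ∫ x, f (shiftZ^[t] x) ∂μ = ∫ x, f x ∂μ := by
  have h := hμ.iterate t
  rw [← integral_map h.measurable.aemeasurable (by rwa [h.map_eq]), h.map_eq]

lemma fiberMeasurable_atomRep_blockZ [MeasurableSpace X] [Finite X] :
    FiberMeasurable fun (x : ℤ → X) (i : Fin n) => atomRep (blockZ n x i) :=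
  fiberMeasurable_atomRep_block fun _ => measurable_pi_apply _

lemma integral_blockZ [MeasurableSpace X] [Finite X] {μ : Measure (ℤ → X)}
    [IsProbabilityMeasure μ] (hμ : MeasurePreserving shiftZ μ μ) {F : (Fin n → X) → ℝ}
    (hF : ∀ u, F (fun i => atomRep (u i)) = F u) :
    ∫ x, F (fun i => x (i : ℕ)) ∂μ = ∫ x, F (blockZ n x) ∂μ := by
  have h1 : FiberMeasurable fun (x : ℤ → X) (i : Fin n) => atomRep (x (i : ℕ)) :=
    fiberMeasurable_atomRep_block fun _ => measurable_pi_apply _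
  have h2 : AEStronglyMeasurable (fun x : ℤ → X => F (fun i : Fin n => x (i : ℕ))) μ := by
    have := (h1.integrable_comp (μ := μ) F).aestronglyMeasurable
    simpa only [hF] using this
  exact (integral_iterate_shiftZ hμ h2 1).symm

variable [NeZero n]

/-- The symbol at time `t`, when this time has phase `j`, of the sequence obtained from `x` by
applying `c` to the blocks starting at the times of phase zero. -/
def codeAt (c : (Fin n → X) → Fin n → C) (x : ℤ → X) (t : ℤ) (j : ZMod n) : C :=
  c (fun i => x (t + (i : ℕ) - j.val)) ⟨j.val, ZMod.val_lt j⟩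

/-- The process coded blockwise by `c`, jointly with the source. -/
def codeProcess (c : (Fin n → X) → Fin n → C) (ω : (ℤ → X) × ZMod n) (t : ℤ) : X × C :=
  (ω.1 t, codeAt c ω.1 t (ω.2 + t))

variable {c : (Fin n → X) → Fin n → C}

lemma codeProcess_phaseMap (ω : (ℤ → X) × ZMod n) :
    codeProcess c (phaseMap n shiftZ ω) = shiftZ (codeProcess c ω) := by
  funext t
  have h : ω.2 + 1 + (t : ZMod n) = ω.2 + ((t + 1 : ℤ) : ZMod n) := by push_cast; ring
  have h' : ∀ (i : Fin n) (z : ℤ), t + (i : ℕ) - z + 1 = t + 1 + (i : ℕ) - z := fun i z => by ring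
  simp only [codeProcess, phaseMap, Prod.map, shiftZ, h, codeAt, h']

lemma codeProcess_zero_fin (x : ℤ → X) (i : Fin n) :
    codeProcess c (x, 0) (i : ℕ) = (x (i : ℕ), c (fun j => x (j : ℕ)) i) := by
  have h : ((0 : ZMod n) + (((i : ℕ) : ℤ) : ZMod n)).val = i := by
    rw [zero_add, Int.cast_natCast, ZMod.val_natCast, Nat.mod_eq_of_lt i.2]
  simp only [codeProcess, codeAt, h, add_sub_cancel_left]

lemma codeProcess_iterate (x : ℤ → X) (i : Fin n) :
    codeProcess c ((phaseMap n shiftZ)^[i] (x, 0)) 0 = (x (i : ℕ), c (fun j => x (j : ℕ)) i) := by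
  rw [iterate_shift_eq codeProcess_phaseMap, codeProcess_zero_fin]

lemma codeProcess_snd_of_phase_eq_zero {ω : (ℤ → X) × ZMod n} {t : ℤ} (h : ω.2 + t = 0) :
    ∃ u, (codeProcess c ω t).2 = c u 0 := by
  refine ⟨fun i => ω.1 (t + (i : ℕ) - (ω.2 + t).val), ?_⟩
  simp only [codeProcess, codeAt]
  congr 1
  simp [h]

variable [MeasurableSpace X] [Finite X]

lemma fiberMeasurable_codeProcess (hc : ∀ u, c (fun i => atomRep (u i)) = c u) (t : ℤ) :
    FiberMeasurable fun ω => (codeProcess c ω t).2 := by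
  have h1 : FiberMeasurable fun ω : (ℤ → X) × ZMod n =>
      ((fun (j : ZMod n) (i : Fin n) => atomRep (ω.1 (t + (i : ℕ) - (j + t).val))), ω.2) := by
    refine FiberMeasurable.prodMk (FiberMeasurable.pi fun j => FiberMeasurable.pi fun i => ?_)
      (FiberMeasurable.of_measurable measurable_snd)
    exact fiberMeasurable_atomRep.comp_measurable
      ((measurable_pi_apply (t + (i : ℕ) - (j + t).val)).comp measurable_fst)
  have h2 := h1.comp fun v => c (v.1 v.2) ⟨(v.2 + t).val, ZMod.val_lt _⟩
  simpa only [hc, codeProcess, codeAt] using h2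

lemma fiberMeasurable_atomRep_codeProcess (hc : ∀ u, c (fun i => atomRep (u i)) = c u) (t : ℤ) :
    FiberMeasurable fun ω => (atomRep (codeProcess c ω t).1, (codeProcess c ω t).2) :=
  (fiberMeasurable_atomRep.comp_measurable
    ((measurable_pi_apply t).comp measurable_fst)).prodMk (fiberMeasurable_codeProcess hc t)

lemma measurable_codeProcess [Finite C] [MeasurableSpace C]
    (hc : ∀ u, c (fun i => atomRep (u i)) = c u) :
    Measurable (codeProcess c) :=
  measurable_pi_lambda _ fun t => ((measurable_pi_apply t).comp measurable_fst).prodMk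
    (fiberMeasurable_codeProcess hc t).measurable

/-- The phase average of a single-letter cost of the coded process is the block average. -/
lemma average_codeProcess [Finite C] {μ : Measure (ℤ → X)} [IsProbabilityMeasure μ]
    (hμ : MeasurePreserving shiftZ μ μ) (hc : ∀ u, c (fun i => atomRep (u i)) = c u)
    {D : X → C → ℝ} (hD : ∀ x y, D (atomRep x) y = D x y) :
    (n : ℝ)⁻¹ * ∑ j, ∫ x, D (codeProcess c (x, j) 0).1 (codeProcess c (x, j) 0).2 ∂μ =
      ∫ x, dn D n (blockZ n x) (c (blockZ n x)) ∂μ := by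
  have hterm : ∀ i : Fin n, ∫ x, D (codeProcess c (x, ((i : ℕ) : ZMod n)) 0).1
        (codeProcess c (x, ((i : ℕ) : ZMod n)) 0).2 ∂μ =
      ∫ x, D (blockZ n x i) (c (blockZ n x) i) ∂μ := by
    intro i
    have hm : AEStronglyMeasurable (fun x : ℤ → X => D (codeProcess c (x, ((i : ℕ) : ZMod n)) 0).1
        (codeProcess c (x, ((i : ℕ) : ZMod n)) 0).2) μ := by
      have := (((fiberMeasurable_atomRep_codeProcess hc 0).comp_measurable
        (measurable_prodMk_right (y := ((i : ℕ) : ZMod n)))).integrable_comp (μ := μ)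
        fun v => D v.1 v.2).aestronglyMeasurable
      simpa only [hD] using this
    rw [← integral_iterate_shiftZ hμ hm i]
    simp only [← phaseMap_iterate_zero, codeProcess_iterate]
    exact integral_blockZ hμ (F := fun u => D (u i) (c u i)) fun u => by rw [hD, hc]
  have hsum : ∑ j, ∫ x, D (codeProcess c (x, j) 0).1 (codeProcess c (x, j) 0).2 ∂μ =
      ∑ i : Fin n, ∫ x, D (blockZ n x i) (c (blockZ n x) i) ∂μ := by
    have e : Function.Bijective fun i : Fin n => ((i : ℕ) : ZMod n) := by
      rw [Fintype.bijective_iff_injective_and_card]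
      refine ⟨fun i j h => Fin.ext ?_, by simp [ZMod.card]⟩
      have := congrArg ZMod.val h
      simpa [ZMod.val_natCast, Nat.mod_eq_of_lt i.2, Nat.mod_eq_of_lt j.2] using this
    rw [← e.sum_comp]
    exact Finset.sum_congr rfl fun i _ => hterm i
  rw [hsum, ← integral_finsetSum, ← integral_const_mul]
  · simp only [dn, one_div]
  · intro i _
    have := (fiberMeasurable_atomRep_blockZ (X := X) (n := n)).integrable_comp (μ := μ)
      fun u => D (u i) (c u i)
    simpa only [hD, hc] using this

end CodeProcess

lemma muGA_le {X Xh : Type*} [Fintype X] [Fintype Xh] [MeasurableSpace X] [MeasurableSpace Xh]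
    {μ : Measure (ℤ → X)} {d : X → Xh → ℝ} {γ1 γ2 γ0 α1 α2 α0 R1 R2 R0 D1 D2 D0 : ℝ}
    (h : StationaryAchievable μ d R1 R2 R0 D1 D2 D0)
    (h0 : 0 ≤ γ1 * R1 + γ2 * R2 + γ0 * R0 + α1 * D1 + α2 * D2 + α0 * D0) :
    muGA μ d γ1 γ2 γ0 α1 α2 α0 ≤
      γ1 * R1 + γ2 * R2 + γ0 * R0 + α1 * D1 + α2 * D2 + α0 * D0 := by
  rw [muGA]
  set S := {v : ℝ | ∃ R11 R22 R0 D1 D2 D0 : ℝ, StationaryAchievable μ d R11 R22 R0 D1 D2 D0 ∧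
    v = γ1 * R11 + γ2 * R22 + γ0 * R0 + α1 * D1 + α2 * D2 + α0 * D0}
  by_cases hS : BddBelow S
  · exact csInf_le hS ⟨_, _, _, _, _, _, h, rfl⟩
  · rwa [Real.sInf_of_not_bddBelow hS]

lemma integral_prod_uniformZMod {α : Type*} [MeasurableSpace α] {n : ℕ} [NeZero n] {μ : Measure α}
    [IsProbabilityMeasure μ] {g : α × ZMod n → ℝ} (hg : Integrable g (μ.prod (uniformZMod n))) :
    ∫ ω, g ω ∂(μ.prod (uniformZMod n)) = (n : ℝ)⁻¹ * ∑ j, ∫ x, g (x, j) ∂μ := by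
  rw [integral_prod_symm g hg, integral_uniformZMod]

lemma integral_linear_combination {Ω : Type*} [MeasurableSpace Ω] {P : Measure Ω}
    {f1 f2 f3 f4 f5 f6 : Ω → ℝ} (h1 : Integrable f1 P) (h2 : Integrable f2 P)
    (h3 : Integrable f3 P) (h4 : Integrable f4 P) (h5 : Integrable f5 P) (h6 : Integrable f6 P)
    (a1 a2 a3 a4 a5 a6 : ℝ) :
    ∫ ω, (a1 * f1 ω + a2 * f2 ω + a3 * f3 ω + a4 * f4 ω + a5 * f5 ω + a6 * f6 ω) ∂P =
      a1 * ∫ ω, f1 ω ∂P + a2 * ∫ ω, f2 ω ∂P + a3 * ∫ ω, f3 ω ∂P + a4 * ∫ ω, f4 ω ∂P +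
        a5 * ∫ ω, f5 ω ∂P + a6 * ∫ ω, f6 ω ∂P := by
  have g1 := h1.const_mul a1
  have g2 := h2.const_mul a2
  have g3 := h3.const_mul a3
  have g4 := h4.const_mul a4
  have g5 := h5.const_mul a5
  have g6 := h6.const_mul a6
  have e2 := g1.fun_add g2
  have e3 := e2.fun_add g3
  have e4 := e3.fun_add g4
  have e5 := e4.fun_add g5
  rw [integral_add e5 g6, integral_add e4 g5, integral_add e3 g4, integral_add e2 g3,
    integral_add g1 g2]
  simp only [integral_const_mul]

section Achievability

variable {X Xh : Type*} [Fintype X] [Fintype Xh] [MeasurableSpace X] [MeasurableSpace Xh] {n : ℕ}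
  [NeZero n] {μ : Measure (ℤ → X)} {d : X → Xh → ℝ} {c : (Fin n → X) → Fin n → Xh × Xh × Xh}

lemma integral_codeProcess_le (hd : ∀ x y, 0 ≤ d x y) (hc : ∀ u, c (fun i => atomRep (u i)) = c u)
    (P : Measure ((ℤ → X) × ZMod n)) [IsProbabilityMeasure P] {s : Xh × Xh × Xh → Xh}
    (hs : Measurable s)
    (hsl : ∀ e y, Indist (s e) y → ∃ e', Indist e e' ∧ s e' = y) :
    ∫ x, d (x 0).1 (s (x 0).2) ∂(P.map (codeProcess c)) ≤
      ∫ ω, atomCost d (codeProcess c ω 0).1 (s (codeProcess c ω 0).2) ∂P := by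
  classical
  have hm := measurable_codeProcess hc
  have hf : FiberMeasurable fun x : ℤ → X × Xh × Xh × Xh =>
      (atomRep (x 0).1, atomRep (s (x 0).2)) :=
    (fiberMeasurable_atomRep.comp_measurable (measurable_fst.comp (measurable_pi_apply 0))).prodMk
      (fiberMeasurable_atomRep.comp_measurable
        (hs.comp (measurable_snd.comp (measurable_pi_apply 0))))
  have hmeas : AEStronglyMeasurable (fun x : ℤ → X × Xh × Xh × Xh => atomCost d (x 0).1 (s (x 0).2))
      (P.map (codeProcess c)) := by
    have := (hf.measurable_comp fun v => atomCost d v.1 v.2).aestronglyMeasurable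
      (μ := P.map (codeProcess c))
    simpa only [atomCost_atomRep_both] using this
  rw [← integral_map hm.aemeasurable hmeas]
  refine integral_le_integral_atomCost hd fun x a y ha hy => ?_
  obtain ⟨e, he, rfl⟩ := hsl _ _ hy
  refine ⟨Function.update x 0 (a, e), Indist.pi fun t => ?_, by simp, by simp⟩
  by_cases ht : t = 0
  · subst ht
    simpa using ha.prodMk he
  · simpa [ht] using Indist.refl (x t)

lemma map_codeProcess (hc : ∀ u, c (fun i => atomRep (u i)) = c u)
    (P : Measure ((ℤ → X) × ZMod n)) {β : Type*} [MeasurableSpace β]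
    {f : X × Xh × Xh × Xh → β} (hf : Measurable f) :
    (P.map (codeProcess c)).map (fun x (m : ℤ) => f (x m)) =
      P.map fun ω t => f (codeProcess c ω t) := by
  have hF : Measurable fun (x : ℤ → X × Xh × Xh × Xh) (m : ℤ) => f (x m) :=
    measurable_pi_lambda _ fun t => hf.comp (measurable_pi_apply t)
  rw [Measure.map_map hF (measurable_codeProcess hc)]
  rfl

lemma stationaryAchievable_of_code (hd : ∀ x y, 0 ≤ d x y)
    (hc : ∀ u, c (fun i => atomRep (u i)) = c u)
    {P : Measure ((ℤ → X) × ZMod n)} [IsProbabilityMeasure P] (hP : Ergodic (phaseMap n shiftZ) P)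
    (hPμ : P.map Prod.fst = μ) {R1 R2 R0 : ℝ}
    (h1 : entropyRate (P.map fun ω t => (codeProcess c ω t).2.1) ≤ R1)
    (h2 : entropyRate (P.map fun ω t => (codeProcess c ω t).2.2.1) ≤ R2)
    (h0 : condEntropyRate (P.map fun ω t => ((codeProcess c ω t).2.2.2, (codeProcess c ω t).2.1,
      (codeProcess c ω t).2.2.1)) ≤ R0) :
    StationaryAchievable μ d R1 R2 R0
      (∫ ω, atomCost d (codeProcess c ω 0).1 (codeProcess c ω 0).2.1 ∂P)
      (∫ ω, atomCost d (codeProcess c ω 0).1 (codeProcess c ω 0).2.2.1 ∂P)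
      (∫ ω, atomCost d (codeProcess c ω 0).1 (codeProcess c ω 0).2.2.2 ∂P) := by
  intro ε hε
  have hm := measurable_codeProcess hc
  have hshift : Measurable (shiftZ : (ℤ → X × Xh × Xh × Xh) → ℤ → X × Xh × Xh × Xh) :=
    measurable_pi_lambda _ fun t => measurable_pi_apply _
  have : IsProbabilityMeasure (P.map (codeProcess c)) :=
    Measure.isProbabilityMeasure_map hm.aemeasurable
  refine ⟨P.map (codeProcess c), inferInstance, ?_, ?_, ?_, ?_, ?_, ?_, ?_, ?_⟩
  · have hmp : MeasurePreserving (codeProcess c) P (P.map (codeProcess c)) := ⟨hm, rfl⟩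
    exact hmp.ergodic_of_ergodic_semiconj hP hshift fun ω => codeProcess_phaseMap ω
  · rw [map_codeProcess hc P measurable_fst]
    exact hPμ
  · rw [map_codeProcess hc P (f := fun e => e.2.1) (by fun_prop)]
    exact h1.trans (by linarith)
  · rw [map_codeProcess hc P (f := fun e => e.2.2.1) (by fun_prop)]
    exact h2.trans (by linarith)
  · rw [map_codeProcess hc P (f := fun e => (e.2.2.2, e.2.1, e.2.2.1)) (by fun_prop)]
    exact h0.trans (by linarith)
  · refine (integral_codeProcess_le hd hc P (s := fun e => e.1) measurable_fst ?_).trans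
      (by linarith)
    exact fun e y h => ⟨(y, e.2), h.prodMk (Indist.refl _), rfl⟩
  · refine (integral_codeProcess_le hd hc P (s := fun e => e.2.1) (by fun_prop) ?_).trans
      (by linarith)
    exact fun e y h => ⟨(e.1, y, e.2.2), (Indist.refl _).prodMk (h.prodMk (Indist.refl _)), rfl⟩
  · refine (integral_codeProcess_le hd hc P (s := fun e => e.2.2) (by fun_prop) ?_).trans
      (by linarith)
    exact fun e y h => ⟨(e.1, e.2.1, y), (Indist.refl _).prodMk ((Indist.refl _).prodMk h), rfl⟩

lemma integrable_atomCost_codeProcess (hc : ∀ u, c (fun i => atomRep (u i)) = c u)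
    (P : Measure ((ℤ → X) × ZMod n)) [IsProbabilityMeasure P] (s : Xh × Xh × Xh → Xh) :
    Integrable (fun ω => atomCost d (codeProcess c ω 0).1 (s (codeProcess c ω 0).2)) P := by
  have := (fiberMeasurable_atomRep_codeProcess hc 0).integrable_comp (μ := P)
    fun v => atomCost d v.1 (s v.2)
  simpa only [atomCost_atomRep] using this

lemma integral_prod_atomCost_codeProcess [IsProbabilityMeasure μ]
    (hμ : MeasurePreserving shiftZ μ μ) (hc : ∀ u, c (fun i => atomRep (u i)) = c u)
    (s : Xh × Xh × Xh → Xh) :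
    ∫ ω, atomCost d (codeProcess c ω 0).1 (s (codeProcess c ω 0).2) ∂(μ.prod (uniformZMod n)) =
      ∫ x, dn (atomCost d) n (blockZ n x) (fun i => s (c (blockZ n x) i)) ∂μ := by
  rw [integral_prod_uniformZMod (integrable_atomCost_codeProcess hc _ s)]
  exact average_codeProcess hμ hc (D := fun x e => atomCost d x (s e))
    fun x y => atomCost_atomRep x _

/-- A block code whose rates are controlled by time-stationary costs bounds `μ(γ, α)`. -/
lemma muGA_le_of_code [IsProbabilityMeasure μ] (hμ : Ergodic shiftZ μ) (hd : ∀ x y, 0 ≤ d x y)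
    (hc : ∀ u, c (fun i => atomRep (u i)) = c u) {γ1 γ2 γ0 α1 α2 α0 : ℝ} (hγ1 : 0 ≤ γ1)
    (hγ2 : 0 ≤ γ2) (hγ0 : 0 ≤ γ0) (hα1 : 0 ≤ α1) (hα2 : 0 ≤ α2) (hα0 : 0 ≤ α0)
    {r1 r2 r0 : (ℤ → X) × ZMod n → ℝ} (hr1 : ∀ ω, 0 ≤ r1 ω) (hr2 : ∀ ω, 0 ≤ r2 ω)
    (hr0 : ∀ ω, 0 ≤ r0 ω)
    (hi : ∀ P : Measure ((ℤ → X) × ZMod n), IsProbabilityMeasure P →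
      MeasurePreserving (phaseMap n shiftZ) P P →
      Integrable r1 P ∧ Integrable r2 P ∧ Integrable r0 P)
    (hb : ∀ P : Measure ((ℤ → X) × ZMod n), IsProbabilityMeasure P →
      MeasurePreserving (phaseMap n shiftZ) P P →
      entropyRate (P.map fun ω t => (codeProcess c ω t).2.1) ≤ ∫ ω, r1 ω ∂P ∧
      entropyRate (P.map fun ω t => (codeProcess c ω t).2.2.1) ≤ ∫ ω, r2 ω ∂P ∧
      condEntropyRate (P.map fun ω t => ((codeProcess c ω t).2.2.2, (codeProcess c ω t).2.1,
        (codeProcess c ω t).2.2.1)) ≤ ∫ ω, r0 ω ∂P) :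
    muGA μ d γ1 γ2 γ0 α1 α2 α0 ≤
      γ1 * ∫ ω, r1 ω ∂(μ.prod (uniformZMod n)) + γ2 * ∫ ω, r2 ω ∂(μ.prod (uniformZMod n)) +
      γ0 * ∫ ω, r0 ω ∂(μ.prod (uniformZMod n)) +
      α1 * ∫ x, dn (atomCost d) n (blockZ n x) (fun i => (c (blockZ n x) i).1) ∂μ +
      α2 * ∫ x, dn (atomCost d) n (blockZ n x) (fun i => (c (blockZ n x) i).2.1) ∂μ +
      α0 * ∫ x, dn (atomCost d) n (blockZ n x) (fun i => (c (blockZ n x) i).2.2) ∂μ := by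
  have hnn : ∀ (s : Xh × Xh × Xh → Xh) (P : Measure ((ℤ → X) × ZMod n)),
      0 ≤ ∫ ω, atomCost d (codeProcess c ω 0).1 (s (codeProcess c ω 0).2) ∂P := fun s P =>
    integral_nonneg fun ω => atomCost_nonneg hd _ _
  have hcost := fun (s : Xh × Xh × Xh → Xh) (P : Measure ((ℤ → X) × ZMod n))
    (_ : IsProbabilityMeasure P) => integrable_atomCost_codeProcess (d := d) hc P s
  obtain ⟨hi1, hi2, hi0⟩ := hi (μ.prod (uniformZMod n)) inferInstance
    (measurePreserving_phaseMap hμ.toMeasurePreserving)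
  have hlin := integral_linear_combination hi1 hi2 hi0 (hcost (fun e => e.1) _ inferInstance)
    (hcost (fun e => e.2.1) _ inferInstance) (hcost (fun e => e.2.2) _ inferInstance)
    γ1 γ2 γ0 α1 α2 α0
  have hg : Integrable (fun ω => γ1 * r1 ω + γ2 * r2 ω + γ0 * r0 ω +
      α1 * atomCost d (codeProcess c ω 0).1 (codeProcess c ω 0).2.1 +
      α2 * atomCost d (codeProcess c ω 0).1 (codeProcess c ω 0).2.2.1 +
      α0 * atomCost d (codeProcess c ω 0).1 (codeProcess c ω 0).2.2.2)
      (μ.prod (uniformZMod n)) :=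
    (((((hi1.const_mul γ1).add (hi2.const_mul γ2)).add (hi0.const_mul γ0)).add
      ((hcost (fun e => e.1) _ inferInstance).const_mul α1)).add
      ((hcost (fun e => e.2.1) _ inferInstance).const_mul α2)).add
      ((hcost (fun e => e.2.2) _ inferInstance).const_mul α0)
  obtain ⟨P, hP, hPe, hPμ, hPg⟩ := exists_ergodic_phase_measure hμ hg
  rw [← integral_prod_uniformZMod hg, hlin,
    integral_prod_atomCost_codeProcess hμ.toMeasurePreserving hc (fun e => e.1),
    integral_prod_atomCost_codeProcess hμ.toMeasurePreserving hc (fun e => e.2.1),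
    integral_prod_atomCost_codeProcess hμ.toMeasurePreserving hc (fun e => e.2.2)] at hPg
  refine le_trans ?_ hPg
  obtain ⟨hiP1, hiP2, hiP0⟩ := hi P hP hPe.toMeasurePreserving
  obtain ⟨hb1, hb2, hb0⟩ := hb P hP hPe.toMeasurePreserving
  rw [integral_linear_combination hiP1 hiP2 hiP0 (hcost (fun e => e.1) P hP)
    (hcost (fun e => e.2.1) P hP) (hcost (fun e => e.2.2) P hP) γ1 γ2 γ0 α1 α2 α0]
  refine muGA_le (stationaryAchievable_of_code hd hc hPe hPμ hb1 hb2 hb0) ?_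
  have h1 := mul_nonneg hγ1 (integral_nonneg (μ := P) hr1)
  have h2 := mul_nonneg hγ2 (integral_nonneg (μ := P) hr2)
  have h3 := mul_nonneg hγ0 (integral_nonneg (μ := P) hr0)
  have h4 := mul_nonneg hα1 (hnn (fun e => e.1) P)
  have h5 := mul_nonneg hα2 (hnn (fun e => e.2.1) P)
  have h6 := mul_nonneg hα0 (hnn (fun e => e.2.2) P)
  linarith

end Achievability

section CodeCost

variable {X C : Type*} {n : ℕ} [NeZero n] {c : (Fin n → X) → Fin n → C}

lemma codeProcess_comp_phaseMap {A : Type*} (f : X × C → A) (ω : (ℤ → X) × ZMod n) :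
    (fun t => f (codeProcess c (phaseMap n shiftZ ω) t)) =
      shiftZ fun t => f (codeProcess c ω t) := by
  rw [codeProcess_phaseMap]
  rfl

/-- The time-stationary cost of describing the letters `f` of a block code given the letters
`g`. -/
noncomputable def codeCost {A V : Type*} (c : (Fin n → X) → Fin n → C)
    (f : C → A) (g : C → V) (q : (Fin n → A) → (Fin n → V) → ℝ) :
    (ℤ → X) × ZMod n → ℝ :=
  blockCost (phaseMap n shiftZ) Prod.snd (fun ω => f (codeProcess c ω 0).2)
    (fun ω => g (codeProcess c ω 0).2) q

variable [MeasurableSpace X]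

lemma integrable_comp_blockZ {n : ℕ} [Finite X] {μ : Measure (ℤ → X)} [IsProbabilityMeasure μ]
    {F : (Fin n → X) → ℝ} (hF : ∀ u, F (fun i => atomRep (u i)) = F u) :
    Integrable (fun x => F (blockZ n x)) μ := by
  have := (fiberMeasurable_atomRep_blockZ (X := X) (n := n)).integrable_comp (μ := μ) F
  simpa only [hF] using this

variable [Finite C]

lemma integrable_codeCost [Finite X] (hc : ∀ u, c (fun i => atomRep (u i)) = c u) {A V : Type*}
    [Finite A] [Finite V] {P : Measure ((ℤ → X) × ZMod n)} [IsProbabilityMeasure P]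
    (hT : Measurable (phaseMap n (shiftZ : (ℤ → X) → ℤ → X)))
    (f : C → A) (g : C → V) (q : (Fin n → A) → (Fin n → V) → ℝ) :
    Integrable (codeCost c f g q) P :=
  integrable_blockCost hT (FiberMeasurable.of_measurable measurable_snd)
    ((fiberMeasurable_codeProcess hc 0).comp f) ((fiberMeasurable_codeProcess hc 0).comp g) q

lemma integral_prod_blockCost [Finite X] {A V : Type*} [Finite A] [Finite V]
    {μ : Measure (ℤ → X)} [IsProbabilityMeasure μ] (hμ : MeasurePreserving shiftZ μ μ)
    (hc : ∀ u, c (fun i => atomRep (u i)) = c u)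
    (f : C → A) (g : C → V) (q : (Fin n → A) → (Fin n → V) → ℝ) :
    ∫ ω, blockCost (phaseMap n shiftZ) Prod.snd (fun ω => f (codeProcess c ω 0).2)
        (fun ω => g (codeProcess c ω 0).2) q ω ∂(μ.prod (uniformZMod n)) =
      (n : ℝ)⁻¹ * ∫ x, -Real.logb 2
        (q (fun i => f (c (blockZ n x) i)) (fun i => g (c (blockZ n x) i))) ∂μ := by
  classical
  have hT := (measurePreserving_phaseMap (n := n) hμ).measurable
  rw [integral_prod_uniformZMod (integrable_blockCost hT
    (FiberMeasurable.of_measurable measurable_snd) ((fiberMeasurable_codeProcess hc 0).comp f)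
    ((fiberMeasurable_codeProcess hc 0).comp g) q), Finset.sum_eq_single 0]
  · congr 1
    rw [← integral_blockZ hμ (F := fun u => -Real.logb 2
      (q (fun i => f (c u i)) (fun i => g (c u i)))) fun u => by rw [hc]]
    refine integral_congr_ae (Eventually.of_forall fun x => ?_)
    simp only [blockCost, if_true, codeProcess_iterate]
  · intro j _ hj
    simp [blockCost, hj]
  · simp

lemma integral_prod_codeCost [Finite X] {A V : Type*} [Finite A] [Finite V]
    {μ : Measure (ℤ → X)} [IsProbabilityMeasure μ] (hμ : MeasurePreserving shiftZ μ μ)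
    (hc : ∀ u, c (fun i => atomRep (u i)) = c u)
    (f : C → A) (g : C → V) {q : (Fin n → A) → (Fin n → V) → ℝ}
    {H : (Fin n → A) → (Fin n → V) → ℝ} {ρ : ℝ}
    (hq : ∀ s t, -Real.logb 2 (q s t) = n * H s t + ρ) :
    ∫ ω, codeCost c f g q ω ∂(μ.prod (uniformZMod n)) =
      ∫ x, H (fun i => f (c (blockZ n x) i)) (fun i => g (c (blockZ n x) i)) ∂μ +
        (n : ℝ)⁻¹ * ρ := by
  have hn : (n : ℝ) ≠ 0 := Nat.cast_ne_zero.2 (NeZero.ne n)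
  unfold codeCost
  rw [integral_prod_blockCost hμ hc f g q]
  simp only [hq]
  have hi : Integrable (fun x => H (fun i => f (c (blockZ n x) i))
      (fun i => g (c (blockZ n x) i))) μ :=
    integrable_comp_blockZ (F := fun u => H (fun i => f (c u i)) (fun i => g (c u i)))
      fun u => by rw [hc]
  rw [integral_add (hi.const_mul _) (integrable_const _), integral_const_mul, integral_const]
  simp only [probReal_univ, one_smul]
  field_simp

end CodeCost

section BlockBound

variable {X Xh : Type*} [Fintype Xh]

/-- The cost functional on source blocks. -/
noncomputable def blockMdCost (d : X → Xh → ℝ) (γ1 γ2 γ0 α1 α2 α0 : ℝ) (k k1 : ℕ) {n : ℕ}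
    (u : Fin n → X) (t : (Fin n → Xh) × (Fin n → Xh) × (Fin n → Xh)) : ℝ :=
  γ1 * empH k t.1 + γ2 * empH k t.2.1 + γ0 * empH2 k k1 t.2.2 t.1 t.2.1 +
    α1 * dn d n u t.1 + α2 * dn d n u t.2.1 + α0 * dn d n u t.2.2

/-- The minimal cost of a source block. -/
noncomputable def minMdCost (d : X → Xh → ℝ) (γ1 γ2 γ0 α1 α2 α0 : ℝ) (k k1 : ℕ) {n : ℕ}
    (u : Fin n → X) : ℝ :=
  ⨅ t, blockMdCost d γ1 γ2 γ0 α1 α2 α0 k k1 u t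

/-- The excess over `n * shCondEntropy` of the universal code with contexts in a set of size `c`
built from `k` past letters, for words of length `n` over an alphabet of size `a`. -/
noncomputable def redundancy (a c n k : ℕ) : ℝ :=
  a * c * Real.logb 2 (n + 1) + k * Real.logb 2 a

lemma redundancy_nonneg (a c n k : ℕ) : 0 ≤ redundancy a c n k := by
  have h1 : 0 ≤ Real.logb 2 ((n : ℝ) + 1) :=
    Real.logb_nonneg one_lt_two (by linarith [n.cast_nonneg (α := ℝ)])
  have h2 : 0 ≤ Real.logb 2 (a : ℝ) := by
    rcases Nat.eq_zero_or_pos a with rfl | ha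
    · simp
    · exact Real.logb_nonneg one_lt_two (by exact_mod_cast ha)
  unfold redundancy
  positivity

variable {d : X → Xh → ℝ} {γ1 γ2 γ0 α1 α2 α0 : ℝ} {k k1 n : ℕ}

lemma exists_eq_minMdCost [Nonempty Xh] (u : Fin n → X) :
    ∃ t, blockMdCost d γ1 γ2 γ0 α1 α2 α0 k k1 u t = minMdCost d γ1 γ2 γ0 α1 α2 α0 k k1 u :=
  exists_eq_ciInf_of_finite

lemma dn_nonneg {Y Z : Type*} {e : Y → Z → ℝ} (he : ∀ x y, 0 ≤ e x y) (u : Fin n → Y)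
    (t : Fin n → Z) : 0 ≤ dn e n u t :=
  mul_nonneg (by positivity) (Finset.sum_nonneg fun _ _ => he _ _)

lemma empH_nonneg (hn : 0 < n) (y : Fin n → Xh) : 0 ≤ empH k y := by
  have := isProbabilityMeasure_uniformFin hn
  exact shCondEntropy_nonneg (fiberMeasurable_fin _) (fiberMeasurable_fin _)

lemma empH2_nonneg (hn : 0 < n) (w y z : Fin n → Xh) : 0 ≤ empH2 k k1 w y z := by
  have := isProbabilityMeasure_uniformFin hn
  exact shCondEntropy_nonneg (fiberMeasurable_fin _) (fiberMeasurable_fin _)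

variable [MeasurableSpace X] [MeasurableSpace Xh]

lemma blockMdCost_atomRep (u : Fin n → X) (t : (Fin n → Xh) × (Fin n → Xh) × (Fin n → Xh)) :
    blockMdCost (atomCost d) γ1 γ2 γ0 α1 α2 α0 k k1 (fun i => atomRep (u i)) t =
      blockMdCost (atomCost d) γ1 γ2 γ0 α1 α2 α0 k k1 u t := by
  simp only [blockMdCost, dn, atomCost_atomRep]

lemma minMdCost_atomRep (u : Fin n → X) :
    minMdCost (atomCost d) γ1 γ2 γ0 α1 α2 α0 k k1 (fun i => atomRep (u i)) =
      minMdCost (atomCost d) γ1 γ2 γ0 α1 α2 α0 k k1 u := by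
  simp only [minMdCost, blockMdCost_atomRep]

variable (d γ1 γ2 γ0 α1 α2 α0 k k1 n) in
lemma exists_optimal_code [Nonempty Xh] :
    ∃ c : (Fin n → X) → Fin n → Xh × Xh × Xh, (∀ u, c (fun i => atomRep (u i)) = c u) ∧
      ∀ u, blockMdCost (atomCost d) γ1 γ2 γ0 α1 α2 α0 k k1 u
        (fun i => (c u i).1, fun i => (c u i).2.1, fun i => (c u i).2.2) =
          minMdCost (atomCost d) γ1 γ2 γ0 α1 α2 α0 k k1 u := by
  choose t ht using fun u : Fin n → X => exists_eq_minMdCost (d := atomCost d) (γ1 := γ1)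
    (γ2 := γ2) (γ0 := γ0) (α1 := α1) (α2 := α2) (α0 := α0) (k := k) (k1 := k1) u
  refine ⟨fun u i => ((t fun i => atomRep (u i)).1 i, (t fun i => atomRep (u i)).2.1 i,
    (t fun i => atomRep (u i)).2.2 i), fun u => ?_, fun u => ?_⟩
  · simp only [atomRep_atomRep]
  · rw [← blockMdCost_atomRep, ← minMdCost_atomRep]
    exact ht _

/-- The gap between `μ(γ, α)` and the mean minimal cost of blocks of length `n`. -/
noncomputable def blockGap (a : ℕ) (γ1 γ2 γ0 M : ℝ) (k k1 n : ℕ) : ℝ :=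
  (n : ℝ)⁻¹ * ((γ1 + γ2) * redundancy a (a ^ k) n k +
    γ0 * redundancy a (a ^ k * (a ^ (2 * k1 + 1) * a ^ (2 * k1 + 1))) n k + M)

section CodeRates

variable [NeZero n] {c : (Fin n → X) → Fin n → Xh × Xh × Xh}

lemma measurable_codeProcess_comp [Finite X] (hc : ∀ u, c (fun i => atomRep (u i)) = c u)
    {A : Type*} [MeasurableSpace A] {f : X × Xh × Xh × Xh → A} (hf : Measurable f) :
    Measurable (fun ω t => f (codeProcess c ω t)) :=
  measurable_pi_lambda _ fun t => hf.comp ((measurable_pi_apply t).comp (measurable_codeProcess hc))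

variable [Finite X] [Nonempty Xh] [MeasurableSingletonClass Xh] {P : Measure ((ℤ → X) × ZMod n)}
  [IsProbabilityMeasure P]

lemma entropyRate_codeProcess_le (hc : ∀ u, c (fun i => atomRep (u i)) = c u)
    (hT : MeasurePreserving (phaseMap n shiftZ) P P) {f : Xh × Xh × Xh → Xh} (hf : Measurable f)
    {q : (Fin n → Xh) → ℝ} (hq0 : ∀ s, 0 < q s) (hq1 : ∑ s, q s ≤ 1) :
    entropyRate (P.map fun ω t => f (codeProcess c ω t).2) ≤
      ∫ ω, codeCost c f (fun _ => ()) (fun w _ => q w) ω ∂P :=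
  entropyRate_map_le hT (FiberMeasurable.of_measurable measurable_snd) (fun _ => rfl)
    (measurable_codeProcess_comp hc (hf.comp measurable_snd))
    (codeProcess_comp_phaseMap fun e => f e.2) (fun s _ => hq0 s) fun _ => hq1

lemma condEntropyRate_codeProcess_le (hc : ∀ u, c (fun i => atomRep (u i)) = c u)
    (hT : MeasurePreserving (phaseMap n shiftZ) P P) {q : (Fin n → Xh) → (Fin n → Xh × Xh) → ℝ}
    (hq0 : ∀ s t, 0 < q s t) (hq1 : ∀ t, ∑ s, q s t ≤ 1) :
    condEntropyRate (P.map fun ω t => ((codeProcess c ω t).2.2.2, (codeProcess c ω t).2.1,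
      (codeProcess c ω t).2.2.1)) ≤
      ∫ ω, codeCost c (fun e => e.2.2) (fun e => (e.1, e.2.1)) q ω ∂P :=
  condEntropyRate_map_le hT (FiberMeasurable.of_measurable measurable_snd) (fun _ => rfl)
    (measurable_codeProcess_comp hc (f := fun e => (e.2.2.2, e.2.1, e.2.2.1)) (by fun_prop))
    (codeProcess_comp_phaseMap fun e : X × Xh × Xh × Xh => (e.2.2.2, e.2.1, e.2.2.1)) hq0 hq1

end CodeRates

lemma integral_blockMdCost [Finite X] {μ : Measure (ℤ → X)} [IsProbabilityMeasure μ]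
    {c : (Fin n → X) → Fin n → Xh × Xh × Xh} (hc : ∀ u, c (fun i => atomRep (u i)) = c u) :
    ∫ x, blockMdCost (atomCost d) γ1 γ2 γ0 α1 α2 α0 k k1 (blockZ n x)
        (fun i => (c (blockZ n x) i).1, fun i => (c (blockZ n x) i).2.1,
          fun i => (c (blockZ n x) i).2.2) ∂μ =
      γ1 * ∫ x, empH k (fun i => (c (blockZ n x) i).1) ∂μ +
      γ2 * ∫ x, empH k (fun i => (c (blockZ n x) i).2.1) ∂μ +
      γ0 * ∫ x, empH2 k k1 (fun i => (c (blockZ n x) i).2.2) (fun i => (c (blockZ n x) i).1)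
        (fun i => (c (blockZ n x) i).2.1) ∂μ +
      α1 * ∫ x, dn (atomCost d) n (blockZ n x) (fun i => (c (blockZ n x) i).1) ∂μ +
      α2 * ∫ x, dn (atomCost d) n (blockZ n x) (fun i => (c (blockZ n x) i).2.1) ∂μ +
      α0 * ∫ x, dn (atomCost d) n (blockZ n x) (fun i => (c (blockZ n x) i).2.2) ∂μ := by
  have he : ∀ f : (Fin n → Xh × Xh × Xh) → ℝ, Integrable (fun x => f (c (blockZ n x))) μ :=
    fun f => integrable_comp_blockZ (F := fun u => f (c u)) fun u => by rw [hc]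
  have hd : ∀ s : Xh × Xh × Xh → Xh, Integrable
      (fun x => dn (atomCost d) n (blockZ n x) (fun i => s (c (blockZ n x) i))) μ := fun s =>
    integrable_comp_blockZ (F := fun u => dn (atomCost d) n u (fun i => s (c u i))) fun u => by
      simp only [hc, dn, atomCost_atomRep]
  exact integral_linear_combination (he fun v => empH k fun i => (v i).1)
    (he fun v => empH k fun i => (v i).2.1)
    (he fun v => empH2 k k1 (fun i => (v i).2.2) (fun i => (v i).1) (fun i => (v i).2.1))
    (hd fun e => e.1) (hd fun e => e.2.1) (hd fun e => e.2.2) γ1 γ2 γ0 α1 α2 α0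

lemma muGA_le_of_separated [NeZero n] [Fintype X] [Nonempty Xh] [MeasurableSingletonClass Xh]
    {μ : Measure (ℤ → X)} [IsProbabilityMeasure μ] (hμ : Ergodic shiftZ μ) (hd : ∀ x y, 0 ≤ d x y)
    (hγ1 : 0 ≤ γ1) (hγ2 : 0 ≤ γ2) (hγ0 : 0 ≤ γ0) (hα1 : 0 ≤ α1) (hα2 : 0 ≤ α2) (hα0 : 0 ≤ α0) :
    muGA μ d γ1 γ2 γ0 α1 α2 α0 ≤
      ∫ x, minMdCost (atomCost d) γ1 γ2 γ0 α1 α2 α0 k k1 (blockZ n x) ∂μ +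
        blockGap (Fintype.card Xh) γ1 γ2 γ0 0 k k1 n := by
  obtain ⟨c, hc, hopt⟩ := exists_optimal_code d γ1 γ2 γ0 α1 α2 α0 k k1 n
  have hn : 0 < n := Nat.pos_of_ne_zero (NeZero.ne n)
  obtain ⟨q, hq0, hq1, hq⟩ := exists_universal_assignment (A := Xh) (k := k) hn (fun _ b => b)
  choose r hr0 hr1 hr using fun v : Fin n → Xh × Xh =>
    exists_universal_assignment (A := Xh) (k := k) hn fun i b =>
      (b, fun j : Fin (2 * k1 + 1) => (v (cycIdx i ((j : ℤ) - (k1 : ℤ)))).1,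
        fun j : Fin (2 * k1 + 1) => (v (cycIdx i ((j : ℤ) - (k1 : ℤ)))).2)
  have key := muGA_le_of_code (c := c) hμ hd hc hγ1 hγ2 hγ0 hα1 hα2 hα0
    (r1 := codeCost c (fun e => e.1) (fun _ => ()) fun w _ => q w)
    (r2 := codeCost c (fun e => e.2.1) (fun _ => ()) fun w _ => q w)
    (r0 := codeCost c (fun e => e.2.2) (fun e => (e.1, e.2.1)) fun w v => r v w)
    (blockCost_nonneg _ _ _ _ (fun s _ => hq0 s) fun _ => hq1)
    (blockCost_nonneg _ _ _ _ (fun s _ => hq0 s) fun _ => hq1)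
    (blockCost_nonneg _ _ _ _ (fun s t => hr0 t s) fun t => hr1 t)
    (fun P hP hT => ⟨integrable_codeCost hc hT.measurable _ _ _,
      integrable_codeCost hc hT.measurable _ _ _, integrable_codeCost hc hT.measurable _ _ _⟩)
    (fun P hP hT => ⟨entropyRate_codeProcess_le hc hT (f := fun e => e.1) (by fun_prop) hq0 hq1,
      entropyRate_codeProcess_le hc hT (f := fun e => e.2.1) (by fun_prop) hq0 hq1,
      condEntropyRate_codeProcess_le hc hT (fun s t => hr0 t s) fun t => hr1 t⟩)
  refine key.trans (le_of_eq ?_)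
  have e1 := fun f : Xh × Xh × Xh → Xh => integral_prod_codeCost hμ.toMeasurePreserving hc f
    (fun _ => ()) (q := fun w _ => q w) (H := fun w _ => empH k w)
    (ρ := redundancy (Fintype.card Xh) (Fintype.card Xh ^ k) n k) fun w _ => by
      rw [hq w, redundancy]
      simp [empH]
  have e0 := integral_prod_codeCost hμ.toMeasurePreserving hc (fun e => e.2.2)
    (fun e => (e.1, e.2.1)) (q := fun w v => r v w)
    (H := fun w v => empH2 k k1 w (fun i => (v i).1) (fun i => (v i).2))
    (ρ := redundancy (Fintype.card Xh)
      (Fintype.card Xh ^ k * (Fintype.card Xh ^ (2 * k1 + 1) * Fintype.card Xh ^ (2 * k1 + 1))) n k)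
    fun w v => by
      rw [hr v w, redundancy]
      simp [empH2]
  rw [e1, e1, e0]
  simp only [← hopt]
  rw [integral_blockMdCost hc, blockGap]
  ring

end BlockBound

section NonSeparated

lemma ae_map_exists_phase_offset {Ω A : Type*} [MeasurableSpace Ω] [MeasurableSpace A] [Finite A]
    {P : Measure Ω} {T : Ω → Ω} {n : ℕ} [NeZero n] {p : Ω → ZMod n}
    (hpT : ∀ ω, p (T ω) = p ω + 1) {Ψ : Ω → ℤ → A} (hm : Measurable Ψ)
    (hΨ : ∀ ω, Ψ (T ω) = shiftZ (Ψ ω)) {B : Type*} [MeasurableSpace B] [Finite B] {f : A → B}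
    (hf : Measurable f) {a : B} (hp : ∀ ω, p ω = 0 → f (Ψ ω 0) = a) :
    ∀ᵐ x ∂(P.map Ψ), ∃ o : Fin n, ∀ b : ℕ, Indist a (f (x ((o : ℕ) + b * n + 1))) := by
  have hms : MeasurableSet
      {x : ℤ → A | ∃ o : Fin n, ∀ b : ℕ, Indist a (f (x ((o : ℕ) + b * n + 1)))} := by
    have : {x : ℤ → A | ∃ o : Fin n, ∀ b : ℕ, Indist a (f (x ((o : ℕ) + b * n + 1)))} =
        ⋃ o : Fin n, ⋂ b : ℕ, (fun x : ℤ → A => f (x ((o : ℕ) + b * n + 1))) ⁻¹'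
          {y | Indist a y} := by
      ext x
      simp
    rw [this]
    exact MeasurableSet.iUnion fun o => MeasurableSet.iInter fun b =>
      (hf.comp (measurable_pi_apply _)) (Indist.measurableSet a)
  rw [ae_map_iff hm.aemeasurable hms]
  refine Eventually.of_forall fun ω => ?_
  obtain ⟨o, ho⟩ := exists_phase_offset hpT ω
  refine ⟨o, fun b => ?_⟩
  have h := iterate_shift_eq hΨ ((o : ℕ) + b * n + 1) ω
  push_cast at h
  rw [← h, hp _ (ho b)]
  exact Indist.refl a

variable {X Xh : Type*} [MeasurableSpace X] [MeasurableSpace Xh] {n : ℕ} [NeZero n]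
  {c : (Fin n → X) → Fin n → Xh × Xh × Xh} {P : Measure ((ℤ → X) × ZMod n)}
  [IsProbabilityMeasure P]

lemma measurePreserving_shiftZ_map {Ω A : Type*} [MeasurableSpace Ω] [MeasurableSpace A]
    {P : Measure Ω} {T : Ω → Ω} (hT : MeasurePreserving T P P) {Ψ : Ω → ℤ → A} (hm : Measurable Ψ)
    (hΨ : ∀ ω, Ψ (T ω) = shiftZ (Ψ ω)) : MeasurePreserving shiftZ (P.map Ψ) (P.map Ψ) :=
  MeasurePreserving.of_semiconj ⟨hm, rfl⟩ hT hΨ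
    (measurable_pi_lambda _ fun _ => measurable_pi_apply _)

lemma entropyRate_codeProcess_eq_zero [Finite X] [Fintype Xh]
    (hc : ∀ u, c (fun i => atomRep (u i)) = c u)
    (hT : MeasurePreserving (phaseMap n shiftZ) P P) {a a' : Xh} (hne : a ≠ a') (ha : Indist a a')
    {f : Xh × Xh × Xh → Xh} (hf : Measurable f) (h0 : ∀ u, f (c u 0) = a) :
    entropyRate (P.map fun ω t => f (codeProcess c ω t).2) = 0 := by
  have hm := measurable_codeProcess_comp hc (hf.comp measurable_snd)
  have hΨ := codeProcess_comp_phaseMap (c := c) fun e => f e.2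
  have : IsProbabilityMeasure (P.map fun ω t => f (codeProcess c ω t).2) :=
    Measure.isProbabilityMeasure_map hm.aemeasurable
  refine entropyRate_eq_zero_of_nonatomic (measurePreserving_shiftZ_map hT hm hΨ) hne ha
    (Nat.pos_of_ne_zero (NeZero.ne n))
    (ae_map_exists_phase_offset (p := Prod.snd) (fun _ => rfl) hm hΨ measurable_id fun ω hω => ?_)
  obtain ⟨u, hu⟩ := codeProcess_snd_of_phase_eq_zero (c := c) (ω := ω) (t := 0) (by simpa using hω)
  simp only [id, Function.comp_apply, hu, h0]

lemma condEntropyRate_codeProcess_eq_zero [Finite X] [Fintype Xh]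
    (hc : ∀ u, c (fun i => atomRep (u i)) = c u)
    (hT : MeasurePreserving (phaseMap n shiftZ) P P) {a a' : Xh} (hne : a ≠ a') (ha : Indist a a')
    (h0 : ∀ u, (c u 0).2.2 = a) :
    condEntropyRate (P.map fun ω t => ((codeProcess c ω t).2.2.2, (codeProcess c ω t).2.1,
      (codeProcess c ω t).2.2.1)) = 0 := by
  have hm := measurable_codeProcess_comp hc (f := fun e => (e.2.2.2, e.2.1, e.2.2.1)) (by fun_prop)
  have hΨ := codeProcess_comp_phaseMap (c := c)
    fun e : X × Xh × Xh × Xh => (e.2.2.2, e.2.1, e.2.2.1)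
  have : IsProbabilityMeasure (P.map fun ω t => ((codeProcess c ω t).2.2.2,
      (codeProcess c ω t).2.1, (codeProcess c ω t).2.2.1)) :=
    Measure.isProbabilityMeasure_map hm.aemeasurable
  refine condEntropyRate_eq_zero_of_nonatomic (measurePreserving_shiftZ_map hT hm hΨ) hne ha
    (Nat.pos_of_ne_zero (NeZero.ne n))
    (ae_map_exists_phase_offset (p := Prod.snd) (fun _ => rfl) hm hΨ measurable_fst fun ω hω => ?_)
  obtain ⟨u, hu⟩ := codeProcess_snd_of_phase_eq_zero (c := c) (ω := ω) (t := 0) (by simpa using hω)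
  simp only [hu, h0]

end NonSeparated

lemma dn_le_add_of_eq_of_ne {X Xh : Type*} {n : ℕ} {e : X → Xh → ℝ} {M : ℝ}
    (he : ∀ x y, 0 ≤ e x y) (hM : ∀ x y, e x y ≤ M) {u u' : Fin n → X} {v v' : Fin n → Xh}
    {i₀ : Fin n} (h : ∀ i ≠ i₀, e (u i) (v i) = e (u' i) (v' i)) :
    dn e n u v ≤ dn e n u' v' + (n : ℝ)⁻¹ * M := by
  have h : ∑ i, e (u i) (v i) ≤ ∑ i, e (u' i) (v' i) + M := by
    rw [← Finset.add_sum_erase _ _ (Finset.mem_univ i₀),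
      ← Finset.add_sum_erase _ (fun i => e (u' i) (v' i)) (Finset.mem_univ i₀)]
    have h1 : ∑ i ∈ Finset.univ.erase i₀, e (u i) (v i) =
        ∑ i ∈ Finset.univ.erase i₀, e (u' i) (v' i) :=
      Finset.sum_congr rfl fun i hi => h i (Finset.ne_of_mem_erase hi)
    linarith [he (u' i₀) (v' i₀), hM (u i₀) (v i₀)]
  have hn : (0 : ℝ) ≤ (n : ℝ)⁻¹ := by positivity
  simp only [dn, one_div, ← mul_add]
  exact mul_le_mul_of_nonneg_left h hn

section BlockBound

variable {X Xh : Type*} [MeasurableSpace X] [MeasurableSpace Xh] {d : X → Xh → ℝ}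
  {γ1 γ2 γ0 α1 α2 α0 : ℝ} {k k1 n : ℕ}

lemma muGA_le_of_indist [NeZero n] [Fintype X] [Fintype Xh]
    {μ : Measure (ℤ → X)} [IsProbabilityMeasure μ] (hμ : Ergodic shiftZ μ) (hd : ∀ x y, 0 ≤ d x y)
    (hγ1 : 0 ≤ γ1) (hγ2 : 0 ≤ γ2) (hγ0 : 0 ≤ γ0) (hα1 : 0 ≤ α1) (hα2 : 0 ≤ α2) (hα0 : 0 ≤ α0)
    {a a' : Xh} (hne : a ≠ a') (ha : Indist a a') {M : ℝ} (hM : ∀ x y, d x y ≤ M) :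
    muGA μ d γ1 γ2 γ0 α1 α2 α0 ≤
      ∫ x, minMdCost (atomCost d) γ1 γ2 γ0 α1 α2 α0 k k1 (blockZ n x) ∂μ +
        (n : ℝ)⁻¹ * ((α1 + α2 + α0) * M) := by
  have : Nonempty Xh := ⟨a⟩
  have hn : 0 < n := Nat.pos_of_ne_zero (NeZero.ne n)
  obtain ⟨c, hc, hopt⟩ := exists_optimal_code d γ1 γ2 γ0 α1 α2 α0 k k1 n
  obtain ⟨c', hc'⟩ : ∃ c' : (Fin n → X) → Fin n → Xh × Xh × Xh,
      c' = fun u i => if i = 0 then (a, a, a) else c u i := ⟨_, rfl⟩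
  have hc'r : ∀ u, c' (fun i => atomRep (u i)) = c' u := fun u => by simp only [hc', hc]
  have h0 : ∀ u, c' u 0 = (a, a, a) := fun u => by simp [hc']
  have hne0 : ∀ u, ∀ i ≠ 0, c' u i = c u i := fun u i hi => by simp [hc', hi]
  have key := muGA_le_of_code (c := c') hμ hd hc'r hγ1 hγ2 hγ0 hα1 hα2 hα0
    (r1 := 0) (r2 := 0) (r0 := 0) (fun _ => le_rfl) (fun _ => le_rfl) (fun _ => le_rfl)
    (fun P hP hT => ⟨integrable_zero _ _ _, integrable_zero _ _ _, integrable_zero _ _ _⟩)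
    (fun P hP hT => by
      simp only [Pi.zero_apply, integral_zero]
      exact ⟨(entropyRate_codeProcess_eq_zero hc'r hT hne ha (f := fun e => e.1) (by fun_prop)
          fun u => by rw [h0]).le,
        (entropyRate_codeProcess_eq_zero hc'r hT hne ha (f := fun e => e.2.1) (by fun_prop)
          fun u => by rw [h0]).le,
        (condEntropyRate_codeProcess_eq_zero hc'r hT hne ha fun u => by rw [h0]).le⟩)
  have hdist : ∀ s : Xh × Xh × Xh → Xh,
      ∫ x, dn (atomCost d) n (blockZ n x) (fun i => s (c' (blockZ n x) i)) ∂μ ≤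
        ∫ x, dn (atomCost d) n (blockZ n x) (fun i => s (c (blockZ n x) i)) ∂μ +
          (n : ℝ)⁻¹ * M := fun s => by
    have hi : ∀ c : (Fin n → X) → Fin n → Xh × Xh × Xh,
        (∀ u, c (fun i => atomRep (u i)) = c u) → Integrable
          (fun x => dn (atomCost d) n (blockZ n x) (fun i => s (c (blockZ n x) i))) μ :=
      fun c hc => integrable_comp_blockZ
        (F := fun u => dn (atomCost d) n u (fun i => s (c u i))) fun u => by
          simp only [hc, dn, atomCost_atomRep]
    refine (integral_mono (hi c' hc'r) ((hi c hc).fun_add (integrable_const ((n : ℝ)⁻¹ * M)))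
      fun x => dn_le_add_of_eq_of_ne (i₀ := 0) (fun x y => atomCost_nonneg hd x y)
        (fun x y => (atomCost_le x y).trans (hM x y)) fun i hi =>
          congrArg (fun v => atomCost d (blockZ n x i) (s v)) (hne0 _ i hi)).trans_eq ?_
    rw [integral_add (hi c hc) (integrable_const _)]
    simp
  simp only [Pi.zero_apply, integral_zero, mul_zero, zero_add] at key
  simp only [← hopt]
  rw [integral_blockMdCost hc]
  have e1 := mul_nonneg hγ1 (integral_nonneg (μ := μ) fun x =>
    empH_nonneg (k := k) hn fun i => (c (blockZ n x) i).1)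
  have e2 := mul_nonneg hγ2 (integral_nonneg (μ := μ) fun x =>
    empH_nonneg (k := k) hn fun i => (c (blockZ n x) i).2.1)
  have e0 := mul_nonneg hγ0 (integral_nonneg (μ := μ) fun x =>
    empH2_nonneg (k := k) (k1 := k1) hn (fun i => (c (blockZ n x) i).2.2)
      (fun i => (c (blockZ n x) i).1) fun i => (c (blockZ n x) i).2.1)
  have d1 := mul_le_mul_of_nonneg_left (hdist fun e => e.1) hα1
  have d2 := mul_le_mul_of_nonneg_left (hdist fun e => e.2.1) hα2
  have d0 := mul_le_mul_of_nonneg_left (hdist fun e => e.2.2) hα0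
  simp only [mul_add] at d1 d2 d0
  linarith

/-- `μ(γ, α)` is at most the mean minimal cost of blocks of length `n`, up to `blockGap`. -/
lemma muGA_le_integral_minMdCost [NeZero n] [Fintype X] [Fintype Xh] [Nonempty Xh]
    {μ : Measure (ℤ → X)} [IsProbabilityMeasure μ] (hμ : Ergodic shiftZ μ) (hd : ∀ x y, 0 ≤ d x y)
    (hγ1 : 0 ≤ γ1) (hγ2 : 0 ≤ γ2) (hγ0 : 0 ≤ γ0) (hα1 : 0 ≤ α1) (hα2 : 0 ≤ α2) (hα0 : 0 ≤ α0)
    {M : ℝ} (hM0 : 0 ≤ M) (hM : ∀ x y, d x y ≤ M) :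
    muGA μ d γ1 γ2 γ0 α1 α2 α0 ≤
      ∫ x, minMdCost (atomCost d) γ1 γ2 γ0 α1 α2 α0 k k1 (blockZ n x) ∂μ +
        blockGap (Fintype.card Xh) γ1 γ2 γ0 ((α1 + α2 + α0) * M) k k1 n := by
  have hr : ∀ c, 0 ≤ redundancy (Fintype.card Xh) c n k := fun c => redundancy_nonneg _ _ _ _
  by_cases h : ∃ a a' : Xh, a ≠ a' ∧ Indist a a'
  · obtain ⟨a, a', hne, ha⟩ := h
    refine (muGA_le_of_indist (k := k) (k1 := k1) (n := n) hμ hd hγ1 hγ2 hγ0 hα1 hα2 hα0 hne ha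
      hM).trans ?_
    unfold blockGap
    gcongr
    exact le_add_of_nonneg_left (add_nonneg (mul_nonneg (by positivity) (hr _))
      (mul_nonneg hγ0 (hr _)))
  · have : MeasurableSingletonClass Xh := measurableSingletonClass_of_indist fun a b hab => by
      by_contra hne
      exact h ⟨a, b, hne, hab⟩
    refine (muGA_le_of_separated (k := k) (k1 := k1) (n := n) hμ hd hγ1 hγ2 hγ0 hα1 hα2
      hα0).trans ?_
    unfold blockGap
    gcongr
    positivity

end BlockBound

section Gap

lemma tendsto_inv_mul_redundancy {a : ℕ} (ha : 0 < a) {k : ℕ → ℕ}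
    (hk : Tendsto (fun n : ℕ => (k n : ℝ) / Real.log n) atTop (nhds 0)) {c : ℕ → ℕ}
    (hc : ∀ n, c n ≤ a ^ (5 * k n + 2)) :
    Tendsto (fun n : ℕ => (n : ℝ)⁻¹ * redundancy a (c n) n (k n)) atTop (nhds 0) := by
  have ha1 : (1 : ℝ) ≤ a := by exact_mod_cast ha
  have hla : 0 ≤ Real.logb 2 (a : ℝ) := Real.logb_nonneg one_lt_two ha1
  have hl2 : 0 < Real.log 2 := Real.log_pos one_lt_two
  have hlog : Tendsto (fun n : ℕ => Real.log n) atTop atTop :=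
    Real.tendsto_log_atTop.comp tendsto_natCast_atTop_atTop
  have hexp : Tendsto (fun n : ℕ => (5 * (k n : ℝ) + 3) * Real.log a / Real.log n) atTop
      (nhds 0) := by
    have h1 := ((hk.const_mul 5).add (tendsto_const_nhds (x := (3 : ℝ)).div_atTop hlog)).mul_const
      (Real.log a)
    simp only [mul_zero, add_zero, zero_mul] at h1
    refine h1.congr fun n => ?_
    ring
  have hlim : Tendsto (fun n : ℕ => (2 / Real.log 2 + 2 * Real.logb 2 a) *
      (Real.log ((n : ℝ) + 1) / ((n : ℝ) + 1) ^ (1 / 2 : ℝ))) atTop (nhds 0) := by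
    have h := (isLittleO_log_rpow_atTop (r := 1 / 2) (by norm_num)).tendsto_div_nhds_zero.comp
      (tendsto_natCast_atTop_atTop.atTop_add (tendsto_const_nhds (x := (1 : ℝ))))
    simpa using h.const_mul (2 / Real.log 2 + 2 * Real.logb 2 a)
  refine tendsto_of_tendsto_of_tendsto_of_le_of_le' tendsto_const_nhds hlim
    (Eventually.of_forall fun n => mul_nonneg (by positivity) (redundancy_nonneg _ _ _ _)) ?_
  filter_upwards [hk.eventually (ge_mem_nhds zero_lt_one),
    hexp.eventually (ge_mem_nhds (show (0 : ℝ) < 1 / 2 by norm_num)), hlog.eventually_gt_atTop 0,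
    eventually_ge_atTop 1] with n h1 h2 h3 h4
  have hn : (1 : ℝ) ≤ n := by exact_mod_cast h4
  rw [div_le_iff₀ h3] at h1 h2
  have hLn : Real.log n ≤ Real.log ((n : ℝ) + 1) := Real.log_le_log (by linarith) (by linarith)
  set L := Real.log ((n : ℝ) + 1) with hL
  set s := ((n : ℝ) + 1) ^ (1 / 2 : ℝ) with hs
  have hs1 : 1 ≤ s := Real.one_le_rpow (by linarith) (by norm_num)
  have hss : s * s = (n : ℝ) + 1 := by
    rw [hs, ← Real.rpow_add (by linarith)]
    norm_num
  have hac : (a : ℝ) * c n ≤ s := by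
    calc (a : ℝ) * c n ≤ a * a ^ (5 * k n + 2) := by
          gcongr
          exact_mod_cast hc n
      _ = Real.exp ((5 * (k n : ℝ) + 3) * Real.log a) := by
          rw [← pow_succ', mul_comm _ (Real.log a), ← Real.rpow_def_of_pos (by linarith),
            ← Real.rpow_natCast]
          push_cast
          ring_nf
      _ ≤ Real.exp (1 / 2 * L) := Real.exp_le_exp.2 (by linarith)
      _ = s := by
          rw [hs, Real.rpow_def_of_pos (by linarith), mul_comm]
  have hL0 : 0 ≤ L := h3.le.trans hLn
  have hred : redundancy a (c n) n (k n) ≤ s * (L / Real.log 2) + s * (L * Real.logb 2 a) := by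
    unfold redundancy
    refine add_le_add (mul_le_mul_of_nonneg_right hac (by rw [Real.logb]; positivity)) ?_
    calc (k n : ℝ) * Real.logb 2 a ≤ L * Real.logb 2 a := by
          gcongr
          linarith
      _ ≤ s * (L * Real.logb 2 a) := le_mul_of_one_le_left (by positivity) hs1
  have hinv : (n : ℝ)⁻¹ ≤ 2 * (s * s)⁻¹ := by
    rw [hss, inv_le_iff_one_le_mul₀ (by linarith), ← div_eq_mul_inv, div_mul_eq_mul_div,
      le_div_iff₀ (by linarith)]
    linarith
  calc (n : ℝ)⁻¹ * redundancy a (c n) n (k n)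
      ≤ 2 * (s * s)⁻¹ * (s * (L / Real.log 2) + s * (L * Real.logb 2 a)) := by
        gcongr
        exact redundancy_nonneg _ _ _ _
    _ = (2 / Real.log 2 + 2 * Real.logb 2 a) * (L / s) := by
        field_simp

lemma tendsto_blockGap {a : ℕ} (ha : 0 < a) (γ1 γ2 γ0 M : ℝ) {k k1 : ℕ → ℕ}
    (hk1 : ∀ n, k1 n ≤ k n)
    (hk : Tendsto (fun n : ℕ => (k n : ℝ) / Real.log n) atTop (nhds 0)) :
    Tendsto (fun n => blockGap a γ1 γ2 γ0 M (k n) (k1 n) n) atTop (nhds 0) := by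
  have h1 := tendsto_inv_mul_redundancy ha hk (c := fun n => a ^ k n) fun n =>
    Nat.pow_le_pow_right ha (by omega)
  have h2 := tendsto_inv_mul_redundancy ha hk
    (c := fun n => a ^ k n * (a ^ (2 * k1 n + 1) * a ^ (2 * k1 n + 1))) fun n => by
      rw [← pow_add, ← pow_add]
      exact Nat.pow_le_pow_right ha (by have := hk1 n; omega)
  have h := ((h1.const_mul (γ1 + γ2)).add (h2.const_mul γ0)).add
    ((tendsto_inv_atTop_nhds_zero_nat (𝕜 := ℝ)).mul_const M)
  simp only [mul_zero, zero_mul, add_zero] at h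
  refine h.congr fun n => ?_
  rw [blockGap]
  ring

end Gap

section Rotation

lemma cycIdx_cycIdx {n : ℕ} (i : Fin n) (s t : ℤ) : cycIdx (cycIdx i s) t = cycIdx i (s + t) := by
  have hn : (0 : ℤ) < n := by exact_mod_cast i.pos
  apply Fin.ext
  simp only [cycIdx]
  rw [Int.toNat_of_nonneg (Int.emod_nonneg _ hn.ne'), Int.emod_add_emod, add_assoc]

lemma cycIdx_zero {n : ℕ} (i : Fin n) : cycIdx i 0 = i := by
  apply Fin.ext
  simp only [cycIdx, add_zero]
  rw [Int.emod_eq_of_lt (by positivity) (by exact_mod_cast i.2)]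
  simp

lemma cycIdx_val_of_lt {n : ℕ} {i : Fin n} (h : (i : ℕ) + 1 < n) :
    ((cycIdx i 1 : Fin n) : ℕ) = i + 1 := by
  simp only [cycIdx]
  rw [Int.emod_eq_of_lt (by positivity) (by exact_mod_cast h)]
  omega

/-- The cyclic shift of `Fin n`. -/
def cycEquiv (n : ℕ) : Equiv.Perm (Fin n) where
  toFun i := cycIdx i 1
  invFun i := cycIdx i (-1)
  left_inv i := by simp [cycIdx_cycIdx, cycIdx_zero]
  right_inv i := by simp [cycIdx_cycIdx, cycIdx_zero]

lemma cycEquiv_cycIdx {n : ℕ} (i : Fin n) (t : ℤ) :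
    cycEquiv n (cycIdx i t) = cycIdx (cycEquiv n i) t := by
  simp only [cycEquiv, Equiv.coe_fn_mk, cycIdx_cycIdx, add_comm]

lemma measure_uniformFin_preimage {n : ℕ} (e : Equiv.Perm (Fin n)) (s : Set (Fin n)) :
    uniformFin n (e ⁻¹' s) = uniformFin n s := by
  rw [uniformFin, Measure.smul_apply, Measure.smul_apply,
    Measure.count_apply MeasurableSpace.measurableSet_top,
    Measure.count_apply MeasurableSpace.measurableSet_top, ← Equiv.image_symm_eq_preimage,
    e.symm.injective.encard_image]

lemma shEntropy_uniformFin_comp {n : ℕ} {A : Type*} [Fintype A] (S : Fin n → A)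
    (e : Equiv.Perm (Fin n)) :
    shEntropy (uniformFin n) (fun i => S (e i)) = shEntropy (uniformFin n) S := by
  simp only [shEntropy]
  congr 1
  refine Finset.sum_congr rfl fun s _ => ?_
  rw [← measure_uniformFin_preimage e (S ⁻¹' {s})]
  rfl

lemma shCondEntropy_uniformFin_comp {n : ℕ} {A B : Type*} [Fintype A] [Fintype B] (S : Fin n → A)
    (T : Fin n → B) (e : Equiv.Perm (Fin n)) :
    shCondEntropy (uniformFin n) (fun i => S (e i)) (fun i => T (e i)) =
      shCondEntropy (uniformFin n) S T := by
  rw [shCondEntropy, shCondEntropy, shEntropy_uniformFin_comp T e,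
    ← shEntropy_uniformFin_comp (fun i => (S i, T i)) e]

variable {X Xh : Type*} {n k k1 : ℕ}

lemma empH_cycEquiv [Fintype Xh] (y : Fin n → Xh) :
    empH k (fun i => y (cycEquiv n i)) = empH k y := by
  simp only [empH, cycEquiv_cycIdx]
  exact shCondEntropy_uniformFin_comp y
    (fun i (j : Fin k) => y (cycIdx i ((j : ℤ) - (k : ℤ)))) (cycEquiv n)

lemma empH2_cycEquiv [Fintype Xh] (w y z : Fin n → Xh) :
    empH2 k k1 (fun i => w (cycEquiv n i)) (fun i => y (cycEquiv n i))
      (fun i => z (cycEquiv n i)) = empH2 k k1 w y z := by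
  simp only [empH2, cycEquiv_cycIdx]
  exact shCondEntropy_uniformFin_comp w
    (fun i => (fun j : Fin k => w (cycIdx i ((j : ℤ) - (k : ℤ))),
      fun j : Fin (2 * k1 + 1) => y (cycIdx i ((j : ℤ) - (k1 : ℤ))),
      fun j : Fin (2 * k1 + 1) => z (cycIdx i ((j : ℤ) - (k1 : ℤ))))) (cycEquiv n)

lemma dn_shiftZ_le [NeZero n] {e : X → Xh → ℝ} {M : ℝ} (he : ∀ x y, 0 ≤ e x y)
    (hM : ∀ x y, e x y ≤ M) (x : ℤ → X) (y : Fin n → Xh) :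
    dn e n (blockZ n (shiftZ x)) (fun i => y (cycEquiv n i)) ≤
      dn e n (blockZ n x) y + (n : ℝ)⁻¹ * M := by
  have hn : 0 < n := Nat.pos_of_ne_zero (NeZero.ne n)
  have h : dn e n (blockZ n x) y =
      dn e n (fun i => blockZ n x (cycEquiv n i)) (fun i => y (cycEquiv n i)) := by
    simp only [dn]
    rw [← Equiv.sum_comp (cycEquiv n)]
  rw [h]
  refine dn_le_add_of_eq_of_ne he hM (i₀ := ⟨n - 1, by omega⟩) fun i hi => ?_
  have hi' : (i : ℕ) + 1 < n := by
    have := i.2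
    have : (i : ℕ) ≠ n - 1 := fun h => hi (Fin.ext h)
    omega
  simp only [blockZ, shiftZ, cycEquiv, Equiv.coe_fn_mk, cycIdx_val_of_lt hi']
  push_cast
  rfl

lemma minMdCost_shiftZ_le [NeZero n] [Fintype Xh] [Nonempty Xh] {e : X → Xh → ℝ} {M : ℝ}
    (he : ∀ x y, 0 ≤ e x y) (hM : ∀ x y, e x y ≤ M) {γ1 γ2 γ0 α1 α2 α0 : ℝ} (hα1 : 0 ≤ α1)
    (hα2 : 0 ≤ α2) (hα0 : 0 ≤ α0) (x : ℤ → X) :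
    minMdCost e γ1 γ2 γ0 α1 α2 α0 k k1 (blockZ n (shiftZ x)) ≤
      minMdCost e γ1 γ2 γ0 α1 α2 α0 k k1 (blockZ n x) + (n : ℝ)⁻¹ * ((α1 + α2 + α0) * M) := by
  obtain ⟨⟨y, z, w⟩, ht⟩ := exists_eq_minMdCost (d := e) (γ1 := γ1) (γ2 := γ2) (γ0 := γ0)
    (α1 := α1) (α2 := α2) (α0 := α0) (k := k) (k1 := k1) (blockZ n x)
  rw [← ht]
  refine (ciInf_le (Set.finite_range _).bddBelow (fun i => y (cycEquiv n i),
    fun i => z (cycEquiv n i), fun i => w (cycEquiv n i))).trans ?_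
  simp only [blockMdCost, empH_cycEquiv, empH2_cycEquiv]
  have d1 := mul_le_mul_of_nonneg_left (dn_shiftZ_le he hM x y) hα1
  have d2 := mul_le_mul_of_nonneg_left (dn_shiftZ_le he hM x z) hα2
  have d0 := mul_le_mul_of_nonneg_left (dn_shiftZ_le he hM x w) hα0
  simp only [mul_add] at d1 d2 d0
  linarith

end Rotation

section ErgodicLimsup

variable {α : Type*} [MeasurableSpace α] {μ : Measure α} [IsProbabilityMeasure μ] {T : α → α}

/-- If the means of a bounded, asymptotically shift-subinvariant sequence of functions are
asymptotically at least `m`, then so is its limit superior, almost everywhere. -/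
lemma ae_le_limsup_of_ergodic (hT : Ergodic T μ) {f : ℕ → α → ℝ} (hf : ∀ n, Measurable (f n))
    {C m : ℝ} {δ ε : ℕ → ℝ} (h0 : ∀ᶠ n in atTop, ∀ x, 0 ≤ f n x)
    (hC : ∀ᶠ n in atTop, ∀ x, f n x ≤ C) (hs : ∀ᶠ n in atTop, ∀ x, f n (T x) ≤ f n x + δ n)
    (hδ : Tendsto δ atTop (nhds 0)) (hε : Tendsto ε atTop (nhds 0))
    (hm : ∀ᶠ n in atTop, m ≤ ∫ x, f n x ∂μ + ε n) :
    ∀ᵐ x ∂μ, m ≤ limsup (fun n => f n x) atTop := by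
  have hb : ∀ x, IsBoundedUnder (· ≤ ·) atTop fun n => f n x := fun x =>
    isBoundedUnder_of_eventually_le (hC.mono fun n h => h x)
  have hcb : ∀ x, IsCoboundedUnder (· ≤ ·) atTop fun n => f n x := fun x =>
    IsBoundedUnder.isCoboundedUnder_le (isBoundedUnder_of_eventually_ge (h0.mono fun n h => h x))
  have key : ∀ c < m, ∀ᵐ x ∂μ, c ≤ limsup (fun n => f n x) atTop := by
    intro c hc
    have hA : MeasurableSet {x | limsup (fun n => f n x) atTop < c} :=
      measurableSet_lt (Measurable.limsup hf) measurable_const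
    have hsub : {x | limsup (fun n => f n x) atTop < c} ⊆
        T ⁻¹' {x | limsup (fun n => f n x) atTop < c} := by
      intro x hx
      obtain ⟨q, hq, hqc⟩ := exists_between (show limsup (fun n => f n x) atTop < c from hx)
      refine lt_of_le_of_lt (b := (q + c) / 2) (limsup_le_of_le (hcb (T x)) ?_) (by linarith)
      filter_upwards [eventually_lt_of_limsup_lt hq (hb x), hs,
        hδ.eventually (gt_mem_nhds (show (0 : ℝ) < (c - q) / 2 by linarith))] with n h1 h2 h3
      linarith [h2 x]
    rcases hT.ae_empty_or_univ_of_ae_le_preimage hA.nullMeasurableSet hsub.eventuallyLE with h | h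
    · filter_upwards [h.mem_iff] with x hx
      simpa using hx
    · exfalso
      have hlim : Tendsto (fun n => ∫ x, max (f n x) c ∂μ) atTop (nhds (∫ _, c ∂μ)) := by
        refine tendsto_integral_filter_of_dominated_convergence (fun _ => |C| + |c|)
          (Eventually.of_forall fun n => ((hf n).max measurable_const).aestronglyMeasurable) ?_
          (integrable_const _) ?_
        · filter_upwards [h0, hC] with n h1 h2
          refine Eventually.of_forall fun x => ?_
          rw [Real.norm_eq_abs]
          refine abs_max_le_max_abs_abs.trans (max_le ?_ ?_)
          · rw [abs_of_nonneg (h1 x)]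
            linarith [h2 x, le_abs_self C, abs_nonneg c]
          · linarith [abs_nonneg C]
        · filter_upwards [h.mem_iff] with x hx
          have hx' : limsup (fun n => f n x) atTop < c := by simpa using hx
          refine tendsto_const_nhds.congr' ?_
          filter_upwards [eventually_lt_of_limsup_lt hx' (hb x)] with n hn
          exact (max_eq_right hn.le).symm
      have hcost : ∀ᶠ n in atTop, m ≤ ∫ x, max (f n x) c ∂μ + ε n := by
        filter_upwards [hm, h0, hC] with n h1 h2 h3
        have hi : Integrable (f n) μ := Integrable.of_bound (hf n).aestronglyMeasurable C
          (Eventually.of_forall fun x => by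
            rw [Real.norm_eq_abs, abs_of_nonneg (h2 x)]
            exact h3 x)
        have h4 : ∫ x, f n x ∂μ ≤ ∫ x, max (f n x) c ∂μ :=
          integral_mono hi (hi.sup (integrable_const c)) fun x => le_max_left (f n x) c
        linarith
      have := ge_of_tendsto (hlim.add hε) hcost
      simp only [integral_const, probReal_univ, one_smul, add_zero] at this
      linarith
  have hall : ∀ᵐ x ∂μ, ∀ q : ℚ, (q : ℝ) < m → (q : ℝ) ≤ limsup (fun n => f n x) atTop :=
    ae_all_iff.2 fun q => by
      by_cases hq : (q : ℝ) < m
      · filter_upwards [key q hq] with x hx _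
        exact hx
      · exact Eventually.of_forall fun x h => absurd h hq
  filter_upwards [hall] with x hx
  exact le_of_forall_rat_lt_imp_le hx

end ErgodicLimsup

section MinimalCost

variable {X Xh : Type*} {d : X → Xh → ℝ} {n : ℕ}

lemma dn_mono {e : X → Xh → ℝ} (h : ∀ x y, d x y ≤ e x y) (u : Fin n → X) (v : Fin n → Xh) :
    dn d n u v ≤ dn e n u v :=
  mul_le_mul_of_nonneg_left (Finset.sum_le_sum fun _ _ => h _ _) (by positivity)

lemma dn_le (hn : 0 < n) {M : ℝ} (hM : ∀ x y, d x y ≤ M) (u : Fin n → X) (v : Fin n → Xh) :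
    dn d n u v ≤ M := by
  refine (dn_mono hM u v).trans_eq ?_
  simp [dn, hn.ne']

variable [Fintype Xh] {γ1 γ2 γ0 α1 α2 α0 : ℝ} {k k1 : ℕ}

lemma minMdCost_nonneg (hn : 0 < n) (hd : ∀ x y, 0 ≤ d x y) (hγ1 : 0 ≤ γ1) (hγ2 : 0 ≤ γ2)
    (hγ0 : 0 ≤ γ0) (hα1 : 0 ≤ α1) (hα2 : 0 ≤ α2) (hα0 : 0 ≤ α0) (u : Fin n → X) :
    0 ≤ minMdCost d γ1 γ2 γ0 α1 α2 α0 k k1 u := by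
  refine Real.iInf_nonneg fun t => ?_
  have h1 := empH_nonneg (k := k) hn t.1
  have h2 := empH_nonneg (k := k) hn t.2.1
  have h0 := empH2_nonneg (k := k) (k1 := k1) hn t.2.2 t.1 t.2.1
  have h3 := dn_nonneg hd u t.1
  have h4 := dn_nonneg hd u t.2.1
  have h5 := dn_nonneg hd u t.2.2
  unfold blockMdCost
  positivity

lemma minMdCost_mono {e : X → Xh → ℝ} (h : ∀ x y, d x y ≤ e x y) (hα1 : 0 ≤ α1) (hα2 : 0 ≤ α2)
    (hα0 : 0 ≤ α0) (u : Fin n → X) :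
    minMdCost d γ1 γ2 γ0 α1 α2 α0 k k1 u ≤ minMdCost e γ1 γ2 γ0 α1 α2 α0 k k1 u := by
  refine ciInf_mono (Set.finite_range _).bddBelow fun t => ?_
  unfold blockMdCost
  gcongr <;> exact dn_mono h _ _

lemma minMdCost_le [Nonempty Xh] (hn : 0 < n) {M : ℝ} (hM : ∀ x y, d x y ≤ M) (hγ1 : 0 ≤ γ1)
    (hγ2 : 0 ≤ γ2) (hγ0 : 0 ≤ γ0) (hα1 : 0 ≤ α1) (hα2 : 0 ≤ α2) (hα0 : 0 ≤ α0) (u : Fin n → X) :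
    minMdCost d γ1 γ2 γ0 α1 α2 α0 k k1 u ≤
      (γ1 + γ2 + γ0) * Real.logb 2 (Fintype.card Xh) + (α1 + α2 + α0) * M := by
  have := isProbabilityMeasure_uniformFin hn
  obtain ⟨t, ht⟩ := exists_eq_minMdCost (d := d) (γ1 := γ1) (γ2 := γ2) (γ0 := γ0)
    (α1 := α1) (α2 := α2) (α0 := α0) (k := k) (k1 := k1) u
  have h1 : ∀ y : Fin n → Xh, empH k y ≤ Real.logb 2 (Fintype.card Xh) := fun y =>
    shCondEntropy_le_log_card (fiberMeasurable_fin _) (fiberMeasurable_fin _)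
  have h0 : empH2 k k1 t.2.2 t.1 t.2.1 ≤ Real.logb 2 (Fintype.card Xh) :=
    shCondEntropy_le_log_card (fiberMeasurable_fin _) (fiberMeasurable_fin _)
  rw [← ht]
  calc blockMdCost d γ1 γ2 γ0 α1 α2 α0 k k1 u t
      ≤ γ1 * Real.logb 2 (Fintype.card Xh) + γ2 * Real.logb 2 (Fintype.card Xh) +
        γ0 * Real.logb 2 (Fintype.card Xh) + α1 * M + α2 * M + α0 * M := by
        unfold blockMdCost
        gcongr
        exacts [h1 _, h1 _, dn_le hn hM _ _, dn_le hn hM _ _, dn_le hn hM _ _]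
    _ = _ := by ring

end MinimalCost

/-- **Converse half of the paper's Theorem 3.** Almost surely, the limsup of the minimal
cost `min_{(y^n, z^n, w^n)} ℰ_n(y^n, z^n, w^n)` is at least `μ(γ, α)`: no coding
strategy can asymptotically beat `μ(γ, α)` on a set of nonzero probability. -/
theorem universal_md_converse {X Xh : Type*} [Fintype X] [Fintype Xh]
    [Nonempty Xh] [MeasurableSpace X] [MeasurableSpace Xh]
    (μ : Measure (ℤ → X)) [IsProbabilityMeasure μ] (hX : Ergodic shiftZ μ)
    (d : X → Xh → ℝ) (hd : ∀ a b, 0 ≤ d a b)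
    (γ1 γ2 γ0 α1 α2 α0 : ℝ)
    (hγ1 : 0 ≤ γ1) (hγ2 : 0 ≤ γ2) (hγ0 : 0 ≤ γ0)
    (hα1 : 0 ≤ α1) (hα2 : 0 ≤ α2) (hα0 : 0 ≤ α0)
    (k k1 : ℕ → ℕ) (hk1k : ∀ n, k1 n ≤ k n)
    (hklog : Tendsto (fun n : ℕ => (k n : ℝ) / Real.log n) atTop (nhds 0))
    (hk : Tendsto k atTop atTop) (hk1 : Tendsto k1 atTop atTop) :
    ∀ᵐ x ∂μ,
      muGA μ d γ1 γ2 γ0 α1 α2 α0 ≤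
        limsup (fun n : ℕ =>
          ⨅ t : (Fin n → Xh) × (Fin n → Xh) × (Fin n → Xh),
            mdCost d γ1 γ2 γ0 α1 α2 α0 (k n) (k1 n) x t.1 t.2.1 t.2.2) atTop := by
  obtain ⟨M, hM0, hM⟩ : ∃ M : ℝ, 0 ≤ M ∧ ∀ x y, d x y ≤ M := by
    refine ⟨∑ x, ∑ y, d x y, Finset.sum_nonneg fun x _ => Finset.sum_nonneg fun y _ => hd x y,
      fun x y => ?_⟩
    exact (Finset.single_le_sum (fun y _ => hd x y) (Finset.mem_univ y)).trans
      (Finset.single_le_sum (f := fun x => ∑ y, d x y)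
        (fun x _ => Finset.sum_nonneg fun y _ => hd x y) (Finset.mem_univ x))
  have hM' : ∀ x y, atomCost d x y ≤ M := fun x y => (atomCost_le x y).trans (hM x y)
  have hd' : ∀ x y, 0 ≤ atomCost d x y := fun x y => atomCost_nonneg hd x y
  have hpos := eventually_gt_atTop (0 : ℕ)
  have key := ae_le_limsup_of_ergodic hX
    (f := fun n x => minMdCost (atomCost d) γ1 γ2 γ0 α1 α2 α0 (k n) (k1 n) (blockZ n x))
    (m := muGA μ d γ1 γ2 γ0 α1 α2 α0)
    (fun n => by
      have h := (fiberMeasurable_atomRep_blockZ (X := X) (n := n)).measurable_comp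
        (minMdCost (atomCost d) γ1 γ2 γ0 α1 α2 α0 (k n) (k1 n))
      simpa only [minMdCost_atomRep] using h)
    (hpos.mono fun n hn x => minMdCost_nonneg hn hd' hγ1 hγ2 hγ0 hα1 hα2 hα0 _)
    (hpos.mono fun n hn x => minMdCost_le hn hM' hγ1 hγ2 hγ0 hα1 hα2 hα0 _)
    (hpos.mono fun n hn x => by
      have : NeZero n := ⟨hn.ne'⟩
      exact minMdCost_shiftZ_le hd' hM' hα1 hα2 hα0 x)
    (by simpa using (tendsto_inv_atTop_nhds_zero_nat (𝕜 := ℝ)).mul_const ((α1 + α2 + α0) * M))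
    (tendsto_blockGap Fintype.card_pos γ1 γ2 γ0 ((α1 + α2 + α0) * M) hk1k hklog)
    (hpos.mono fun n hn => by
      have : NeZero n := ⟨hn.ne'⟩
      exact muGA_le_integral_minMdCost hX hd hγ1 hγ2 hγ0 hα1 hα2 hα0 hM0 hM)
  filter_upwards [key] with x hx
  refine hx.trans (limsup_le_limsup (v := fun n =>
    minMdCost d γ1 γ2 γ0 α1 α2 α0 (k n) (k1 n) (blockZ n x))
    (Eventually.of_forall fun n => minMdCost_mono atomCost_le hα1 hα2 hα0 _) ?_ ?_)
  · exact IsBoundedUnder.isCoboundedUnder_le (isBoundedUnder_of_eventually_ge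
      (hpos.mono fun n hn => minMdCost_nonneg hn hd' hγ1 hγ2 hγ0 hα1 hα2 hα0 _))
  · exact isBoundedUnder_of_eventually_le
      (hpos.mono fun n hn => minMdCost_le hn hM hγ1 hγ2 hγ0 hα1 hα2 hα0 _)
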